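/- Let G be a finitely generated group such that there exists c > 0 with a_n(G) ≥ c·n for all n ≥ 1, and assume hypothesis (★) holds with α ≥ 2. Fix a real x > 0. Then the normalized random variables (K_{G,n} − E[K_{G,n}])/√Var(K_{G,n}) converge to the standard Gaussian: for every bounded continuous function f : ℝ → ℝ, and also for every polynomial function f : ℝ → ℝ, one has lim_{n→∞} E[f((K_{G,n} − E[K_{G,n}])/√Var(K_{G,n}))] = (1/√(2π)) ∫_{−∞}^{∞} f(s) e^{−s²/2} ds. -/

import Mathlib

open scoped BigOperators

/-- `a_n(G)`: the number of subgroups of `G` of index exactly `n`. -/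
noncomputable def aCount (G : Type*) [Group G] (n : ℕ) : ℕ :=
  Nat.card {H : Subgroup G // H.index = n}

/-- `c(φ)`: the number of orbits of the action of `G` on `Fin n` induced by
`φ : G →* Equiv.Perm (Fin n)` (equivalently, the orbits of the range of `φ`). -/
noncomputable def numOrbits {G : Type*} [Group G] {n : ℕ} (φ : G →* Equiv.Perm (Fin n)) : ℕ :=
  Nat.card (Quotient (MulAction.orbitRel φ.range (Fin n)))

/-- The expectation `E[f(K_{G,n})]` for the `x`-biased measure on `Hom(G, S_n)`. -/
noncomputable def expVal (G : Type*) [Group G] (n : ℕ) (x : ℝ) (f : ℝ → ℝ) : ℝ :=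
  (∑ᶠ φ : G →* Equiv.Perm (Fin n), f (numOrbits φ) * x ^ numOrbits φ) /
    (∑ᶠ φ : G →* Equiv.Perm (Fin n), x ^ numOrbits φ)

section OrbitRecursion

open MulAction

instance finite_monoidHom_perm (G : Type*) [Group G] [Group.FG G] (A : Type*) [Finite A] :
    Finite (G →* Equiv.Perm A) := by
  obtain ⟨S, hS, hfin⟩ := Group.fg_iff.1 (inferInstance : Group.FG G)
  have : Finite S := hfin
  refine Finite.of_injective (fun φ : G →* Equiv.Perm A => fun s : S => φ s) fun φ ψ h => ?_
  refine MonoidHom.eq_of_eqOn_dense hS fun s hs => ?_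
  exact congrFun h ⟨s, hs⟩

/-- The number of orbits of `G` on `A` for an action given by `φ : G →* Equiv.Perm A`. -/
noncomputable def orbitCount {G : Type*} [Group G] {A : Type*} (φ : G →* Equiv.Perm A) : ℕ :=
  Nat.card (Quotient (orbitRel φ.range A))

lemma orbitRel_range_iff {G A : Type*} [Group G] (φ : G →* Equiv.Perm A) (a b : A) :
    (orbitRel φ.range A) a b ↔ ∃ g, φ g b = a := by
  rw [orbitRel_apply, mem_orbit_iff]
  constructor
  · rintro ⟨⟨_, g, rfl⟩, h⟩
    exact ⟨g, h⟩
  · rintro ⟨g, h⟩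
    exact ⟨⟨φ g, g, rfl⟩, h⟩

/-- Embeddings sending `x₀` to `a₀` are embeddings of the complements. -/
noncomputable def pointedEmbeddingEquiv {X A : Type*} (x₀ : X) (a₀ : A) :
    {e : X ↪ A // e x₀ = a₀} ≃ ({x // x ≠ x₀} ↪ {a // a ≠ a₀}) := by
  classical
  exact
  { toFun := fun e => ⟨fun x => ⟨e.1 x, fun h => x.2 (e.1.injective (h.trans e.2.symm))⟩,
      fun x y h => Subtype.ext (e.1.injective (congrArg Subtype.val h))⟩
    invFun := fun f => ⟨⟨fun x => if h : x = x₀ then a₀ else f ⟨x, h⟩, by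
      intro x y h
      by_cases hx : x = x₀ <;> by_cases hy : y = x₀ <;> simp only [hx, hy, dite_true, dite_false] at h ⊢
      · exact absurd h.symm (f ⟨y, hy⟩).2
      · exact absurd h (f ⟨x, hx⟩).2
      · exact congrArg Subtype.val (f.injective (Subtype.ext h))⟩, by simp⟩
    left_inv := fun e => by
      ext x
      by_cases hx : x = x₀
      · simp [hx, e.2]
      · simp [hx]
        rfl
    right_inv := fun f => by
      ext x
      simp [x.2] }

lemma card_pointedEmbedding {X A : Type*} [Finite X] [Finite A] (x₀ : X) (a₀ : A) :
    Nat.card {e : X ↪ A // e x₀ = a₀} = (Nat.card A - 1).descFactorial (Nat.card X - 1) := by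
  classical
  have := Fintype.ofFinite X
  have := Fintype.ofFinite A
  rw [Nat.card_congr (pointedEmbeddingEquiv x₀ a₀), Nat.card_eq_fintype_card,
    Fintype.card_embedding_eq]
  simp [Fintype.card_subtype_compl]

variable {G : Type*} [Group G] {A : Type*} {H : Subgroup G}

/-- The action on `A` that extends the action of `G` on the image of `e : G ⧸ H ↪ A` by an action
on the complement of this image. -/
noncomputable def extendAction (e : G ⧸ H ↪ A) (ψ : G →* Equiv.Perm ↥(Set.range e)ᶜ) :
    G →* Equiv.Perm A := by
  classical
  exact (((Equiv.ofInjective e e.injective).sumCongr (Equiv.refl _)).trans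
    (Equiv.Set.sumCompl (Set.range e))).permCongrHom.toMonoidHom.comp
      ((Equiv.Perm.sumCongrHom _ _).comp ((MulAction.toPermHom G (G ⧸ H)).prod ψ))

lemma extendAction_apply_range (e : G ⧸ H ↪ A) (ψ : G →* Equiv.Perm ↥(Set.range e)ᶜ) (g : G)
    (q : G ⧸ H) : extendAction e ψ g (e q) = e (g • q) := by
  classical
  simp [extendAction, Equiv.permCongrHom,
    Equiv.Set.sumCompl_symm_apply_of_mem (Set.mem_range_self q)]

lemma extendAction_apply_compl (e : G ⧸ H ↪ A) (ψ : G →* Equiv.Perm ↥(Set.range e)ᶜ) (g : G)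
    (b : ↥(Set.range e)ᶜ) : extendAction e ψ g b = ψ g b := by
  classical
  have : (((Equiv.ofInjective e e.injective).sumCongr (Equiv.refl _)).trans
    (Equiv.Set.sumCompl (Set.range e))) (Sum.inr b) = b := by simp
  simp only [extendAction, MonoidHom.comp_apply]
  rw [← this]
  simp [Equiv.permCongrHom]

lemma apply_range_of_pointed {e : G ⧸ H ↪ A} {φ : G →* Equiv.Perm A}
    (h : ∀ g : G, φ g (e (1 : G)) = e g) (g : G) (q : G ⧸ H) : φ g (e q) = e (g • q) := by
  induction q using QuotientGroup.induction_on with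
  | H q => rw [← h q, ← Equiv.Perm.mul_apply, ← map_mul, h]; rfl

/-- Actions extending a given embedded coset space correspond to actions on the complement. -/
noncomputable def extendActionEquiv (e : G ⧸ H ↪ A) :
    {φ : G →* Equiv.Perm A // ∀ g : G, φ g (e (1 : G)) = e g} ≃
      (G →* Equiv.Perm ↥(Set.range e)ᶜ) where
  toFun φ :=
    have key : ∀ g a, a ∈ (Set.range e)ᶜ ↔ φ.1 g a ∈ (Set.range e)ᶜ := fun g a => by
      rw [Set.mem_compl_iff, Set.mem_compl_iff, not_iff_not]
      constructor
      · rintro ⟨q, rfl⟩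
        exact ⟨g • q, (apply_range_of_pointed φ.2 g q).symm⟩
      · rintro ⟨q, hq⟩
        refine ⟨g⁻¹ • q, ?_⟩
        rw [← apply_range_of_pointed φ.2, hq, ← Equiv.Perm.mul_apply, ← map_mul]
        simp
    { toFun := fun g => (φ.1 g).subtypePerm fun a => (key g a).symm
      map_one' := by ext; simp
      map_mul' := fun g h => by
        ext
        simp only [map_mul]
        rfl }
  invFun ψ := ⟨extendAction e ψ, fun g => by rw [extendAction_apply_range]; simp⟩
  left_inv φ := by
    refine Subtype.ext (MonoidHom.ext fun g => Equiv.ext fun a => ?_)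
    by_cases ha : a ∈ Set.range e
    · obtain ⟨q, rfl⟩ := ha
      rw [extendAction_apply_range, apply_range_of_pointed φ.2]
    · exact extendAction_apply_compl e _ g ⟨a, ha⟩
  right_inv ψ := by
    refine MonoidHom.ext fun g => Equiv.ext fun a => Subtype.ext ?_
    exact extendAction_apply_compl e ψ g a

lemma orbitCount_extendAction [Finite A] (e : G ⧸ H ↪ A) (ψ : G →* Equiv.Perm ↥(Set.range e)ᶜ) :
    orbitCount (extendAction e ψ) = orbitCount ψ + 1 := by
  classical
  rw [orbitCount, orbitCount, ← Finite.card_option]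
  symm
  let r := orbitRel (extendAction e ψ).range A
  let s := orbitRel ψ.range ↥(Set.range e)ᶜ
  let F : Option (Quotient s) → Quotient r := fun o => o.elim (Quotient.mk r (e (1 : G)))
    (Quotient.map' (s₁ := s) (s₂ := r) Subtype.val (by
      intro a b hab
      obtain ⟨g, hg⟩ := (orbitRel_range_iff ψ a b).1 hab
      exact (orbitRel_range_iff _ _ _).2 ⟨g, by rw [extendAction_apply_compl, hg]⟩))
  refine Nat.card_congr (Equiv.ofBijective F ⟨?_, ?_⟩)
  · have key : ∀ b : ↥(Set.range e)ᶜ, ¬ r (e (1 : G)) b := by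
      intro b hb
      obtain ⟨g, hg⟩ := (orbitRel_range_iff _ _ _).1 hb
      rw [extendAction_apply_compl] at hg
      exact (ψ g b).2 ⟨_, hg.symm⟩
    rintro (_ | a) (_ | b) hab
    · rfl
    · induction b using Quotient.inductionOn
      exact (key _ (Quotient.exact hab)).elim
    · induction a using Quotient.inductionOn
      exact (key _ (Quotient.exact hab.symm)).elim
    · induction a using Quotient.inductionOn
      induction b using Quotient.inductionOn
      obtain ⟨g, hg⟩ := (orbitRel_range_iff _ _ _).1 (Quotient.exact hab)
      rw [extendAction_apply_compl] at hg
      exact congrArg some (Quotient.sound ((orbitRel_range_iff _ _ _).2 ⟨g, Subtype.ext hg⟩))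
  · intro q
    induction q using Quotient.inductionOn with
    | h a =>
      by_cases ha : a ∈ Set.range e
      · obtain ⟨q, rfl⟩ := ha
        induction q using QuotientGroup.induction_on with
        | H g =>
          refine ⟨none, Quotient.sound ((orbitRel_range_iff _ _ _).2 ⟨g⁻¹, ?_⟩)⟩
          rw [extendAction_apply_range]
          simp
      · exact ⟨some (Quotient.mk s ⟨a, ha⟩), rfl⟩

lemma orbitCount_congr {A B : Type*} (σ : A ≃ B) (φ : G →* Equiv.Perm A) :
    orbitCount (σ.permCongrHom.toMonoidHom.comp φ) = orbitCount φ := by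
  refine Nat.card_congr (Quotient.congr σ.symm fun a b => ?_)
  rw [orbitRel_range_iff, orbitRel_range_iff]
  refine exists_congr fun g => ?_
  simp [Equiv.permCongrHom, Equiv.eq_symm_apply]

/-- The orbit-weighted number of actions of `G` on `Fin n`. -/
noncomputable def orbitSum (G : Type*) [Group G] (n : ℕ) (y : ℂ) : ℂ :=
  ∑ᶠ φ : G →* Equiv.Perm (Fin n), y ^ orbitCount φ

lemma finsum_pow_orbitCount [Finite A] (y : ℂ) :
    ∑ᶠ φ : G →* Equiv.Perm A, y ^ orbitCount φ = orbitSum G (Nat.card A) y := by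
  let σ := Finite.equivFin A
  refine finsum_eq_of_bijective (fun φ => σ.permCongrHom.toMonoidHom.comp φ) ?_
    fun φ => by rw [orbitCount_congr]
  exact (MulEquiv.monoidHomCongrRightEquiv σ.permCongrHom).bijective

lemma orbitSum_zero (y : ℂ) : orbitSum G 0 y = 1 := by
  have : Unique (G →* Equiv.Perm (Fin 0)) := ⟨⟨1⟩, fun φ => MonoidHom.ext fun g => Subsingleton.elim _ _⟩
  rw [orbitSum, finsum_unique]
  simp [orbitCount]

/-- The embedded coset space of the orbit of `a₀`. -/
noncomputable def orbitEmbedding (φ : G →* Equiv.Perm A) (a₀ : A) :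
    Σ H : Subgroup G, {e : G ⧸ H ↪ A // e (1 : G) = a₀} := by
  letI := MulAction.compHom A φ
  exact ⟨stabilizer G a₀, ⟨ofQuotientStabilizer G a₀, injective_ofQuotientStabilizer G a₀⟩,
    by simp⟩

lemma orbitEmbedding_eq_iff (φ : G →* Equiv.Perm A) (a₀ : A)
    (p : Σ H : Subgroup G, {e : G ⧸ H ↪ A // e (1 : G) = a₀}) :
    orbitEmbedding φ a₀ = p ↔ ∀ g : G, φ g (p.2.1 (1 : G)) = p.2.1 g := by
  constructor
  · rintro rfl g
    rw [(orbitEmbedding φ a₀).2.2]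
    rfl
  · obtain ⟨H, e, he⟩ := p
    intro h
    have hH : (orbitEmbedding φ a₀).1 = H := by
      ext g
      have h1 : g ∈ (orbitEmbedding φ a₀).1 ↔ φ g a₀ = a₀ := Iff.rfl
      have h2 := h g
      simp only at h2
      rw [h1, ← he, h2, e.injective.eq_iff, eq_comm, QuotientGroup.eq]
      simp
    have h3 : ∀ g : G, (orbitEmbedding φ a₀).2.1 g = e g := fun g => by
      rw [← h g]
      simp only
      rw [he]
      rfl
    revert h3
    generalize orbitEmbedding φ a₀ = q at hH
    obtain ⟨H', e', he'⟩ := q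
    obtain rfl : H' = H := hH
    intro h3
    have : e' = e := by
      ext x
      induction x using QuotientGroup.induction_on with
      | H g => exact h3 g
    subst this
    rfl

lemma card_sigma_pointed [Finite A] (a₀ : A) (k : ℕ) :
    Nat.card {p : Σ H : Subgroup G, {e : G ⧸ H ↪ A // e (1 : G) = a₀} // p.1.index = k + 1} =
      aCount G (k + 1) * (Nat.card A - 1).descFactorial k := by
  have h1 : ∀ H : {H : Subgroup G // H.index = k + 1},
      {e : G ⧸ H.1 ↪ A // e (1 : G) = a₀} ≃ Fin ((Nat.card A - 1).descFactorial k) := fun H => by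
    have : Nat.card (G ⧸ H.1) = k + 1 := H.2
    have : Finite (G ⧸ H.1) := Nat.finite_of_card_ne_zero (by omega)
    refine Finite.equivFinOfCardEq ?_
    rw [card_pointedEmbedding]
    simp [*]
  have h2 : {p : Σ H : Subgroup G, {e : G ⧸ H ↪ A // e (1 : G) = a₀} // p.1.index = k + 1} ≃
      Σ H : {H : Subgroup G // H.index = k + 1}, {e : G ⧸ H.1 ↪ A // e (1 : G) = a₀} :=
    { toFun := fun p => ⟨⟨p.1.1, p.2⟩, p.1.2⟩
      invFun := fun q => ⟨⟨q.1.1, q.2⟩, q.1.2⟩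
      left_inv := fun _ => rfl
      right_inv := fun _ => rfl }
  rw [Nat.card_congr (h2.trans ((Equiv.sigmaCongrRight h1).trans (Equiv.sigmaEquivProd _ _))),
    Nat.card_prod, Nat.card_fin, aCount]

variable [Group.FG G]

lemma finite_sigma_pointed [Finite A] (a₀ : A) :
    Finite (Σ H : Subgroup G, {e : G ⧸ H ↪ A // e (1 : G) = a₀}) := by
  refine Finite.of_surjective (fun φ : G →* Equiv.Perm A => orbitEmbedding φ a₀) fun p => ?_
  obtain ⟨φ, hφ⟩ := (extendActionEquiv p.2.1).symm 1
  exact ⟨φ, (orbitEmbedding_eq_iff _ _ _).2 hφ⟩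

lemma finsum_orbitEmbedding [Finite A] (a₀ : A) (y : ℂ)
    (p : Σ H : Subgroup G, {e : G ⧸ H ↪ A // e (1 : G) = a₀}) :
    ∑ᶠ φ : {φ : G →* Equiv.Perm A // orbitEmbedding φ a₀ = p}, y ^ orbitCount φ.1 =
      y * orbitSum G (Nat.card A - p.1.index) y := by
  classical
  have hcard : Nat.card ↥(Set.range p.2.1)ᶜ = Nat.card A - p.1.index := by
    have := Fintype.ofFinite A
    rw [Nat.card_coe_set_eq, Set.ncard_compl, ← Nat.card_coe_set_eq, Nat.card_range_of_injective p.2.1.injective,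
      Subgroup.index]
  rw [← hcard, ← finsum_pow_orbitCount, mul_finsum' _ _ (Set.toFinite _)]
  let E := (Equiv.subtypeEquivRight fun φ : G →* Equiv.Perm A => orbitEmbedding_eq_iff φ a₀ p).trans
    (extendActionEquiv p.2.1)
  symm
  refine finsum_eq_of_bijective E.symm E.symm.bijective fun ψ => ?_
  have : (E.symm ψ).1 = extendAction p.2.1 ψ := rfl
  rw [this, orbitCount_extendAction, pow_succ']

/-- Splitting off the orbit of a point. -/
lemma orbitSum_succ (n : ℕ) (y : ℂ) :
    orbitSum G (n + 1) y = y * ∑ k ∈ Finset.range (n + 1),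
      (aCount G (k + 1) : ℂ) * (n.descFactorial k : ℂ) * orbitSum G (n - k) y := by
  classical
  have := finite_sigma_pointed (G := G) (0 : Fin (n + 1))
  have := Fintype.ofFinite (Σ H : Subgroup G, {e : G ⧸ H ↪ Fin (n + 1) // e (1 : G) = 0})
  have := Fintype.ofFinite (G →* Equiv.Perm (Fin (n + 1)))
  have hfib := fun p => finsum_orbitEmbedding (G := G) (0 : Fin (n + 1)) y p
  simp only [finsum_eq_sum_of_fintype, Nat.card_fin] at hfib
  rw [orbitSum, finsum_eq_sum_of_fintype,
    ← Fintype.sum_fiberwise (fun φ : G →* Equiv.Perm (Fin (n + 1)) => orbitEmbedding φ 0)]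
  simp only [hfib]
  rw [← Finset.mul_sum]
  congr 1
  have hmaps : ∀ p ∈ (Finset.univ : Finset (Σ H : Subgroup G,
      {e : G ⧸ H ↪ Fin (n + 1) // e (1 : G) = 0})), p.1.index - 1 ∈ Finset.range (n + 1) := by
    intro p _
    have := Finite.card_le_of_embedding p.2.1
    rw [Nat.card_fin] at this
    have h : p.1.index = Nat.card (G ⧸ p.1) := rfl
    rw [Finset.mem_range]
    omega
  rw [← Finset.sum_fiberwise_of_maps_to hmaps]
  refine Finset.sum_congr rfl fun k _ => ?_
  have hpos : ∀ p : Σ H : Subgroup G, {e : G ⧸ H ↪ Fin (n + 1) // e (1 : G) = 0},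
      p.1.index - 1 = k ↔ p.1.index = k + 1 := fun p => by
    have : Finite (G ⧸ p.1) := Finite.of_injective _ p.2.1.injective
    have h1 : 0 < Nat.card (G ⧸ p.1) := Nat.card_pos
    have h : p.1.index = Nat.card (G ⧸ p.1) := rfl
    omega
  have hcard := card_sigma_pointed (G := G) (0 : Fin (n + 1)) k
  rw [Nat.card_fin, Nat.add_sub_cancel, Nat.card_eq_fintype_card, Fintype.card_subtype] at hcard
  rw [← Nat.cast_mul, ← hcard, ← nsmul_eq_mul, ← Finset.sum_const]
  simp only [hpos]
  refine Finset.sum_congr rfl fun p hp => ?_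
  rw [(Finset.mem_filter.1 hp).2]
  congr 1
  omega

end OrbitRecursion

section CauchyCoefficients

open Complex Metric
open scoped Real Topology

variable {b : ℕ → ℝ}

lemma summable_series_of_norm_lt_one (hb0 : ∀ δ, 0 ≤ b δ)
    (hb : ∀ r : ℝ, 0 ≤ r → r < 1 → Summable fun δ => b δ * r ^ δ) {z : ℂ} (hz : ‖z‖ < 1) :
    Summable fun δ : ℕ => (b δ : ℂ) * z ^ δ := by
  refine Summable.of_norm ((hb ‖z‖ (norm_nonneg _) hz).congr fun δ => ?_)
  simp [abs_of_nonneg (hb0 δ)]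

lemma differentiableOn_series (hb0 : ∀ δ, 0 ≤ b δ)
    (hb : ∀ r : ℝ, 0 ≤ r → r < 1 → Summable fun δ => b δ * r ^ δ) :
    DifferentiableOn ℂ (fun z : ℂ => ∑' δ : ℕ, (b δ : ℂ) * z ^ δ) (ball 0 1) := by
  intro z hz
  rw [mem_ball_zero_iff] at hz
  obtain ⟨r, hr, hr1⟩ := exists_between hz
  refine DifferentiableAt.differentiableWithinAt ?_
  refine DifferentiableOn.differentiableAt (s := ball 0 r) ?_
    (isOpen_ball.mem_nhds (mem_ball_zero_iff.2 hr))
  refine differentiableOn_tsum_of_summable_norm (hb r ((norm_nonneg z).trans hr.le) hr1)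
    (fun δ => by fun_prop) isOpen_ball fun δ w hw => ?_
  rw [mem_ball_zero_iff] at hw
  rw [norm_mul, norm_pow, Complex.norm_real, Real.norm_of_nonneg (hb0 δ)]
  have := hb0 δ
  gcongr

lemma iteratedDeriv_series_zero (hb0 : ∀ δ, 0 ≤ b δ)
    (hb : ∀ r : ℝ, 0 ≤ r → r < 1 → Summable fun δ => b δ * r ^ δ) (k : ℕ) :
    iteratedDeriv k (fun z : ℂ => ∑' δ : ℕ, (b δ : ℂ) * z ^ δ) 0 = k.factorial * b k := by
  set F := fun z : ℂ => ∑' δ : ℕ, (b δ : ℂ) * z ^ δ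
  have han : AnalyticAt ℂ F 0 :=
    (differentiableOn_series hb0 hb).analyticAt (ball_mem_nhds 0 one_pos)
  have h1 : HasFPowerSeriesAt F (FormalMultilinearSeries.ofScalars ℂ fun k => (b k : ℂ)) 0 := by
    rw [hasFPowerSeriesAt_iff']
    filter_upwards [ball_mem_nhds (0 : ℂ) one_pos] with z hz
    have := (summable_series_of_norm_lt_one hb0 hb (mem_ball_zero_iff.1 hz)).hasSum
    simpa [FormalMultilinearSeries.coeff_ofScalars, mul_comm] using this
  have h2 := congrArg (fun p => FormalMultilinearSeries.coeff p k)
    (h1.eq_formalMultilinearSeries han.hasFPowerSeriesAt)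
  simp only [FormalMultilinearSeries.coeff_ofScalars] at h2
  rw [h2]
  field_simp [Nat.factorial_ne_zero]

lemma iteratedDeriv_exp_series_zero (hb0 : ∀ δ, 0 ≤ b δ)
    (hb : ∀ r : ℝ, 0 ≤ r → r < 1 → Summable fun δ => b δ * r ^ δ) (hbz : b 0 = 0) {y : ℂ}
    {h : ℕ → ℂ} (h0 : h 0 = 1)
    (hsucc : ∀ n, h (n + 1) = y * ∑ k ∈ Finset.range (n + 1),
      ((k + 1 : ℕ) * b (k + 1) : ℂ) * (n.descFactorial k : ℂ) * h (n - k)) (n : ℕ) :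
    iteratedDeriv n (fun z : ℂ => cexp (y * ∑' δ : ℕ, (b δ : ℂ) * z ^ δ)) 0 = h n := by
  set F := fun z : ℂ => ∑' δ : ℕ, (b δ : ℂ) * z ^ δ
  have hF : DifferentiableOn ℂ F (ball 0 1) := differentiableOn_series hb0 hb
  have hFan : AnalyticAt ℂ F 0 := hF.analyticAt (ball_mem_nhds 0 one_pos)
  have hEan : AnalyticAt ℂ (fun z => cexp (y * F z)) 0 := by fun_prop
  induction n using Nat.strong_induction_on with
  | _ n ih =>
  cases n with
  | zero =>
    have : F 0 = 0 := by
      have := iteratedDeriv_series_zero hb0 hb 0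
      simpa [hbz] using this
    change cexp (y * F 0) = _
    simp [this, h0]
  | succ n =>
    have hder : deriv (fun z => cexp (y * F z)) =ᶠ[𝓝 0] fun z => y * (deriv F z * cexp (y * F z)) := by
      filter_upwards [ball_mem_nhds (0 : ℂ) one_pos] with z hz
      have hd := (hF.differentiableAt (isOpen_ball.mem_nhds hz)).hasDerivAt
      rw [((hd.const_mul y).cexp).deriv]
      ring
    rw [iteratedDeriv_succ', hder.iteratedDeriv_eq, iteratedDeriv_const_mul_field,
      iteratedDeriv_fun_mul (AnalyticAt.contDiffAt (by fun_prop)) hEan.contDiffAt, hsucc]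
    congr 1
    refine Finset.sum_congr rfl fun k hk => ?_
    rw [ih _ (by omega), ← iteratedDeriv_succ', iteratedDeriv_series_zero hb0 hb,
      Nat.descFactorial_eq_factorial_mul_choose, Nat.factorial_succ]
    push_cast
    ring

/-- Cauchy's formula for the coefficients of `exp (y F)`. -/
lemma integral_exp_series (hb0 : ∀ δ, 0 ≤ b δ)
    (hb : ∀ r : ℝ, 0 ≤ r → r < 1 → Summable fun δ => b δ * r ^ δ) (hbz : b 0 = 0) {y : ℂ}
    {h : ℕ → ℂ} (h0 : h 0 = 1)
    (hsucc : ∀ n, h (n + 1) = y * ∑ k ∈ Finset.range (n + 1),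
      ((k + 1 : ℕ) * b (k + 1) : ℂ) * (n.descFactorial k : ℂ) * h (n - k))
    {r : ℝ} (hr : 0 < r) (hr1 : r < 1) (n : ℕ) :
    ∫ θ in -π..π, cexp (y * ∑' δ : ℕ, (b δ : ℂ) * (r * cexp (θ * I)) ^ δ) * cexp (-(n * θ * I)) =
      2 * π * r ^ n * h n / n.factorial := by
  set F := fun z : ℂ => ∑' δ : ℕ, (b δ : ℂ) * z ^ δ
  have hF : DifferentiableOn ℂ F (ball 0 1) := differentiableOn_series hb0 hb
  have hE : DiffContOnCl ℂ (fun z => cexp (y * F z)) (ball 0 r) := by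
    refine DifferentiableOn.diffContOnCl_ball (U := ball 0 1) ?_ (closedBall_subset_ball hr1)
    exact (hF.const_mul y).cexp
  have h1 := hE.circleIntegral_one_div_sub_center_pow_smul hr n
  rw [iteratedDeriv_exp_series_zero hb0 hb hbz h0 hsucc, circleIntegral] at h1
  have hr0 : (r : ℂ) ≠ 0 := by exact_mod_cast hr.ne'
  have h2 : ∀ θ : ℝ, deriv (circleMap 0 r) θ •
      (1 / (circleMap 0 r θ - 0) ^ (n + 1)) • cexp (y * F (circleMap 0 r θ)) =
      (I / r ^ n) * (cexp (y * F (r * cexp (θ * I))) * cexp (-(n * θ * I))) := fun θ => by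
    rw [deriv_circleMap, show circleMap 0 r θ = r * cexp (θ * I) by simp [circleMap], exp_neg,
      show (n * θ * I : ℂ) = n * (θ * I) by ring, exp_nat_mul]
    simp only [smul_eq_mul, sub_zero]
    have := exp_ne_zero (θ * I)
    field_simp
    ring
  simp_rw [h2] at h1
  rw [intervalIntegral.integral_const_mul] at h1
  have hper : Function.Periodic
      (fun θ : ℝ => cexp (y * F (r * cexp (θ * I))) * cexp (-(n * θ * I))) (2 * π) := fun θ => by
    have e1 : cexp (((θ + 2 * π : ℝ) : ℂ) * I) = cexp (θ * I) := by
      push_cast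
      rw [add_mul, exp_add, exp_two_pi_mul_I, mul_one]
    simp only [exp_neg, mul_assoc, exp_nat_mul, e1]
  have h3 := hper.intervalIntegral_add_eq (-π) 0
  rw [show -π + 2 * π = π by ring, zero_add] at h3
  rw [h3]
  have hI := I_ne_zero
  have hn : (n.factorial : ℂ) ≠ 0 := by exact_mod_cast n.factorial_ne_zero
  have : ∀ X Y : ℂ, I / r ^ n * X = Y → X = Y * r ^ n / I := fun X Y h => by
    rw [← h]; field_simp
  rw [this _ _ h1, smul_eq_mul]
  field_simp

end CauchyCoefficients

section BandLimitedKernel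

open MeasureTheory FourierTransform Convolution
open scoped Real SchwartzMap ComplexConjugate

/-- A nonnegative rapidly decreasing function whose Fourier transform has compact support. -/
lemma exists_bandLimited_kernel : ∃ (k : ℝ → ℂ) (g : ℝ → ℝ), Continuous k ∧ HasCompactSupport k ∧
    Continuous g ∧ (∀ z, 0 ≤ g z) ∧ 0 < g 0 ∧ (∀ N : ℕ, ∃ C, ∀ z, (1 + |z|) ^ N * g z ≤ C) ∧
    ∀ z : ℝ, (g z : ℂ) = ∫ t : ℝ, k t * Complex.exp (-(2 * π * t * z * Complex.I)) := by
  let β : ContDiffBump (0 : ℝ) := ⟨1, 2, one_pos, one_lt_two⟩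
  let χ : ℝ → ℂ := fun t => (β t : ℂ)
  have hχc : HasCompactSupport χ := β.hasCompactSupport.comp_left Complex.ofReal_zero
  have hχd : ContDiff ℝ ((⊤ : ℕ∞) : WithTop ℕ∞) χ := Complex.ofRealCLM.contDiff.comp β.contDiff
  let X : 𝓢(ℝ, ℂ) := hχc.toSchwartzMap hχd
  have hXi : Integrable χ := X.integrable
  have hreal : ∀ z, conj (𝓕 χ z) = 𝓕 χ z := by
    intro z
    rw [Real.fourier_real_eq_integral_exp_smul, ← integral_conj, ← integral_neg_eq_self]
    refine integral_congr_ae (Filter.Eventually.of_forall fun t => ?_)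
    have : χ (-t) = χ t := by simp [χ, β.neg]
    simp only [smul_eq_mul, map_mul, this, ← Complex.exp_conj]
    simp [χ, Complex.conj_ofNat]
  refine ⟨χ ⋆[ContinuousLinearMap.mul ℂ ℂ] χ, fun z => ‖𝓕 χ z‖ ^ 2, ?_, ?_, ?_, ?_, ?_, ?_, ?_⟩
  · exact hχc.continuous_convolution_right _ hXi.locallyIntegrable hχd.continuous
  · exact hχc.convolution _ hχc
  · have : Continuous (𝓕 χ) := (𝓕 X).continuous
    fun_prop
  · intro z; positivity
  · have h1 : 𝓕 χ 0 = ((∫ t, β t : ℝ) : ℂ) := by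
      rw [Real.fourier_real_eq_integral_exp_smul, ← integral_complex_ofReal]
      simp [χ]
    have h2 : 0 < ∫ t, β t := β.integral_pos
    simp only [h1]
    rw [Complex.norm_real, Real.norm_of_nonneg h2.le]
    exact pow_pos h2 2
  · intro N
    have hs := fun z => (𝓕 X).one_add_le_sup_seminorm_apply (𝕜 := ℝ) (m := (N, 0)) (k := N) (n := 0)
      le_rfl le_rfl z
    simp only [norm_iteratedFDeriv_zero] at hs
    obtain ⟨C₂, hC₂⟩ : ∃ C, ∀ z, ‖𝓕 X z‖ ≤ C := ⟨_, fun z => (𝓕 X).norm_le_seminorm ℝ z⟩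
    obtain ⟨C₁, hC₁⟩ : ∃ C, ∀ z : ℝ, (1 + ‖z‖) ^ N * ‖𝓕 X z‖ ≤ C := ⟨_, hs⟩
    refine ⟨C₁ * C₂, fun z => ?_⟩
    change (1 + |z|) ^ N * ‖𝓕 χ z‖ ^ 2 ≤ _
    rw [pow_two, ← mul_assoc]
    exact mul_le_mul (hC₁ z) (hC₂ z) (norm_nonneg _) (le_trans (by positivity) (hC₁ z))
  · intro z
    have h1 := Real.fourier_mul_convolution_eq hXi hXi z
    have h2 : 𝓕 χ z * 𝓕 χ z = ((‖𝓕 χ z‖ ^ 2 : ℝ) : ℂ) := by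
      rw [Complex.ofReal_pow, ← Complex.mul_conj', hreal]
    rw [← h2, ← h1, Real.fourier_real_eq_integral_exp_smul]
    refine integral_congr_ae (Filter.Eventually.of_forall fun t => ?_)
    simp only [smul_eq_mul]
    rw [mul_comm]
    congr 2
    push_cast
    ring

end BandLimitedKernel

section SmoothedSums

open MeasureTheory Set Filter
open scoped Real Topology

lemma integrableOn_pow_mul_exp_neg {ε : ℝ} (hε : 0 < ε) (j : ℕ) :
    IntegrableOn (fun u : ℝ => u ^ j * Real.exp (-(ε * u))) (Ioi 0) := by
  have h := integrableOn_rpow_mul_exp_neg_mul_rpow (p := 1) (s := j) (b := ε)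
    (by have : (0:ℝ) ≤ j := j.cast_nonneg
        linarith) one_pos hε
  refine h.congr_fun (fun u hu => ?_) measurableSet_Ioi
  simp

lemma norm_pow_mul_cexp_neg_mul (s : ℂ) (j : ℕ) {u : ℝ} (hu : 0 ≤ u) :
    ‖(u : ℂ) ^ j * Complex.exp (-(s * u))‖ = u ^ j * Real.exp (-(s.re * u)) := by
  rw [norm_mul, norm_pow, Complex.norm_real, Real.norm_of_nonneg hu, Complex.norm_exp]
  simp

lemma integrableOn_pow_mul_cexp_neg {s : ℂ} (hs : 0 < s.re) (j : ℕ) :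
    IntegrableOn (fun u : ℝ => (u : ℂ) ^ j * Complex.exp (-(s * u))) (Ioi 0) := by
  refine (integrableOn_pow_mul_exp_neg hs j).mono' (Continuous.aestronglyMeasurable (by fun_prop)) ?_
  exact (ae_restrict_iff' measurableSet_Ioi).2 (ae_of_all _ fun u hu =>
    (norm_pow_mul_cexp_neg_mul s j (le_of_lt hu)).le)

lemma integral_pow_mul_cexp_neg_mul {s : ℂ} (hs : 0 < s.re) (j : ℕ) :
    ∫ u in Ioi (0 : ℝ), (u : ℂ) ^ j * Complex.exp (-(s * u)) = j.factorial / s ^ (j + 1) := by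
  have hs0 : s ≠ 0 := by rintro rfl; simp at hs
  induction j with
  | zero =>
    have h := integral_exp_mul_complex_Ioi (a := -s) (by simpa using hs) 0
    simp only [pow_zero, one_mul, Nat.factorial_zero, Nat.cast_one, zero_add, pow_one]
    simp only [neg_mul] at h
    rw [h]
    simp
  | succ j ih =>
    have hder : ∀ u : ℝ, HasDerivAt (fun u : ℝ => (u : ℂ) ^ (j + 1) * Complex.exp (-(s * u)))
        ((j + 1) * ((u : ℂ) ^ j * Complex.exp (-(s * u))) -
          s * ((u : ℂ) ^ (j + 1) * Complex.exp (-(s * u)))) u := fun u => by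
      have h1 : HasDerivAt (fun z : ℂ => z ^ (j + 1) * Complex.exp (-(s * z)))
          (((j + 1 : ℕ) * (u : ℂ) ^ j * Complex.exp (-(s * u)) +
            (u : ℂ) ^ (j + 1) * (Complex.exp (-(s * u)) * (-(s * 1))))) u :=
        (hasDerivAt_pow (j + 1) (u : ℂ)).mul (((hasDerivAt_id (u : ℂ)).const_mul s).neg.cexp)
      convert h1.comp_ofReal using 1
      push_cast
      ring
    have hlim : Tendsto (fun u : ℝ => (u : ℂ) ^ (j + 1) * Complex.exp (-(s * u))) atTop (𝓝 0) := by
      rw [tendsto_zero_iff_norm_tendsto_zero]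
      have h2 := (Real.tendsto_pow_mul_exp_neg_atTop_nhds_zero (j + 1)).comp
        (tendsto_id.const_mul_atTop hs)
      have h3 := h2.const_mul ((s.re ^ (j + 1))⁻¹)
      rw [mul_zero] at h3
      refine h3.congr' ?_
      filter_upwards [eventually_ge_atTop 0] with u hu
      rw [norm_pow_mul_cexp_neg_mul s _ hu]
      simp only [Function.comp, id, mul_pow]
      field_simp
    have h := integral_Ioi_of_hasDerivAt_of_tendsto (a := 0)
      (hder 0).continuousAt.continuousWithinAt (fun u _ => hder u)
      (((integrableOn_pow_mul_cexp_neg hs j).const_mul _).sub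
        ((integrableOn_pow_mul_cexp_neg hs (j + 1)).const_mul _)) hlim
    rw [integral_sub ((integrableOn_pow_mul_cexp_neg hs j).const_mul _)
        ((integrableOn_pow_mul_cexp_neg hs (j + 1)).const_mul _), integral_const_mul,
      integral_const_mul, ih] at h
    rw [Nat.factorial_succ]
    push_cast
    simp only [Complex.ofReal_zero, ne_eq, Nat.add_eq_zero_iff, one_ne_zero, and_false,
      not_false_eq_true, zero_pow, zero_mul, sub_zero] at h
    rw [eq_div_iff (by positivity)]
    have h4 := (sub_eq_zero.1 h)
    field_simp at h4
    rw [h4]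
    ring

variable {k : ℝ → ℂ} {g : ℝ → ℝ}

lemma integral_pow_mul_exp_mul_kernel (hk : Integrable k)
    (hkg : ∀ z : ℝ, (g z : ℂ) = ∫ t : ℝ, k t * Complex.exp (-(2 * π * t * z * Complex.I)))
    {ε : ℝ} (hε : 0 < ε) (v : ℝ) (j : ℕ) :
    ((∫ u in Ioi (0 : ℝ), u ^ j * Real.exp (-(ε * u)) * g (u - v) : ℝ) : ℂ) =
      j.factorial * ∫ t : ℝ, k t * Complex.exp (2 * π * t * v * Complex.I) /
        (ε + 2 * π * t * Complex.I) ^ (j + 1) := by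
  rw [← integral_complex_ofReal]
  let K : ℝ → ℝ → ℂ := fun u t => ((u ^ j * Real.exp (-(ε * u)) : ℝ) : ℂ) *
    (k t * Complex.exp (-(2 * π * t * (u - v : ℝ) * Complex.I)))
  have h1 : ∀ u : ℝ, ((u ^ j * Real.exp (-(ε * u)) * g (u - v) : ℝ) : ℂ) = ∫ t, K u t := fun u => by
    rw [Complex.ofReal_mul, hkg, ← integral_const_mul]
  have hK : Integrable (Function.uncurry K) ((volume.restrict (Ioi 0)).prod volume) := by
    have h2 := ((integrableOn_pow_mul_exp_neg hε j).ofReal (𝕜 := ℂ)).mul_prod hk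
    have h3 := h2.mul_bdd (c := 1)
      (g := fun p : ℝ × ℝ => Complex.exp (-(2 * π * p.2 * (p.1 - v : ℝ) * Complex.I)))
      (Continuous.aestronglyMeasurable (by fun_prop)) (ae_of_all _ fun p => by
        rw [show (-(2 * π * p.2 * (p.1 - v : ℝ) * Complex.I) : ℂ) =
          ((-(2 * π * p.2 * (p.1 - v)) : ℝ) : ℂ) * Complex.I by push_cast; ring,
          Complex.norm_exp_ofReal_mul_I])
    refine h3.congr (ae_of_all _ fun p => ?_)
    simp only [Function.uncurry, K]
    simp only [RCLike.ofReal_mul, RCLike.ofReal_pow, Complex.coe_algebraMap, Complex.ofReal_mul, Complex.ofReal_pow]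
    ring_nf
  simp_rw [h1]
  rw [integral_integral_swap hK, ← integral_const_mul]
  refine integral_congr_ae (ae_of_all _ fun t => ?_)
  have hs : 0 < ((ε : ℂ) + 2 * π * t * Complex.I).re := by simpa using hε
  have h4 := integral_pow_mul_cexp_neg_mul hs j
  have h5 : ∀ u : ℝ, K u t = (k t * Complex.exp (2 * π * t * v * Complex.I)) *
      ((u : ℂ) ^ j * Complex.exp (-((ε + 2 * π * t * Complex.I) * u))) := fun u => by
    simp only [K]
    push_cast
    rw [show -((ε + 2 * π * t * Complex.I) * u : ℂ) = -(ε * u) + -(2 * π * t * u * Complex.I) by ring,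
      show (-(2 * π * t * (u - v) * Complex.I) : ℂ) =
        2 * π * t * v * Complex.I + -(2 * π * t * u * Complex.I) by ring, Complex.exp_add,
      Complex.exp_add]
    ring
  simp_rw [h5]
  rw [integral_const_mul, h4]
  ring

lemma tsum_mul_exp_mul_kernel (hk : Integrable k)
    (hkg : ∀ z : ℝ, (g z : ℂ) = ∫ t : ℝ, k t * Complex.exp (-(2 * π * t * z * Complex.I)))
    {w ℓ : ℕ → ℝ} (hw : ∀ δ, 0 ≤ w δ) {ε : ℝ} (hsum : Summable fun δ => w δ * Real.exp (-(ε * ℓ δ)))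
    (v : ℝ) :
    HasSum (fun δ => ((w δ * Real.exp (-(ε * ℓ δ)) * g (ℓ δ - v) : ℝ) : ℂ))
      (∫ t : ℝ, k t * Complex.exp (2 * π * t * v * Complex.I) *
        ∑' δ, (w δ : ℂ) * Complex.exp (-((ε + 2 * π * t * Complex.I) * ℓ δ))) := by
  let K : ℕ → ℝ → ℂ := fun δ t => k t * Complex.exp (2 * π * t * v * Complex.I) *
    ((w δ : ℂ) * Complex.exp (-((ε + 2 * π * t * Complex.I) * ℓ δ)))
  have hK : ∀ δ t, K δ t = ((w δ * Real.exp (-(ε * ℓ δ)) : ℝ) : ℂ) *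
      (k t * Complex.exp (-(2 * π * t * (ℓ δ - v : ℝ) * Complex.I))) := fun δ t => by
    simp only [K]
    push_cast
    rw [show -((ε + 2 * π * t * Complex.I) * ℓ δ : ℂ) =
        -(ε * ℓ δ) + -(2 * π * t * ℓ δ * Complex.I) by ring,
      show (-(2 * π * t * (ℓ δ - v) * Complex.I) : ℂ) =
        2 * π * t * v * Complex.I + -(2 * π * t * ℓ δ * Complex.I) by ring, Complex.exp_add,
      Complex.exp_add]
    ring
  have hn : ∀ δ t, ‖K δ t‖ = (w δ * Real.exp (-(ε * ℓ δ))) * ‖k t‖ := fun δ t => by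
    rw [hK, norm_mul, norm_mul, Complex.norm_real,
      Real.norm_of_nonneg (mul_nonneg (hw δ) (Real.exp_nonneg _)),
      show (-(2 * π * t * (ℓ δ - v : ℝ) * Complex.I) : ℂ) =
        ((-(2 * π * t * (ℓ δ - v)) : ℝ) : ℂ) * Complex.I by push_cast; ring,
      Complex.norm_exp_ofReal_mul_I, mul_one]
  have hint : ∀ δ, Integrable (K δ) := fun δ => by
    have h3 := (hk.mul_bdd (c := 1)
      (g := fun t : ℝ => Complex.exp (-(2 * π * t * (ℓ δ - v : ℝ) * Complex.I)))
      (Continuous.aestronglyMeasurable (by fun_prop)) (ae_of_all _ fun t => by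
        rw [show (-(2 * π * t * (ℓ δ - v : ℝ) * Complex.I) : ℂ) =
          ((-(2 * π * t * (ℓ δ - v)) : ℝ) : ℂ) * Complex.I by push_cast; ring,
          Complex.norm_exp_ofReal_mul_I])).const_mul ((w δ * Real.exp (-(ε * ℓ δ)) : ℝ) : ℂ)
    exact h3.congr (ae_of_all _ fun t => (hK δ t).symm)
  have h := hasSum_integral_of_summable_integral_norm hint (by
    simp_rw [hn, integral_const_mul]
    exact hsum.mul_right _)
  simp only [K, tsum_mul_left] at h
  refine h.congr_fun fun δ => ?_
  rw [Complex.ofReal_mul, hkg, ← integral_const_mul]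
  exact integral_congr_ae (ae_of_all _ fun t => (hK δ t).symm)

end SmoothedSums

section Tauberian

open MeasureTheory Set Filter
open scoped Real Topology

variable {k : ℝ → ℂ} {g : ℝ → ℝ}

/-- The polynomial-exponential moments of the translated kernel `g`. -/
noncomputable def kernelMoment (g : ℝ → ℝ) (j : ℕ) (ε v : ℝ) : ℝ :=
  ∫ u in Ioi (0 : ℝ), u ^ j * Real.exp (-(ε * u)) * g (u - v)

/-- The contribution of the regular part `Φ` of the Dirichlet series to the smoothed sum. -/
noncomputable def kernelRemainder (k : ℝ → ℂ) (Φ : ℂ → ℂ) (ε v : ℝ) : ℂ :=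
  ∫ t : ℝ, k t * Complex.exp (2 * π * t * v * Complex.I) * Φ (ε + 2 * π * t * Complex.I)

lemma pow_mul_kernel_le (hg0 : ∀ z, 0 ≤ g z) {j : ℕ} {C : ℝ}
    (hC : ∀ z, (1 + |z|) ^ (j + 2) * g z ≤ C) {ε u : ℝ} (hε : 0 ≤ ε) (hu : 0 ≤ u) (v : ℝ) :
    u ^ j * Real.exp (-(ε * u)) * g (u - v) ≤ (1 + |v|) ^ j * (C * (1 + (u - v) ^ 2)⁻¹) := by
  have h1 : u ≤ (1 + |v|) * (1 + |u - v|) := by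
    nlinarith [abs_nonneg v, abs_nonneg (u - v), le_abs_self v, le_abs_self (u - v),
      mul_nonneg (abs_nonneg v) (abs_nonneg (u - v))]
  have h2 : Real.exp (-(ε * u)) ≤ 1 := Real.exp_le_one_iff.2 (by nlinarith [mul_nonneg hε hu])
  have h3 : (1 + |u - v|) ^ j * g (u - v) ≤ C * (1 + (u - v) ^ 2)⁻¹ := by
    rw [← div_eq_mul_inv, le_div_iff₀ (by positivity)]
    refine le_trans ?_ (hC (u - v))
    rw [pow_add, mul_right_comm]
    refine mul_le_mul_of_nonneg_right ?_ (hg0 _)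
    refine mul_le_mul_of_nonneg_left ?_ (by positivity)
    nlinarith [abs_nonneg (u - v), sq_abs (u - v)]
  calc u ^ j * Real.exp (-(ε * u)) * g (u - v)
      ≤ u ^ j * 1 * g (u - v) := by
        refine mul_le_mul_of_nonneg_right ?_ (hg0 _)
        exact mul_le_mul_of_nonneg_left h2 (by positivity)
    _ ≤ ((1 + |v|) * (1 + |u - v|)) ^ j * 1 * g (u - v) := by
        refine mul_le_mul_of_nonneg_right ?_ (hg0 _)
        rw [mul_one, mul_one]
        exact pow_le_pow_left₀ hu h1 j
    _ = (1 + |v|) ^ j * ((1 + |u - v|) ^ j * g (u - v)) := by rw [mul_pow]; ring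
    _ ≤ _ := mul_le_mul_of_nonneg_left h3 (by positivity)

lemma integrable_inv_one_add_sub_sq (v : ℝ) : Integrable fun u : ℝ => (1 + (u - v) ^ 2)⁻¹ :=
  integrable_inv_one_add_sq.comp_sub_right v

lemma integrableOn_kernelMoment (hgc : Continuous g) (hg0 : ∀ z, 0 ≤ g z) {j : ℕ} {C : ℝ}
    (hC : ∀ z, (1 + |z|) ^ (j + 2) * g z ≤ C) {ε : ℝ} (hε : 0 ≤ ε) (v : ℝ) :
    IntegrableOn (fun u => u ^ j * Real.exp (-(ε * u)) * g (u - v)) (Ioi 0) := by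
  refine Integrable.mono' ((((integrable_inv_one_add_sub_sq v).const_mul C).const_mul
    ((1 + |v|) ^ j)).integrableOn) (Continuous.aestronglyMeasurable (by fun_prop)) ?_
  refine (ae_restrict_iff' measurableSet_Ioi).2 (ae_of_all _ fun u hu => ?_)
  have hu' : (0:ℝ) ≤ u := le_of_lt hu
  rw [Real.norm_of_nonneg (mul_nonneg (by positivity) (hg0 _))]
  exact pow_mul_kernel_le hg0 hC hε hu' v

lemma kernelMoment_nonneg (hg0 : ∀ z, 0 ≤ g z) (j : ℕ) (ε v : ℝ) : 0 ≤ kernelMoment g j ε v :=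
  setIntegral_nonneg measurableSet_Ioi fun u hu => by
    have hu' : (0:ℝ) ≤ u := le_of_lt hu
    exact mul_nonneg (by positivity) (hg0 _)

lemma exists_kernelMoment_le (hgc : Continuous g) (hg0 : ∀ z, 0 ≤ g z)
    (hgd : ∀ N : ℕ, ∃ C, ∀ z, (1 + |z|) ^ N * g z ≤ C) (j : ℕ) :
    ∃ C, 0 ≤ C ∧ ∀ ε v : ℝ, 0 ≤ ε → kernelMoment g j ε v ≤ C * (1 + |v|) ^ j := by
  obtain ⟨C, hC⟩ := hgd (j + 2)
  have hC0 : 0 ≤ C := le_trans (mul_nonneg (by positivity) (hg0 0)) (hC 0)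
  refine ⟨C * π, by positivity, fun ε v hε => ?_⟩
  have hi := ((integrable_inv_one_add_sub_sq v).const_mul C).const_mul ((1 + |v|) ^ j)
  calc kernelMoment g j ε v
      ≤ ∫ u in Ioi (0:ℝ), (1 + |v|) ^ j * (C * (1 + (u - v) ^ 2)⁻¹) :=
        setIntegral_mono_on (integrableOn_kernelMoment hgc hg0 hC hε v) hi.integrableOn
          measurableSet_Ioi fun u hu => pow_mul_kernel_le hg0 hC hε (le_of_lt hu) v
    _ ≤ ∫ u : ℝ, (1 + |v|) ^ j * (C * (1 + (u - v) ^ 2)⁻¹) :=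
        setIntegral_le_integral hi (ae_of_all _ fun u => by simp only [Pi.zero_apply]; positivity)
    _ = _ := by
        rw [integral_const_mul, integral_const_mul,
          integral_sub_right_eq_self (fun u : ℝ => (1 + u ^ 2)⁻¹) v, integral_univ_inv_one_add_sq]
        ring

lemma le_kernelMoment (hgc : Continuous g) (hg0 : ∀ z, 0 ≤ g z)
    (hgd : ∀ N : ℕ, ∃ C, ∀ z, (1 + |z|) ^ N * g z ≤ C) (j : ℕ) {ε v : ℝ} (hv : 1 ≤ v)
    (hε : 0 ≤ ε) (hεv : ε * v ≤ 1) :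
    v ^ j * Real.exp (-2) * (∫ z in (0:ℝ)..1, g z) ≤ kernelMoment g j ε v := by
  obtain ⟨C, hC⟩ := hgd (j + 2)
  have hi := integrableOn_kernelMoment hgc hg0 hC hε v
  have h1 : ∫ z in (0:ℝ)..1, g z = ∫ u in v..(v + 1), g (u - v) := by
    rw [intervalIntegral.integral_comp_sub_right]; simp
  have hsub : Ioc v (v + 1) ⊆ Ioi 0 := fun u hu => lt_trans (by linarith) hu.1
  rw [h1, ← intervalIntegral.integral_const_mul, intervalIntegral.integral_of_le (by linarith)]
  refine le_trans (setIntegral_mono_on ?_ (hi.mono_set hsub) measurableSet_Ioc fun u hu => ?_)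
    (setIntegral_mono_set hi ?_ hsub.eventuallyLE)
  · exact (Continuous.integrableOn_Ioc (by fun_prop))
  · refine mul_le_mul_of_nonneg_right ?_ (hg0 _)
    refine mul_le_mul (pow_le_pow_left₀ (by linarith) hu.1.le j) (Real.exp_le_exp.2 ?_)
      (Real.exp_nonneg _) (pow_nonneg (le_trans (by linarith) hu.1.le) j)
    have : ε * u ≤ ε * (2 * v) := mul_le_mul_of_nonneg_left (by linarith [hu.2]) hε
    linarith
  · refine (ae_restrict_iff' measurableSet_Ioi).2 (ae_of_all _ fun u hu => ?_)
    have hu' : (0:ℝ) ≤ u := le_of_lt hu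
    exact mul_nonneg (by positivity) (hg0 _)

variable {Φ : ℂ → ℂ}

lemma continuous_comp_vertical (hΦ : ContinuousOn Φ {s | 0 ≤ s.re}) {ε : ℝ} (hε : 0 ≤ ε) :
    Continuous fun t : ℝ => Φ (ε + 2 * π * t * Complex.I) := by
  rw [← continuousOn_univ]
  exact hΦ.comp (Continuous.continuousOn (by fun_prop)) fun t _ => by simpa using hε

lemma exists_remainder_integrand_bound (hks : HasCompactSupport k)
    (hΦ : ContinuousOn Φ {s | 0 ≤ s.re}) :
    ∃ C, 0 ≤ C ∧ ∀ ε v t : ℝ, 0 ≤ ε → ε ≤ 1 →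
      ‖k t * Complex.exp (2 * π * t * v * Complex.I) * Φ (ε + 2 * π * t * Complex.I)‖ ≤ C * ‖k t‖ := by
  have hc : IsCompact (Icc (0:ℝ) 1 ×ˢ tsupport k) := isCompact_Icc.prod hks
  have hcont : ContinuousOn (fun p : ℝ × ℝ => Φ (p.1 + 2 * π * p.2 * Complex.I))
      (Icc (0:ℝ) 1 ×ˢ tsupport k) :=
    hΦ.comp (Continuous.continuousOn (by fun_prop)) fun p hp => by simpa using hp.1.1
  obtain ⟨C, hC⟩ := hc.exists_bound_of_continuousOn hcont
  refine ⟨max C 0, le_max_right _ _, fun ε v t h0 h1 => ?_⟩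
  rw [norm_mul, norm_mul, show (2 * π * t * v * Complex.I : ℂ) =
    ((2 * π * t * v : ℝ) : ℂ) * Complex.I by push_cast; ring, Complex.norm_exp_ofReal_mul_I, mul_one,
    mul_comm]
  by_cases ht : t ∈ tsupport k
  · exact mul_le_mul_of_nonneg_right ((hC (ε, t) ⟨⟨h0, h1⟩, ht⟩).trans (le_max_left _ _))
      (norm_nonneg _)
  · simp [image_eq_zero_of_notMem_tsupport ht]

lemma exists_kernelRemainder_le (hkc : Continuous k) (hks : HasCompactSupport k)
    (hΦ : ContinuousOn Φ {s | 0 ≤ s.re}) :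
    ∃ C, 0 ≤ C ∧ ∀ ε v : ℝ, 0 ≤ ε → ε ≤ 1 → ‖kernelRemainder k Φ ε v‖ ≤ C := by
  obtain ⟨C, hC0, hC⟩ := exists_remainder_integrand_bound hks hΦ
  refine ⟨C * ∫ t, ‖k t‖, mul_nonneg hC0 (integral_nonneg fun t => norm_nonneg _),
    fun ε v h0 h1 => ?_⟩
  rw [← integral_const_mul]
  exact norm_integral_le_of_norm_le ((hkc.integrable_of_hasCompactSupport hks).norm.const_mul C)
    (ae_of_all _ fun t => hC ε v t h0 h1)

lemma tendsto_kernelRemainder_zero (hkc : Continuous k) (hks : HasCompactSupport k)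
    (hΦ : ContinuousOn Φ {s | 0 ≤ s.re}) (v : ℝ) :
    Tendsto (fun ε => kernelRemainder k Φ ε v) (𝓝[>] 0) (𝓝 (kernelRemainder k Φ 0 v)) := by
  obtain ⟨C, hC0, hC⟩ := exists_remainder_integrand_bound hks hΦ
  have hpos : ∀ᶠ ε : ℝ in 𝓝[>] 0, 0 < ε ∧ ε < 1 := Ioo_mem_nhdsGT one_pos
  refine tendsto_integral_filter_of_dominated_convergence (fun t => C * ‖k t‖) ?_ ?_
    ((hkc.integrable_of_hasCompactSupport hks).norm.const_mul C) (ae_of_all _ fun t => ?_)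
  · filter_upwards [hpos] with ε hε
    have := continuous_comp_vertical hΦ hε.1.le
    exact ((hkc.mul (by fun_prop)).mul this).aestronglyMeasurable
  · filter_upwards [hpos] with ε hε
    exact ae_of_all _ fun t => hC ε v t hε.1.le hε.2.le
  · refine Tendsto.const_mul _ ?_
    have h1 : ContinuousWithinAt (fun ε : ℝ => Φ (ε + 2 * π * t * Complex.I)) (Ici 0) 0 :=
      ContinuousWithinAt.comp (t := {s : ℂ | 0 ≤ s.re}) (hΦ _ (by simp))
        (Continuous.continuousWithinAt (by fun_prop)) fun ε hε => by simpa using hε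
    exact h1.tendsto.mono_left (nhdsWithin_mono _ Ioi_subset_Ici_self)

lemma tendsto_kernelRemainder_atTop :
    Tendsto (fun v => kernelRemainder k Φ 0 v) atTop (𝓝 0) := by
  have h := Real.tendsto_integral_exp_smul_cocompact
    (fun t : ℝ => k t * Φ ((0:ℝ) + 2 * π * t * Complex.I))
  have h2 := h.comp ((tendsto_neg_atTop_atBot (G := ℝ)).mono_right atBot_le_cocompact)
  refine h2.congr fun v => ?_
  refine integral_congr_ae (ae_of_all _ fun t => ?_)
  simp only [Real.fourierChar_apply, Circle.smul_def, smul_eq_mul]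
  rw [show ((2 * π * -(t * -v) : ℝ) : ℂ) * Complex.I = 2 * π * t * v * Complex.I by push_cast; ring]
  ring

variable {w ℓ : ℕ → ℝ} {m : ℕ} {γ : ℝ} {ν : ℕ → ℂ}

lemma tsum_mul_kernel_eq (hkc : Continuous k) (hks : HasCompactSupport k)
    (hkg : ∀ z : ℝ, (g z : ℂ) = ∫ t : ℝ, k t * Complex.exp (-(2 * π * t * z * Complex.I)))
    (hΦ : ContinuousOn Φ {s | 0 ≤ s.re}) (hw : ∀ δ, 0 ≤ w δ) (hm : 1 ≤ m)
    (hsum : ∀ ε > 0, Summable fun δ => w δ * Real.exp (-(ε * ℓ δ)))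
    (hval : ∀ s : ℂ, 0 < s.re → ∑' δ, (w δ : ℂ) * Complex.exp (-(s * ℓ δ)) =
      (γ : ℂ) / s ^ m + (∑ j ∈ Finset.Icc 1 (m - 1), ν j / s ^ j) + Φ s)
    {ε : ℝ} (hε : 0 < ε) (v : ℝ) :
    HasSum (fun δ => ((w δ * Real.exp (-(ε * ℓ δ)) * g (ℓ δ - v) : ℝ) : ℂ))
      ((γ : ℂ) / (m - 1).factorial * kernelMoment g (m - 1) ε v +
        (∑ j ∈ Finset.Icc 1 (m - 1), ν j / (j - 1).factorial * kernelMoment g (j - 1) ε v) +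
        kernelRemainder k Φ ε v) := by
  have hk := hkc.integrable_of_hasCompactSupport (μ := volume) hks
  convert tsum_mul_exp_mul_kernel hk hkg hw (hsum ε hε) v using 1
  have hre : ∀ t : ℝ, 0 < ((ε : ℂ) + 2 * π * t * Complex.I).re := fun t => by simpa using hε
  have hne : ∀ t : ℝ, ((ε : ℂ) + 2 * π * t * Complex.I) ≠ 0 := fun t h => by
    have := hre t
    rw [h] at this
    simp at this
  simp_rw [hval _ (hre _)]
  have hmom : ∀ j, 1 ≤ j → ((kernelMoment g (j - 1) ε v : ℝ) : ℂ) / (j - 1).factorial =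
      ∫ t : ℝ, k t * Complex.exp (2 * π * t * v * Complex.I) /
        (ε + 2 * π * t * Complex.I) ^ j := fun j hj => by
    rw [kernelMoment, integral_pow_mul_exp_mul_kernel hk hkg hε v (j - 1), Nat.sub_add_cancel hj,
      mul_div_cancel_left₀ _ (Nat.cast_ne_zero.2 (Nat.factorial_ne_zero _))]
  have hint : ∀ F : ℝ → ℂ, Continuous F →
      Integrable fun t : ℝ => k t * Complex.exp (2 * π * t * v * Complex.I) * F t := fun F hF => by
    refine Continuous.integrable_of_hasCompactSupport (by fun_prop) ?_
    exact (hks.mul_right).mul_right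
  have hΦε := continuous_comp_vertical hΦ hε.le
  have hA : Continuous fun t : ℝ => (γ : ℂ) / ((ε : ℂ) + 2 * π * t * Complex.I) ^ m :=
    Continuous.div (by fun_prop) (by fun_prop) fun t => pow_ne_zero _ (hne t)
  have hB : ∀ j ∈ Finset.Icc 1 (m - 1),
      Continuous fun t : ℝ => ν j / ((ε : ℂ) + 2 * π * t * Complex.I) ^ j := fun j _ =>
    Continuous.div (by fun_prop) (by fun_prop) fun t => pow_ne_zero _ (hne t)
  simp_rw [mul_add, Finset.mul_sum]
  have hBi := integrable_finsetSum (Finset.Icc 1 (m - 1)) fun j hj => hint _ (hB j hj)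
  rw [integral_add (by exact (hint _ hA).add hBi) (hint _ hΦε), integral_add (hint _ hA) hBi,
    integral_finsetSum _ fun j hj => hint _ (hB j hj)]
  congr 1
  congr 1
  · rw [div_mul_eq_mul_div, mul_div_assoc, hmom m hm, ← integral_const_mul]
    exact integral_congr_ae (ae_of_all _ fun t => by simp only; ring)
  · refine Finset.sum_congr rfl fun j hj => ?_
    rw [div_mul_eq_mul_div, mul_div_assoc, hmom j (Finset.mem_Icc.1 hj).1, ← integral_const_mul]
    exact integral_congr_ae (ae_of_all _ fun t => by simp only; ring)

end Tauberian

section TauberianBounds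

open MeasureTheory Set Filter
open scoped Real Topology

/-- `g` is a nonnegative rapidly decreasing function, the Fourier transform of the compactly
supported continuous function `k`. -/
structure IsBandLimitedKernel (k : ℝ → ℂ) (g : ℝ → ℝ) : Prop where
  continuous_left : Continuous k
  hasCompactSupport : HasCompactSupport k
  continuous_right : Continuous g
  nonneg : ∀ z, 0 ≤ g z
  pos : 0 < g 0
  decay : ∀ N : ℕ, ∃ C, ∀ z, (1 + |z|) ^ N * g z ≤ C
  eq_integral : ∀ z : ℝ, (g z : ℂ) = ∫ t : ℝ, k t * Complex.exp (-(2 * π * t * z * Complex.I))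

/-- The generalized Dirichlet series with nonnegative coefficients `w` and frequencies `ℓ` has a
pole of order `m` at `0`, and otherwise extends continuously to the closed right half plane. -/
structure HasPoleExpansion (w ℓ : ℕ → ℝ) (m : ℕ) (γ : ℝ) (ν : ℕ → ℂ) (Φ : ℂ → ℂ) : Prop where
  nonneg : ∀ δ, 0 ≤ w δ
  one_le : 1 ≤ m
  pos : 0 < γ
  continuousOn : ContinuousOn Φ {s | 0 ≤ s.re}
  summable : ∀ ε > 0, Summable fun δ => w δ * Real.exp (-(ε * ℓ δ))
  tsum_eq : ∀ s : ℂ, 0 < s.re → ∑' δ, (w δ : ℂ) * Complex.exp (-(s * ℓ δ)) =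
      (γ : ℂ) / s ^ m + (∑ j ∈ Finset.Icc 1 (m - 1), ν j / s ^ j) + Φ s

variable {k : ℝ → ℂ} {g : ℝ → ℝ} {w ℓ : ℕ → ℝ} {m : ℕ} {γ : ℝ} {ν : ℕ → ℂ} {Φ : ℂ → ℂ}

namespace HasPoleExpansion

lemma hasSum_smoothed (hg : IsBandLimitedKernel k g) (h : HasPoleExpansion w ℓ m γ ν Φ)
    {ε : ℝ} (hε : 0 < ε) (v : ℝ) :
    HasSum (fun δ => w δ * Real.exp (-(ε * ℓ δ)) * g (ℓ δ - v))
      (γ / (m - 1).factorial * kernelMoment g (m - 1) ε v +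
        (∑ j ∈ Finset.Icc 1 (m - 1),
          (ν j).re / (j - 1).factorial * kernelMoment g (j - 1) ε v) +
        (kernelRemainder k Φ ε v).re) := by
  have h1 := Complex.hasSum_re (tsum_mul_kernel_eq hg.continuous_left hg.hasCompactSupport
    hg.eq_integral h.continuousOn h.nonneg h.one_le h.summable h.tsum_eq hε v)
  simp only [Complex.ofReal_re] at h1
  convert h1 using 1
  rw [Complex.add_re, Complex.add_re, Complex.re_sum]
  congr 1
  congr 1
  · norm_cast
  · refine Finset.sum_congr rfl fun j _ => ?_
    rw [Complex.re_mul_ofReal]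
    rw [← Complex.ofReal_natCast, Complex.div_ofReal_re]

lemma exists_tsum_le (hg : IsBandLimitedKernel k g) (h : HasPoleExpansion w ℓ m γ ν Φ) :
    ∃ C, 0 ≤ C ∧ ∀ v, Summable (fun δ => w δ * g (ℓ δ - v)) ∧
      ∑' δ, w δ * g (ℓ δ - v) ≤ C * (1 + |v|) ^ (m - 1) := by
  choose C hC0 hC using exists_kernelMoment_le hg.continuous_right hg.nonneg hg.decay
  obtain ⟨D, hD0, hD⟩ := exists_kernelRemainder_le hg.continuous_left hg.hasCompactSupport
    h.continuousOn
  set K := γ / (m - 1).factorial * C (m - 1) +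
    (∑ j ∈ Finset.Icc 1 (m - 1), |(ν j).re| / (j - 1).factorial * C (j - 1)) + D with hK
  have hγ := h.pos
  have hK0 : 0 ≤ K := by
    have : 0 ≤ ∑ j ∈ Finset.Icc 1 (m - 1), |(ν j).re| / (j - 1).factorial * C (j - 1) :=
      Finset.sum_nonneg fun j _ => mul_nonneg (by positivity) (hC0 _)
    have := mul_nonneg (show 0 ≤ γ / (m - 1).factorial by positivity) (hC0 (m - 1))
    linarith
  have hbound : ∀ v ε, 0 < ε → ε ≤ 1 → ∀ s : Finset ℕ,
      ∑ δ ∈ s, w δ * Real.exp (-(ε * ℓ δ)) * g (ℓ δ - v) ≤ K * (1 + |v|) ^ (m - 1) := by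
    intro v ε h0 h1 s
    have hS := h.hasSum_smoothed hg h0 v
    have hv1 : 1 ≤ 1 + |v| := by linarith [abs_nonneg v]
    refine (sum_le_hasSum s (fun δ _ => mul_nonneg (mul_nonneg (h.nonneg δ) (Real.exp_nonneg _))
      (hg.nonneg _)) hS).trans ?_
    rw [hK, add_mul, add_mul, Finset.sum_mul]
    refine add_le_add (add_le_add ?_ (Finset.sum_le_sum fun j hj => ?_)) ?_
    · rw [mul_assoc]
      exact mul_le_mul_of_nonneg_left (hC _ ε v h0.le) (by positivity)
    · rw [mul_assoc]
      refine mul_le_mul (div_le_div_of_nonneg_right (le_abs_self _) (by positivity)) ?_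
        (kernelMoment_nonneg hg.nonneg _ _ _) (by positivity)
      refine (hC _ ε v h0.le).trans (mul_le_mul_of_nonneg_left ?_ (hC0 _))
      exact pow_le_pow_right₀ hv1 (by have := (Finset.mem_Icc.1 hj).2; omega)
    · refine ((Complex.re_le_norm _).trans (hD ε v h0.le h1)).trans ?_
      exact le_mul_of_one_le_right hD0 (one_le_pow₀ hv1)
  have hpart : ∀ v (s : Finset ℕ), ∑ δ ∈ s, w δ * g (ℓ δ - v) ≤ K * (1 + |v|) ^ (m - 1) := by
    intro v s
    have hlim : Tendsto (fun ε => ∑ δ ∈ s, w δ * Real.exp (-(ε * ℓ δ)) * g (ℓ δ - v)) (𝓝[>] 0)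
        (𝓝 (∑ δ ∈ s, w δ * Real.exp (-(0 * ℓ δ)) * g (ℓ δ - v))) :=
      (Continuous.tendsto (f := fun ε : ℝ =>
        ∑ δ ∈ s, w δ * Real.exp (-(ε * ℓ δ)) * g (ℓ δ - v)) (by fun_prop) 0).mono_left
        nhdsWithin_le_nhds
    simp only [zero_mul, neg_zero, Real.exp_zero, mul_one] at hlim
    refine le_of_tendsto hlim ?_
    filter_upwards [Ioo_mem_nhdsGT (one_pos (α := ℝ))] with ε hε
    exact hbound v ε hε.1 hε.2.le s
  exact ⟨K, hK0, fun v => ⟨summable_of_sum_le (fun δ => mul_nonneg (h.nonneg δ) (hg.nonneg _))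
    (hpart v), Real.tsum_le_of_sum_le (fun δ => mul_nonneg (h.nonneg δ) (hg.nonneg _)) (hpart v)⟩⟩

lemma exists_le_tsum (hg : IsBandLimitedKernel k g) (h : HasPoleExpansion w ℓ m γ ν Φ)
    (hℓ : ∀ δ, 0 ≤ ℓ δ) :
    ∃ c, 0 < c ∧ ∀ᶠ v in atTop, c * v ^ (m - 1) ≤ ∑' δ, w δ * g (ℓ δ - v) := by
  choose C hC0 hC using exists_kernelMoment_le hg.continuous_right hg.nonneg hg.decay
  obtain ⟨_, _, hsum⟩ := h.exists_tsum_le hg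
  have hγ := h.pos
  set I := ∫ z in (0:ℝ)..1, g z with hI
  have hI0 : 0 < I := by
    refine intervalIntegral.integral_pos one_pos hg.continuous_right.continuousOn
      (fun z _ => hg.nonneg z) ⟨0, by simp, hg.pos⟩
  set c₀ := γ / (m - 1).factorial * (Real.exp (-2) * I) with hc₀
  have hc₀0 : 0 < c₀ := by positivity
  set K := ∑ j ∈ Finset.Icc 1 (m - 1), |(ν j).re| / (j - 1).factorial * (C (j - 1) * 2 ^ (m - 1))
    with hK
  have hmain : ∀ v : ℝ, 1 ≤ v → c₀ * v ^ (m - 1) - K / v * v ^ (m - 1) -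
      ‖kernelRemainder k Φ 0 v‖ ≤ ∑' δ, w δ * g (ℓ δ - v) := by
    intro v hv
    have hv0 : 0 < v := by linarith
    have hlim : Tendsto (fun ε => c₀ * v ^ (m - 1) - K / v * v ^ (m - 1) -
        ‖kernelRemainder k Φ ε v‖) (𝓝[>] 0)
        (𝓝 (c₀ * v ^ (m - 1) - K / v * v ^ (m - 1) - ‖kernelRemainder k Φ 0 v‖)) :=
      tendsto_const_nhds.sub (tendsto_kernelRemainder_zero hg.continuous_left
        hg.hasCompactSupport h.continuousOn v).norm
    refine le_of_tendsto hlim ?_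
    filter_upwards [Ioo_mem_nhdsGT (show (0:ℝ) < 1 / v by positivity)] with ε hε
    have hS := h.hasSum_smoothed hg hε.1 v
    have hle : ∑' δ, w δ * Real.exp (-(ε * ℓ δ)) * g (ℓ δ - v) ≤ ∑' δ, w δ * g (ℓ δ - v) := by
      refine hS.summable.tsum_le_tsum (fun δ => ?_) (hsum v).1
      refine mul_le_mul_of_nonneg_right ?_ (hg.nonneg _)
      refine mul_le_of_le_one_right (h.nonneg δ) (Real.exp_le_one_iff.2 ?_)
      have := mul_nonneg hε.1.le (hℓ δ)
      linarith
    rw [hS.tsum_eq] at hle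
    refine le_trans ?_ hle
    have hεv : ε * v ≤ 1 := by
      have := hε.2
      rw [lt_div_iff₀ hv0] at this
      exact this.le
    have e1 : c₀ * v ^ (m - 1) ≤ γ / (m - 1).factorial * kernelMoment g (m - 1) ε v := by
      have := le_kernelMoment hg.continuous_right hg.nonneg hg.decay (m - 1) hv hε.1.le hεv
      rw [hc₀, mul_assoc]
      refine mul_le_mul_of_nonneg_left (le_trans (le_of_eq ?_) this) (by positivity)
      ring
    have e2 : -(K / v * v ^ (m - 1)) ≤ ∑ j ∈ Finset.Icc 1 (m - 1),
        (ν j).re / (j - 1).factorial * kernelMoment g (j - 1) ε v := by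
      rw [hK, Finset.sum_div, Finset.sum_mul, ← Finset.sum_neg_distrib]
      refine Finset.sum_le_sum fun j hj => ?_
      obtain ⟨hj1, hj2⟩ := Finset.mem_Icc.1 hj
      have hM := hC (j - 1) ε v hε.1.le
      have hM0 := kernelMoment_nonneg (g := g) hg.nonneg (j - 1) ε v
      have hp : (1 + |v|) ^ (j - 1) * v ≤ 2 ^ (m - 1) * v ^ (m - 1) := by
        rw [abs_of_pos hv0]
        calc (1 + v) ^ (j - 1) * v ≤ (1 + v) ^ (j - 1) * (1 + v) := by gcongr; linarith
          _ = (1 + v) ^ j := by rw [← pow_succ, Nat.sub_add_cancel hj1]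
          _ ≤ (1 + v) ^ (m - 1) := pow_le_pow_right₀ (by linarith) hj2
          _ ≤ (2 * v) ^ (m - 1) := pow_le_pow_left₀ (by linarith) (by linarith) _
          _ = _ := mul_pow _ _ _
      have hM2 : kernelMoment g (j - 1) ε v ≤ C (j - 1) * 2 ^ (m - 1) / v * v ^ (m - 1) := by
        refine hM.trans ?_
        rw [div_mul_eq_mul_div, le_div_iff₀ hv0, mul_assoc, mul_assoc]
        exact mul_le_mul_of_nonneg_left hp (hC0 _)
      calc -(|(ν j).re| / (j - 1).factorial * (C (j - 1) * 2 ^ (m - 1)) / v * v ^ (m - 1))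
          = -(|(ν j).re| / (j - 1).factorial) * (C (j - 1) * 2 ^ (m - 1) / v * v ^ (m - 1)) := by
            ring
        _ ≤ -(|(ν j).re| / (j - 1).factorial) * kernelMoment g (j - 1) ε v :=
            mul_le_mul_of_nonpos_left hM2 (by rw [neg_nonpos]; positivity)
        _ ≤ _ := by
            refine mul_le_mul_of_nonneg_right ?_ hM0
            rw [← neg_div]
            exact div_le_div_of_nonneg_right (neg_abs_le _) (by positivity)
    have e3 : -‖kernelRemainder k Φ ε v‖ ≤ (kernelRemainder k Φ ε v).re :=
      (abs_le.1 (Complex.abs_re_le_norm _)).1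
    linarith
  refine ⟨c₀ / 2, by positivity, ?_⟩
  have hR : ∀ᶠ v in atTop, ‖kernelRemainder k Φ 0 v‖ < c₀ / 4 :=
    (tendsto_kernelRemainder_atTop (k := k) (Φ := Φ)).norm.eventually_lt_const
      (by rw [norm_zero]; positivity)
  have hKv : ∀ᶠ v : ℝ in atTop, K / v < c₀ / 4 :=
    (tendsto_const_nhds.div_atTop tendsto_id).eventually_lt_const (by positivity)
  filter_upwards [hR, hKv, eventually_ge_atTop 1] with v h1 h2 hv
  have hp : 1 ≤ v ^ (m - 1) := one_le_pow₀ hv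
  refine le_trans ?_ (hmain v hv)
  nlinarith

end HasPoleExpansion

end TauberianBounds

section Concentration

open MeasureTheory Set Filter
open scoped Real Topology

lemma summable_inv_one_add_abs_int_sq : Summable fun j : ℤ => ((1 + |(j : ℝ)|) ^ 2)⁻¹ := by
  have h : Summable fun n : ℕ => ((1 + (n : ℝ)) ^ 2)⁻¹ := by
    have := (summable_nat_add_iff 1).2 (Real.summable_nat_pow_inv.2 (one_lt_two))
    refine this.congr fun n => ?_
    push_cast
    rw [add_comm]
  exact Summable.of_nat_of_neg (by simpa using h) (by simpa using h)

variable {k : ℝ → ℂ} {g : ℝ → ℝ} {w ℓ : ℕ → ℝ} {m : ℕ} {γ : ℝ} {ν : ℕ → ℂ} {Φ : ℂ → ℂ}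

lemma IsBandLimitedKernel.exists_forall_le (hg : IsBandLimitedKernel k g) :
    ∃ b c : ℝ, 0 < b ∧ b ≤ 1 ∧ 0 < c ∧ ∀ z, |z| ≤ b → c ≤ g z := by
  have h := hg.continuous_right.tendsto 0
  have h2 := h.eventually_const_lt (half_lt_self hg.pos)
  obtain ⟨r, hr, h3⟩ := Metric.eventually_nhds_iff.1 h2
  refine ⟨min (r / 2) 1, g 0 / 2, by positivity, min_le_right _ _, half_pos hg.pos, fun z hz => ?_⟩
  refine (h3 ?_).le
  rw [Real.dist_eq, sub_zero]
  have := min_le_left (r / 2) 1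
  linarith

namespace HasPoleExpansion

lemma exists_tsum_div_pow_le (hg : IsBandLimitedKernel k g) (h : HasPoleExpansion w ℓ m γ ν Φ) :
    ∃ C, 0 ≤ C ∧ ∀ v, Summable (fun δ => w δ / (1 + |ℓ δ - v|) ^ (m + 1)) ∧
      ∑' δ, w δ / (1 + |ℓ δ - v|) ^ (m + 1) ≤ C * (1 + |v|) ^ (m - 1) := by
  obtain ⟨C, hC0, hC⟩ := h.exists_tsum_le hg
  obtain ⟨b, c, hb0, hb1, hc0, hc⟩ := hg.exists_forall_le
  set S := ∑' j : ℤ, ((1 + |(j : ℝ)|) ^ 2)⁻¹ with hS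
  have hS0 : 0 ≤ S := tsum_nonneg fun j => by positivity
  set K := (2 / b) ^ (m + 1) * c⁻¹ * C with hK
  have hK0 : 0 ≤ K := by positivity
  have hm := h.one_le
  have hnn : ∀ v δ, 0 ≤ w δ / (1 + |ℓ δ - v|) ^ (m + 1) := fun v δ =>
    div_nonneg (h.nonneg δ) (by positivity)
  have hpart : ∀ v (s : Finset ℕ), ∑ δ ∈ s, w δ / (1 + |ℓ δ - v|) ^ (m + 1) ≤
      K * S * (1 + |v|) ^ (m - 1) := by
    intro v s
    let f : ℕ → ℤ := fun δ => ⌊(ℓ δ - v) / b⌋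
    have hterm : ∀ δ, w δ / (1 + |ℓ δ - v|) ^ (m + 1) ≤ (2 / b) ^ (m + 1) * c⁻¹ *
        (((1 + |(f δ : ℝ)|) ^ (m + 1))⁻¹ * (w δ * g (ℓ δ - (v + f δ * b)))) := by
      intro δ
      set z := ℓ δ - v with hz
      have h1 : (f δ : ℝ) * b ≤ z := by
        have := Int.floor_le (z / b)
        rwa [le_div_iff₀ hb0] at this
      have h2 : z < ((f δ : ℝ) + 1) * b := by
        have := Int.lt_floor_add_one (z / b)
        rwa [div_lt_iff₀ hb0] at this
      have hg1 : c ≤ g (ℓ δ - (v + f δ * b)) := hc _ (by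
        rw [abs_le]
        constructor <;> nlinarith)
      have h3 : 1 + |(f δ : ℝ)| ≤ 2 / b * (1 + |z|) := by
        rw [div_mul_eq_mul_div, le_div_iff₀ hb0]
        have : |(f δ : ℝ)| * b = |(f δ : ℝ) * b| := by rw [abs_mul, abs_of_pos hb0]
        have h4 : |(f δ : ℝ) * b| ≤ |z| + b := by
          rw [abs_le]
          constructor
          · linarith [neg_abs_le z]
          · linarith [le_abs_self z]
        nlinarith [abs_nonneg z]
      have h5 : ((1 + |z|) ^ (m + 1))⁻¹ ≤ (2 / b) ^ (m + 1) * ((1 + |(f δ : ℝ)|) ^ (m + 1))⁻¹ := by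
        rw [← div_eq_mul_inv, inv_eq_one_div, div_le_div_iff₀ (by positivity) (by positivity),
          one_mul, ← mul_pow]
        exact pow_le_pow_left₀ (by positivity) h3 _
      have h6 : w δ ≤ c⁻¹ * (w δ * g (ℓ δ - (v + f δ * b))) := by
        rw [inv_mul_eq_div, le_div_iff₀ hc0]
        exact mul_le_mul_of_nonneg_left hg1 (h.nonneg δ)
      rw [div_eq_mul_inv]
      calc w δ * ((1 + |z|) ^ (m + 1))⁻¹ ≤ (c⁻¹ * (w δ * g (ℓ δ - (v + f δ * b)))) *
            ((2 / b) ^ (m + 1) * ((1 + |(f δ : ℝ)|) ^ (m + 1))⁻¹) :=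
            mul_le_mul h6 h5 (by positivity) ((h.nonneg δ).trans h6)
        _ = _ := by ring
    calc ∑ δ ∈ s, w δ / (1 + |ℓ δ - v|) ^ (m + 1)
        ≤ ∑ δ ∈ s, (2 / b) ^ (m + 1) * c⁻¹ *
          (((1 + |(f δ : ℝ)|) ^ (m + 1))⁻¹ * (w δ * g (ℓ δ - (v + f δ * b)))) :=
          Finset.sum_le_sum fun δ _ => hterm δ
      _ = (2 / b) ^ (m + 1) * c⁻¹ * ∑ j ∈ s.image f, ∑ δ ∈ s with f δ = j,
          (((1 + |(f δ : ℝ)|) ^ (m + 1))⁻¹ * (w δ * g (ℓ δ - (v + f δ * b)))) := by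
          rw [← Finset.mul_sum, Finset.sum_fiberwise_of_maps_to
            (fun δ hδ => Finset.mem_image_of_mem f hδ)]
      _ ≤ (2 / b) ^ (m + 1) * c⁻¹ * ∑ j ∈ s.image f,
          C * (1 + |v|) ^ (m - 1) * ((1 + |(j : ℝ)|) ^ 2)⁻¹ := by
          refine mul_le_mul_of_nonneg_left (Finset.sum_le_sum fun j _ => ?_) (by positivity)
          have e1 : ∑ δ ∈ s with f δ = j,
              (((1 + |(f δ : ℝ)|) ^ (m + 1))⁻¹ * (w δ * g (ℓ δ - (v + f δ * b)))) =
              ((1 + |(j : ℝ)|) ^ (m + 1))⁻¹ * ∑ δ ∈ s with f δ = j,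
                w δ * g (ℓ δ - (v + j * b)) := by
            rw [Finset.mul_sum]
            refine Finset.sum_congr rfl fun δ hδ => ?_
            rw [(Finset.mem_filter.1 hδ).2]
          rw [e1]
          have e2 : ∑ δ ∈ s with f δ = j, w δ * g (ℓ δ - (v + j * b)) ≤
              C * (1 + |v + j * b|) ^ (m - 1) :=
            ((hC _).1.sum_le_tsum _ fun δ _ => mul_nonneg (h.nonneg δ) (hg.nonneg _)).trans
              (hC _).2
          have e3 : 1 + |v + j * b| ≤ (1 + |v|) * (1 + |(j : ℝ)|) := by
            have : |(j : ℝ) * b| ≤ |(j : ℝ)| := by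
              rw [abs_mul, abs_of_pos hb0]
              exact mul_le_of_le_one_right (abs_nonneg _) hb1
            nlinarith [abs_add_le v (j * b), abs_nonneg v, abs_nonneg (j : ℝ),
              mul_nonneg (abs_nonneg v) (abs_nonneg (j : ℝ))]
          have e4 := mul_le_mul_of_nonneg_left
            (e2.trans (mul_le_mul_of_nonneg_left (pow_le_pow_left₀ (by positivity) e3 (m - 1)) hC0))
            (show 0 ≤ ((1 + |(j : ℝ)|) ^ (m + 1))⁻¹ by positivity)
          refine e4.trans (le_of_eq ?_)
          rw [show m + 1 = (m - 1) + 2 by omega, mul_pow, pow_add]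
          field_simp
      _ ≤ (2 / b) ^ (m + 1) * c⁻¹ * (C * (1 + |v|) ^ (m - 1) * S) := by
          rw [← Finset.mul_sum]
          refine mul_le_mul_of_nonneg_left (mul_le_mul_of_nonneg_left ?_ (by positivity))
            (by positivity)
          exact summable_inv_one_add_abs_int_sq.sum_le_tsum _ fun j _ => by positivity
      _ = _ := by rw [hK]; ring
  exact ⟨K * S, by positivity, fun v => ⟨summable_of_sum_le (hnn v) (hpart v),
    Real.tsum_le_of_sum_le (hnn v) (hpart v)⟩⟩

lemma exists_tsum_div_pow_le_window (h : HasPoleExpansion w ℓ m γ ν Φ) (hℓ : ∀ δ, 0 ≤ ℓ δ) :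
    ∃ B C : ℝ, 0 < B ∧ 0 < C ∧ ∀ᶠ v in atTop,
      Summable (fun δ => w δ / (1 + |ℓ δ - v|) ^ (m + 1)) ∧
      ∑' δ, w δ / (1 + |ℓ δ - v|) ^ (m + 1) ≤ C * ∑' δ, if |ℓ δ - v| ≤ B then w δ else 0 := by
  obtain ⟨k, g, hkc, hks, hgc, hg0, hgp, hgd, hkg⟩ := exists_bandLimited_kernel
  have hg : IsBandLimitedKernel k g := ⟨hkc, hks, hgc, hg0, hgp, hgd, hkg⟩
  obtain ⟨C, hC0, hC⟩ := h.exists_tsum_div_pow_le hg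
  obtain ⟨c, hc0, hc⟩ := h.exists_le_tsum hg hℓ
  obtain ⟨D, hD⟩ := hgd (m + 2)
  have hDp : 0 < D := lt_of_lt_of_le (by simpa using hgp) (hD 0)
  set B := 2 * D * (C + 1) * 2 ^ (m - 1) / c with hB
  have hBp : 0 < B := by positivity
  refine ⟨B, 2 * D * (C + 1) * 2 ^ (m - 1) / c, hBp, by positivity, ?_⟩
  filter_upwards [hc, eventually_ge_atTop 1] with v hv hv1
  obtain ⟨hs, hle⟩ := hC v
  refine ⟨hs, ?_⟩
  have hp : (1 + |v|) ^ (m - 1) ≤ 2 ^ (m - 1) * v ^ (m - 1) := by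
    rw [← mul_pow, abs_of_pos (by linarith)]
    exact pow_le_pow_left₀ (by linarith) (by linarith) _
  have hind : Summable fun δ => if |ℓ δ - v| ≤ B then w δ else 0 := by
    refine Summable.of_nonneg_of_le (fun δ => ?_) (fun δ => ?_) (hs.mul_left ((1 + B) ^ (m + 1)))
    · split_ifs
      exacts [h.nonneg δ, le_rfl]
    · split_ifs with hδ
      · rw [mul_div_assoc', le_div_iff₀ (by positivity), mul_comm]
        refine mul_le_mul_of_nonneg_right (pow_le_pow_left₀ (by positivity) (by linarith) _)
          (h.nonneg δ)
      · exact mul_nonneg (by positivity) (div_nonneg (h.nonneg δ) (by positivity))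
  set P := ∑' δ, if |ℓ δ - v| ≤ B then w δ else 0 with hP
  have hsplit : ∑' δ, w δ * g (ℓ δ - v) ≤ D * P +
      D / (1 + B) * ∑' δ, w δ / (1 + |ℓ δ - v|) ^ (m + 1) := by
    rw [hP, ← tsum_mul_left, ← tsum_mul_left, ← (hind.mul_left D).tsum_add (hs.mul_left _)]
    refine Summable.tsum_le_tsum (fun δ => ?_) ((h.exists_tsum_le hg).choose_spec.2 v).1
      ((hind.mul_left D).add (hs.mul_left _))
    have hz := hD (ℓ δ - v)
    have hz0 := abs_nonneg (ℓ δ - v)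
    split_ifs with hδ
    · have : g (ℓ δ - v) ≤ D :=
        le_trans (le_mul_of_one_le_left (hg0 _) (one_le_pow₀ (by linarith))) hz
      have h2 := mul_le_mul_of_nonneg_left this (h.nonneg δ)
      have h3 : 0 ≤ D / (1 + B) * (w δ / (1 + |ℓ δ - v|) ^ (m + 1)) :=
        mul_nonneg (by positivity) (div_nonneg (h.nonneg δ) (by positivity))
      linarith
    · push Not at hδ
      rw [mul_zero, zero_add]
      have : g (ℓ δ - v) ≤ D / ((1 + B) * (1 + |ℓ δ - v|) ^ (m + 1)) := by
        rw [le_div_iff₀ (by positivity)]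
        refine le_trans ?_ hz
        rw [mul_comm (g _)]
        refine mul_le_mul_of_nonneg_right ?_ (hg0 _)
        rw [show m + 2 = (m + 1) + 1 by ring, pow_succ _ (m + 1), mul_comm]
        exact mul_le_mul_of_nonneg_left (by linarith) (by positivity)
      refine (mul_le_mul_of_nonneg_left this (h.nonneg δ)).trans (le_of_eq ?_)
      field_simp
  set T := ∑' δ, w δ / (1 + |ℓ δ - v|) ^ (m + 1) with hT
  set p := v ^ (m - 1) with hpdef
  have hp1 : 1 ≤ p := one_le_pow₀ hv1
  have hT2 : T ≤ (C + 1) * 2 ^ (m - 1) * p := by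
    refine hle.trans ?_
    have := mul_le_mul_of_nonneg_left hp hC0
    have h3 : 0 ≤ 2 ^ (m - 1) * p := by positivity
    nlinarith
  have hDT : D / (1 + B) * T ≤ c / 2 * p := by
    rw [div_mul_eq_mul_div, div_le_iff₀ (by positivity)]
    have hcB : c * B = 2 * D * (C + 1) * 2 ^ (m - 1) := by rw [hB]; field_simp
    have := mul_le_mul_of_nonneg_left hT2 hDp.le
    have h4 : c / 2 * p * (1 + B) = c / 2 * p + (c * B) / 2 * p := by ring
    rw [h4, hcB]
    have : 0 ≤ c / 2 * p := by positivity
    nlinarith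
  have hDP : c / 2 * p ≤ D * P := by linarith
  rw [div_mul_eq_mul_div, le_div_iff₀ hc0]
  have h6 : T * c ≤ (C + 1) * 2 ^ (m - 1) * p * c := mul_le_mul_of_nonneg_right hT2 hc0.le
  have h7 : (C + 1) * 2 ^ (m - 1) * 2 * (c / 2 * p) ≤ (C + 1) * 2 ^ (m - 1) * 2 * (D * P) :=
    mul_le_mul_of_nonneg_left hDP (by positivity)
  nlinarith

end HasPoleExpansion

end Concentration

section Window

open MeasureTheory Set Filter
open scoped Real Topology

lemma exists_exp_mul_exp_neg_exp_le {α : ℝ} (hα : 2 ≤ α) (B : ℝ) (N : ℕ) :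
    ∃ C, 0 < C ∧ ∀ z : ℝ, Real.exp ((α - 1) * z) * Real.exp (-(Real.exp (z - B) / 2)) ≤
      C / (1 + |z|) ^ N := by
  obtain ⟨K, hK⟩ := exists_nat_ge α
  set D := K.factorial * (2 * Real.exp B) ^ K with hD
  refine ⟨N.factorial * Real.exp 1 * (1 + D), by positivity, fun z => ?_⟩
  have hN : (1 + |z|) ^ N ≤ N.factorial * Real.exp 1 * Real.exp |z| := by
    have := Real.pow_div_factorial_le_exp (1 + |z|) (by positivity) N
    rw [div_le_iff₀ (by positivity), Real.exp_add] at this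
    linarith
  have hmain : Real.exp |z| * (Real.exp ((α - 1) * z) * Real.exp (-(Real.exp (z - B) / 2))) ≤
      1 + D := by
    have hD0 : 0 ≤ D := by positivity
    rcases le_total 0 z with hz | hz
    · have h1 : Real.exp (-(Real.exp (z - B) / 2)) ≤ D * Real.exp (-(K * z)) := by
        have := Real.pow_div_factorial_le_exp (Real.exp (z - B) / 2) (by positivity) K
        rw [Real.exp_neg, inv_le_comm₀ (by positivity) (by positivity)]
        refine le_trans (le_of_eq ?_) this
        rw [hD, Real.exp_sub, Real.exp_neg, Real.exp_nat_mul]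
        field_simp
        rw [← mul_pow]
        field_simp
      rw [abs_of_nonneg hz]
      calc Real.exp z * (Real.exp ((α - 1) * z) * Real.exp (-(Real.exp (z - B) / 2)))
          ≤ Real.exp z * (Real.exp ((α - 1) * z) * (D * Real.exp (-(K * z)))) := by gcongr
        _ = D * Real.exp (z + (α - 1) * z + -(K * z)) := by
            rw [Real.exp_add, Real.exp_add]; ring
        _ ≤ D * 1 := by
            refine mul_le_mul_of_nonneg_left (Real.exp_le_one_iff.2 ?_) hD0
            nlinarith
        _ ≤ _ := by linarith
    · have h1 : Real.exp (-(Real.exp (z - B) / 2)) ≤ 1 :=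
        Real.exp_le_one_iff.2 (by have := Real.exp_pos (z - B); linarith)
      rw [abs_of_nonpos hz]
      calc Real.exp (-z) * (Real.exp ((α - 1) * z) * Real.exp (-(Real.exp (z - B) / 2)))
          ≤ Real.exp (-z) * (Real.exp ((α - 1) * z) * 1) := by gcongr
        _ = Real.exp (-z + (α - 1) * z) := by rw [mul_one, Real.exp_add]
        _ ≤ 1 := Real.exp_le_one_iff.2 (by nlinarith)
        _ ≤ _ := by linarith
  rw [le_div_iff₀ (by positivity)]
  set E := Real.exp ((α - 1) * z) * Real.exp (-(Real.exp (z - B) / 2)) with hE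
  have hE0 : 0 ≤ E := by positivity
  calc E * (1 + |z|) ^ N ≤ E * (N.factorial * Real.exp 1 * Real.exp |z|) := by gcongr
    _ = N.factorial * Real.exp 1 * (Real.exp |z| * E) := by ring
    _ ≤ _ := by gcongr

lemma summable_pow_mul_exp_neg {b : ℕ → ℝ} (hb0 : ∀ δ, 0 ≤ b δ) {S : ℝ} {A : ℕ}
    (hb : ∀ δ : ℕ, b δ ≤ S * (δ : ℝ) ^ A) (k : ℕ) {u : ℝ} (hu : 0 < u) :
    Summable fun δ : ℕ => b δ * (δ : ℝ) ^ k * Real.exp (-(δ * u)) := by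
  have h := (Real.summable_pow_mul_exp_neg_nat_mul (A + k) hu).mul_left S
  refine Summable.of_nonneg_of_le (fun δ => ?_) (fun δ => ?_) h
  · have := hb0 δ
    positivity
  · rw [show -(δ * u) = -u * (δ : ℝ) by ring, pow_add, ← mul_assoc, ← mul_assoc]
    gcongr
    exact hb δ

lemma HasPoleExpansion.exists_laplace_le_window {b : ℕ → ℝ} {m : ℕ} {γ : ℝ} {ν : ℕ → ℂ} {Φ : ℂ → ℂ}
    {α : ℝ} (hα : 2 ≤ α) (hb0 : ∀ δ, 0 ≤ b δ) (hbz : b 0 = 0) {S : ℝ} {A : ℕ}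
    (hb : ∀ δ : ℕ, b δ ≤ S * (δ : ℝ) ^ A)
    (h : HasPoleExpansion (fun δ => b (δ + 1) * ((δ + 1 : ℕ) : ℝ) ^ (1 - α))
      (fun δ => Real.log ((δ + 1 : ℕ) : ℝ)) m γ ν Φ) :
    ∃ η C u₀ : ℝ, 0 < η ∧ η < 1 ∧ 0 < C ∧ 0 < u₀ ∧ ∀ u, 0 < u → u < u₀ →
      ∑' δ : ℕ, b δ * Real.exp (-(δ * (u / 2))) ≤
        C * ∑' δ : ℕ, if η ≤ δ * u ∧ δ * u ≤ 1 then b δ else 0 := by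
  obtain ⟨B, C, hB, hC, hv⟩ := h.exists_tsum_div_pow_le_window fun δ =>
    Real.log_nonneg (by push_cast; linarith [δ.cast_nonneg (α := ℝ)])
  obtain ⟨D, hD, hDz⟩ := exists_exp_mul_exp_neg_exp_le hα B (m + 1)
  have hlim : Tendsto (fun u : ℝ => Real.log u⁻¹ - B) (𝓝[>] 0) atTop :=
    tendsto_atTop_add_const_right _ _ (Real.tendsto_log_atTop.comp tendsto_inv_nhdsGT_zero)
  obtain ⟨u₀, hu₀, hu⟩ := mem_nhdsGT_iff_exists_Ioo_subset.1 (hlim.eventually hv)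
  refine ⟨Real.exp (-(2 * B)), D * C * Real.exp ((α - 1) * B), u₀, Real.exp_pos _,
    Real.exp_lt_one_iff.2 (by linarith), by positivity, hu₀, fun u h0 h1 => ?_⟩
  obtain ⟨hs, hle⟩ := hu ⟨h0, h1⟩
  set v := Real.log u⁻¹ - B with hvdef
  have hvu : ∀ δ : ℕ, ((δ + 1 : ℕ) : ℝ) * u = Real.exp (Real.log ((δ + 1 : ℕ) : ℝ) - v - B) :=
    fun δ => by
      rw [show Real.log ((δ + 1 : ℕ) : ℝ) - v - B = Real.log ((δ + 1 : ℕ) : ℝ) + Real.log u by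
        rw [hvdef, Real.log_inv]; ring, Real.exp_add, Real.exp_log (by positivity), Real.exp_log h0]
  have hsumF := summable_pow_mul_exp_neg hb0 hb 0 (half_pos h0)
  simp only [pow_zero, mul_one] at hsumF
  have hwin : (Function.support fun δ : ℕ =>
      if Real.exp (-(2 * B)) ≤ δ * u ∧ δ * u ≤ 1 then b δ else 0).Finite := by
    refine (finite_le_nat ⌊1 / u⌋₊).subset fun δ hδ => ?_
    simp only [Function.mem_support, ne_eq, ite_eq_right_iff, not_forall] at hδ
    obtain ⟨⟨_, h3⟩, _⟩ := hδ
    exact Nat.le_floor ((le_div_iff₀ h0).2 h3)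
  have hsumW : Summable fun δ : ℕ =>
      if Real.exp (-(2 * B)) ≤ δ * u ∧ δ * u ≤ 1 then b δ else 0 :=
    summable_of_hasFiniteSupport hwin
  rw [hsumF.tsum_eq_zero_add, hsumW.tsum_eq_zero_add, hbz]
  simp only [zero_mul, ite_self, zero_add]
  have hpw : ∀ δ : ℕ, ((δ + 1 : ℕ) : ℝ) ^ (1 - α) =
      Real.exp (-((α - 1) * Real.log ((δ + 1 : ℕ) : ℝ))) := fun δ => by
    rw [Real.rpow_def_of_pos (by positivity)]
    ring_nf
  have hw' : ∀ δ : ℕ, b (δ + 1) * Real.exp (-(((δ + 1 : ℕ) : ℝ) * (u / 2))) ≤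
      D * Real.exp ((α - 1) * v) * (b (δ + 1) * ((δ + 1 : ℕ) : ℝ) ^ (1 - α) /
        (1 + |Real.log ((δ + 1 : ℕ) : ℝ) - v|) ^ (m + 1)) := fun δ => by
    have h2 := hDz (Real.log ((δ + 1 : ℕ) : ℝ) - v)
    rw [← hvu, show ((δ + 1 : ℕ) : ℝ) * u / 2 = ((δ + 1 : ℕ) : ℝ) * (u / 2) by ring] at h2
    set L := Real.log ((δ + 1 : ℕ) : ℝ) with hL
    have h3 := mul_le_mul_of_nonneg_left h2
      (show 0 ≤ b (δ + 1) * Real.exp ((α - 1) * v) * Real.exp (-((α - 1) * L)) from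
        mul_nonneg (mul_nonneg (hb0 _) (Real.exp_nonneg _)) (Real.exp_nonneg _))
    have h4 : Real.exp ((α - 1) * v) * Real.exp (-((α - 1) * L)) *
        Real.exp ((α - 1) * (L - v)) = 1 := by
      rw [← Real.exp_add, ← Real.exp_add, Real.exp_eq_one_iff]; ring
    rw [hpw]
    calc b (δ + 1) * Real.exp (-(((δ + 1 : ℕ) : ℝ) * (u / 2)))
        = b (δ + 1) * (Real.exp ((α - 1) * v) * Real.exp (-((α - 1) * L)) *
          Real.exp ((α - 1) * (L - v))) * Real.exp (-(((δ + 1 : ℕ) : ℝ) * (u / 2))) := by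
          rw [h4, mul_one]
      _ = _ := by ring
      _ ≤ _ := h3
      _ = _ := by ring
  have hsumF' := (summable_nat_add_iff 1).2 hsumF
  have hsumW' := (summable_nat_add_iff 1).2 hsumW
  have hwin2 : ∀ δ : ℕ, (if |Real.log ((δ + 1 : ℕ) : ℝ) - v| ≤ B then
      b (δ + 1) * ((δ + 1 : ℕ) : ℝ) ^ (1 - α) else 0) ≤
      Real.exp (-((α - 1) * v)) * Real.exp ((α - 1) * B) *
      (if Real.exp (-(2 * B)) ≤ ((δ + 1 : ℕ) : ℝ) * u ∧ ((δ + 1 : ℕ) : ℝ) * u ≤ 1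
        then b (δ + 1) else 0) := fun δ => by
    rw [hvu]
    set L := Real.log ((δ + 1 : ℕ) : ℝ) with hL
    by_cases hδ : |L - v| ≤ B
    · obtain ⟨h5, h6⟩ := abs_le.1 hδ
      rw [if_pos hδ, if_pos ⟨Real.exp_le_exp.2 (by linarith),
        Real.exp_le_one_iff.2 (by linarith)⟩, hpw, ← Real.exp_add, mul_comm]
      refine mul_le_mul_of_nonneg_right (Real.exp_le_exp.2 ?_) (hb0 _)
      nlinarith
    · rw [if_neg hδ]
      refine mul_nonneg (by positivity) ?_
      split_ifs
      exacts [hb0 _, le_rfl]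
  have hsumI : Summable fun δ : ℕ => if |Real.log ((δ + 1 : ℕ) : ℝ) - v| ≤ B then
      b (δ + 1) * ((δ + 1 : ℕ) : ℝ) ^ (1 - α) else 0 := by
    refine Summable.of_nonneg_of_le (fun δ => ?_) hwin2 (hsumW'.mul_left _)
    split_ifs
    exacts [h.nonneg δ, le_rfl]
  calc ∑' δ : ℕ, b (δ + 1) * Real.exp (-(((δ + 1 : ℕ) : ℝ) * (u / 2)))
      ≤ D * Real.exp ((α - 1) * v) * ∑' δ : ℕ, (b (δ + 1) * ((δ + 1 : ℕ) : ℝ) ^ (1 - α) /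
        (1 + |Real.log ((δ + 1 : ℕ) : ℝ) - v|) ^ (m + 1)) := by
        rw [← tsum_mul_left]
        exact hsumF'.tsum_le_tsum hw' (hs.mul_left _)
    _ ≤ D * Real.exp ((α - 1) * v) * (C * ∑' δ : ℕ, if |Real.log ((δ + 1 : ℕ) : ℝ) - v| ≤ B then
      b (δ + 1) * ((δ + 1 : ℕ) : ℝ) ^ (1 - α) else 0) := by gcongr
    _ ≤ D * Real.exp ((α - 1) * v) * (C * ∑' δ : ℕ,
      Real.exp (-((α - 1) * v)) * Real.exp ((α - 1) * B) *
      (if Real.exp (-(2 * B)) ≤ ((δ + 1 : ℕ) : ℝ) * u ∧ ((δ + 1 : ℕ) : ℝ) * u ≤ 1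
        then b (δ + 1) else 0)) := by
        refine mul_le_mul_of_nonneg_left (mul_le_mul_of_nonneg_left ?_ hC.le) (by positivity)
        exact hsumI.tsum_le_tsum hwin2 (hsumW'.mul_left _)
    _ = _ := by
        rw [tsum_mul_left]
        generalize (∑' δ : ℕ, if Real.exp (-(2 * B)) ≤ ((δ + 1 : ℕ) : ℝ) * u ∧
          ((δ + 1 : ℕ) : ℝ) * u ≤ 1 then b (δ + 1) else 0) = W
        rw [Real.exp_neg ((α - 1) * v)]
        field_simp

end Window

section SubgroupGrowth

open MeasureTheory Set Filter
open scoped Real Topology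

variable {G : Type*} [Group G] {α : ℝ}

lemma hasPoleExpansion_aCount {m : ℕ} (hm : 1 ≤ m) {γ : ℝ} (hγ : 0 < γ)
    {ν : ℕ → ℂ} {Φ : ℂ → ℂ} (hΦc : ContinuousOn Φ {s : ℂ | α ≤ s.re})
    (hsum : ∀ s : ℂ, α < s.re →
      Summable fun δ : ℕ => ‖(aCount G (δ + 1) : ℂ) * ((δ + 1 : ℕ) : ℂ) ^ (-s)‖)
    (hval : ∀ s : ℂ, α < s.re →
      ∑' δ : ℕ, (aCount G (δ + 1) : ℂ) * ((δ + 1 : ℕ) : ℂ) ^ (-s) =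
        (γ : ℂ) / (s - (α : ℂ)) ^ m
          + (∑ j ∈ Finset.Icc 1 (m - 1), ν j / (s - (α : ℂ)) ^ j) + Φ s) :
    HasPoleExpansion
      (fun δ => (aCount G (δ + 1) : ℝ) / ((δ + 1 : ℕ) : ℝ) * ((δ + 1 : ℕ) : ℝ) ^ (1 - α))
      (fun δ => Real.log ((δ + 1 : ℕ) : ℝ)) m γ ν (fun s => Φ (s + α)) := by
  have hterm : ∀ (s : ℂ) (δ : ℕ),
      (((aCount G (δ + 1) : ℝ) / ((δ + 1 : ℕ) : ℝ) * ((δ + 1 : ℕ) : ℝ) ^ (1 - α) : ℝ) : ℂ) *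
        Complex.exp (-(s * Real.log ((δ + 1 : ℕ) : ℝ))) =
      (aCount G (δ + 1) : ℂ) * ((δ + 1 : ℕ) : ℂ) ^ (-(s + α)) := fun s δ => by
    have hd : ((δ + 1 : ℕ) : ℂ) ≠ 0 := by exact_mod_cast δ.succ_ne_zero
    have h1 : Complex.exp (-(s * Real.log ((δ + 1 : ℕ) : ℝ))) = ((δ + 1 : ℕ) : ℂ) ^ (-s) := by
      rw [Complex.cpow_def_of_ne_zero hd, ← Complex.natCast_log]
      ring_nf
    rw [h1, Complex.ofReal_mul, Complex.ofReal_div, Complex.ofReal_cpow (by positivity),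
      neg_add, Complex.cpow_add _ _ hd, Complex.ofReal_natCast, Complex.ofReal_natCast,
      Complex.ofReal_sub, Complex.ofReal_one, sub_eq_add_neg (1 : ℂ), Complex.cpow_add _ _ hd,
      Complex.cpow_one]
    field_simp
  refine ⟨fun δ => by positivity, hm, hγ, ?_, fun ε hε => ?_, fun s hs => ?_⟩
  · exact hΦc.comp (Continuous.continuousOn (by fun_prop)) fun s hs => by
      simpa using hs
  · refine (hsum (ε + α) (by simpa using hε)).congr fun δ => ?_
    rw [← hterm, norm_mul, Complex.norm_real, Real.norm_of_nonneg (by positivity), Complex.norm_exp]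
    congr 2
    rw [← Complex.ofReal_mul, Complex.neg_re, Complex.ofReal_re]
  · simp_rw [hterm]
    rw [hval _ (by simpa using hs)]
    simp

lemma exists_aCount_div_le (hsum : ∀ s : ℂ, α < s.re →
      Summable fun δ : ℕ => ‖(aCount G (δ + 1) : ℂ) * ((δ + 1 : ℕ) : ℂ) ^ (-s)‖) :
    ∃ (S : ℝ) (A : ℕ), ∀ δ : ℕ, (aCount G δ : ℝ) / δ ≤ S * (δ : ℝ) ^ A := by
  obtain ⟨A, hA⟩ := exists_nat_gt α
  have h := hsum (A : ℝ) (by simpa using hA)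
  refine ⟨∑' δ : ℕ, ‖(aCount G (δ + 1) : ℂ) * ((δ + 1 : ℕ) : ℂ) ^ (-((A : ℝ) : ℂ))‖, A, fun δ => ?_⟩
  have hS : 0 ≤ ∑' δ : ℕ, ‖(aCount G (δ + 1) : ℂ) * ((δ + 1 : ℕ) : ℂ) ^ (-((A : ℝ) : ℂ))‖ :=
    tsum_nonneg fun δ => norm_nonneg _
  rcases δ with _ | δ
  · rw [Nat.cast_zero, div_zero]
    positivity
  · have h2 := h.le_tsum δ fun _ _ => norm_nonneg _
    rw [Complex.ofReal_natCast, Complex.cpow_neg, Complex.cpow_natCast, norm_mul, norm_inv, norm_pow,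
      Complex.norm_natCast, Complex.norm_natCast, ← div_eq_mul_inv, div_le_iff₀ (by positivity)] at h2
    refine le_trans (div_le_self (by positivity) ?_) h2
    push_cast
    linarith [δ.cast_nonneg (α := ℝ)]

end SubgroupGrowth

section LaplaceMoments

open MeasureTheory Set Filter
open scoped Real Topology

/-- The `k`-th moment of the exponentially tilted weights `b δ * exp (-δ u)`. -/
noncomputable def laplaceMoment (b : ℕ → ℝ) (k : ℕ) (u : ℝ) : ℝ :=
  ∑' δ : ℕ, b δ * (δ : ℝ) ^ k * Real.exp (-(δ * u))

/-- Weights between a positive constant and a polynomial whose Laplace transform at `u / 2` is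
dominated, as `u → 0`, by the mass of the window `η / u ≤ δ ≤ 1 / u`. -/
structure WindowDominated (b : ℕ → ℝ) (c S : ℝ) (A : ℕ) (η C u₀ : ℝ) : Prop where
  zero : b 0 = 0
  c_pos : 0 < c
  le_weight : ∀ δ : ℕ, 1 ≤ δ → c ≤ b δ
  weight_le : ∀ δ : ℕ, b δ ≤ S * (δ : ℝ) ^ A
  η_pos : 0 < η
  η_lt_one : η < 1
  C_pos : 0 < C
  u₀_pos : 0 < u₀
  laplace_le : ∀ u, 0 < u → u < u₀ → ∑' δ : ℕ, b δ * Real.exp (-(δ * (u / 2))) ≤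
    C * ∑' δ : ℕ, if η ≤ δ * u ∧ δ * u ≤ 1 then b δ else 0

namespace WindowDominated

variable {b : ℕ → ℝ} {c S : ℝ} {A : ℕ} {η C u₀ : ℝ} {u : ℝ}

lemma nonneg (h : WindowDominated b c S A η C u₀) (δ : ℕ) : 0 ≤ b δ := by
  rcases Nat.eq_zero_or_pos δ with rfl | hδ
  · rw [h.zero]
  · exact h.c_pos.le.trans (h.le_weight δ hδ)

lemma summable (h : WindowDominated b c S A η C u₀) (k : ℕ) (hu : 0 < u) :
    Summable fun δ : ℕ => b δ * (δ : ℝ) ^ k * Real.exp (-(δ * u)) :=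
  summable_pow_mul_exp_neg h.nonneg h.weight_le k hu

lemma laplaceMoment_nonneg (h : WindowDominated b c S A η C u₀) (k : ℕ) (u : ℝ) :
    0 ≤ laplaceMoment b k u :=
  tsum_nonneg fun δ => mul_nonneg (mul_nonneg (h.nonneg δ) (by positivity)) (Real.exp_nonneg _)

lemma laplaceMoment_anti (h : WindowDominated b c S A η C u₀) (k : ℕ) {u' : ℝ} (hu : 0 < u)
    (huu : u ≤ u') : laplaceMoment b k u' ≤ laplaceMoment b k u := by
  refine (h.summable k (hu.trans_le huu)).tsum_le_tsum (fun δ => ?_) (h.summable k hu)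
  refine mul_le_mul_of_nonneg_left (Real.exp_le_exp.2 ?_)
    (mul_nonneg (h.nonneg δ) (by positivity))
  have := mul_le_mul_of_nonneg_left huu (δ.cast_nonneg (α := ℝ))
  linarith

lemma laplaceMoment_le (h : WindowDominated b c S A η C u₀) (k : ℕ) (hu : 0 < u) :
    laplaceMoment b k u * u ^ k ≤ k.factorial * 2 ^ k * laplaceMoment b 0 (u / 2) := by
  rw [laplaceMoment, laplaceMoment, ← tsum_mul_right, ← tsum_mul_left]
  refine ((h.summable k hu).mul_right _).tsum_le_tsum (fun δ => ?_)
    ((h.summable 0 (half_pos hu)).mul_left _)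
  have h1 := Real.pow_div_factorial_le_exp (δ * (u / 2)) (by positivity) k
  rw [div_le_iff₀ (by positivity)] at h1
  have h2 : Real.exp (-(δ * u)) = Real.exp (-(δ * (u / 2))) * (Real.exp (δ * (u / 2)))⁻¹ := by
    rw [← Real.exp_neg, ← Real.exp_add]; ring_nf
  have h3 : (δ * u : ℝ) ^ k * (Real.exp (δ * (u / 2)))⁻¹ ≤ k.factorial * 2 ^ k := by
    rw [← div_eq_mul_inv, div_le_iff₀ (Real.exp_pos _)]
    calc (δ * u : ℝ) ^ k = 2 ^ k * (δ * (u / 2)) ^ k := by rw [← mul_pow]; ring_nf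
      _ ≤ 2 ^ k * (Real.exp (δ * (u / 2)) * k.factorial) := by gcongr
      _ = _ := by ring
  rw [h2, pow_zero, mul_one]
  have h4 := mul_le_mul_of_nonneg_left h3
    (mul_nonneg (h.nonneg δ) (Real.exp_nonneg (-(δ * (u / 2)))))
  refine le_trans (le_of_eq ?_) (h4.trans (le_of_eq ?_)) <;> ring

/-- A function bounded below by `κ` on the window at `u'` has mean at least a constant times `κ`
for the weights tilted by `u`. -/
lemma le_tsum (h : WindowDominated b c S A η C u₀) {u' M κ : ℝ} {φ : ℕ → ℝ} (hu' : 0 < u')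
    (huu : u' ≤ u) (hu₀ : u' < u₀) (hM : u ≤ M * u') (hφ0 : ∀ δ, 0 ≤ φ δ) (hκ0 : 0 ≤ κ)
    (hφ : ∀ δ : ℕ, η ≤ δ * u' → δ * u' ≤ 1 → κ ≤ φ δ)
    (hs : Summable fun δ : ℕ => b δ * φ δ * Real.exp (-(δ * u))) :
    κ * (Real.exp (-M) / C) * laplaceMoment b 0 (u / 2) ≤
      ∑' δ : ℕ, b δ * φ δ * Real.exp (-(δ * u)) := by
  have hM0 : 0 < M := by
    by_contra hM0
    nlinarith
  have hW : laplaceMoment b 0 (u / 2) ≤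
      C * ∑' δ : ℕ, if η ≤ δ * u' ∧ δ * u' ≤ 1 then b δ else 0 := by
    refine (h.laplaceMoment_anti 0 (half_pos hu') (by linarith)).trans ?_
    simpa [laplaceMoment] using h.laplace_le u' hu' hu₀
  have hterm : ∀ δ : ℕ, κ * Real.exp (-M) * (if η ≤ δ * u' ∧ δ * u' ≤ 1 then b δ else 0) ≤
      b δ * φ δ * Real.exp (-(δ * u)) := fun δ => by
    split_ifs with hδ
    · have h1 : δ * u ≤ M := by
        calc δ * u ≤ δ * (M * u') := by gcongr
          _ = M * (δ * u') := by ring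
          _ ≤ M * 1 := by gcongr; exact hδ.2
          _ = M := mul_one M
      calc κ * Real.exp (-M) * b δ = b δ * κ * Real.exp (-M) := by ring
        _ ≤ b δ * φ δ * Real.exp (-(δ * u)) := by
            have := h.nonneg δ
            have := hφ δ hδ.1 hδ.2
            have := mul_nonneg (h.nonneg δ) (hφ0 δ)
            gcongr
    · rw [mul_zero]
      exact mul_nonneg (mul_nonneg (h.nonneg δ) (hφ0 δ)) (Real.exp_nonneg _)
  have hwin : Summable fun δ : ℕ => if η ≤ δ * u' ∧ δ * u' ≤ 1 then b δ else 0 := by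
    refine summable_of_hasFiniteSupport ((finite_le_nat ⌊1 / u'⌋₊).subset fun δ hδ => ?_)
    simp only [Function.mem_support, ne_eq, ite_eq_right_iff, not_forall] at hδ
    obtain ⟨⟨_, h3⟩, _⟩ := hδ
    exact Nat.le_floor ((le_div_iff₀ hu').2 h3)
  have hC := h.C_pos
  calc κ * (Real.exp (-M) / C) * laplaceMoment b 0 (u / 2)
      ≤ κ * (Real.exp (-M) / C) * (C * ∑' δ : ℕ, if η ≤ δ * u' ∧ δ * u' ≤ 1 then b δ else 0) := by
        gcongr
    _ = κ * Real.exp (-M) * ∑' δ : ℕ, if η ≤ δ * u' ∧ δ * u' ≤ 1 then b δ else 0 := by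
        generalize ∑' δ : ℕ, (if η ≤ δ * u' ∧ δ * u' ≤ 1 then b δ else 0) = w
        field_simp
    _ ≤ _ := by
        rw [← tsum_mul_left]
        exact (hwin.mul_left _).tsum_le_tsum hterm hs

lemma le_laplaceMoment_two (h : WindowDominated b c S A η C u₀) (hu : 0 < u) (hu₀ : u < u₀) :
    η ^ 2 / u ^ 2 * (Real.exp (-1) / C) * laplaceMoment b 0 (u / 2) ≤ laplaceMoment b 2 u := by
  refine h.le_tsum (φ := fun δ => (δ : ℝ) ^ 2) hu le_rfl hu₀ (by linarith)
    (fun δ => by positivity) (by positivity) (fun δ h1 _ => ?_) (h.summable 2 hu)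
  rw [div_le_iff₀ (by positivity), ← mul_pow]
  exact pow_le_pow_left₀ h.η_pos.le h1 2

lemma le_variance (h : WindowDominated b c S A η C u₀) (hu : 0 < u) (hu₀ : u < u₀) (μ : ℝ) :
    1 / (4 * u ^ 2) * (Real.exp (-(2 / η)) / C) * laplaceMoment b 0 (u / 2) ≤
      ∑' δ : ℕ, b δ * (δ - μ) ^ 2 * Real.exp (-(δ * u)) := by
  have hη := h.η_pos
  have hη1 := h.η_lt_one
  have hC := h.C_pos
  have hs : Summable fun δ : ℕ => b δ * (δ - μ) ^ 2 * Real.exp (-(δ * u)) := by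
    refine (((h.summable 2 hu).sub ((h.summable 1 hu).mul_left (2 * μ))).add
      ((h.summable 0 hu).mul_left (μ ^ 2))).congr fun δ => ?_
    ring
  have key : ∀ δ : ℕ, 1 / 2 ≤ |δ * u - μ * u| → 1 / (4 * u ^ 2) ≤ ((δ : ℝ) - μ) ^ 2 := fun δ hδ => by
    rw [div_le_iff₀ (by positivity)]
    have h1 : (1 / 2) ^ 2 ≤ |δ * u - μ * u| ^ 2 := pow_le_pow_left₀ (by norm_num) hδ 2
    rw [sq_abs] at h1
    nlinarith
  rcases le_total (μ * u) (3 / 2) with hμ | hμ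
  · refine h.le_tsum (u' := η * u / 2) (φ := fun δ => ((δ : ℝ) - μ) ^ 2) (by positivity)
      (by nlinarith) (by nlinarith) (le_of_eq (by field_simp)) (fun δ => by positivity)
      (by positivity) (fun δ h1 _ => key δ ?_) hs
    refine le_trans ?_ (le_abs_self _)
    have : 2 ≤ δ * u := by
      have : η * (δ * u) ≥ η * 2 := by linarith
      exact le_of_mul_le_mul_left this hη
    linarith
  · refine le_trans ?_ (h.le_tsum (M := 1) (κ := 1 / (4 * u ^ 2)) (φ := fun δ => ((δ : ℝ) - μ) ^ 2) hu
      le_rfl hu₀ (by linarith) (fun δ => by positivity) (by positivity)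
      (fun δ _ h2 => key δ ?_) hs)
    · have := h.laplaceMoment_nonneg 0 (u / 2)
      gcongr
      rw [le_div_iff₀ hη]
      linarith
    · refine le_trans ?_ (neg_le_abs _)
      linarith

/-- A quantitative strict Cauchy-Schwarz inequality for the tilted moments. -/
lemma exists_sq_le (h : WindowDominated b c S A η C u₀) :
    ∃ ε, 0 < ε ∧ ∀ u, 0 < u → u < u₀ → 0 < laplaceMoment b 0 u →
      laplaceMoment b 1 u ^ 2 ≤ (1 - ε) * (laplaceMoment b 0 u * laplaceMoment b 2 u) := by
  have hC := h.C_pos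
  refine ⟨Real.exp (-(2 / η)) / C / 32, by positivity, fun u hu hu₀ h0 => ?_⟩
  set F0 := laplaceMoment b 0 u with hF0
  set F1 := laplaceMoment b 1 u with hF1
  set F2 := laplaceMoment b 2 u with hF2
  have hv := h.le_variance hu hu₀ (F1 / F0)
  have hexp : ∑' δ : ℕ, b δ * (δ - F1 / F0) ^ 2 * Real.exp (-(δ * u)) = F2 - F1 ^ 2 / F0 := by
    have h1 := ((h.summable 2 hu).hasSum.sub
      (((h.summable 1 hu).hasSum).mul_left (2 * (F1 / F0)))).add
      (((h.summable 0 hu).hasSum).mul_left ((F1 / F0) ^ 2))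
    have h2 : F2 - F1 ^ 2 / F0 = F2 - 2 * (F1 / F0) * F1 + (F1 / F0) ^ 2 * F0 := by
      field_simp
      ring
    rw [h2]
    refine HasSum.tsum_eq (h1.congr_fun fun δ => ?_)
    ring
  have h2 := h.laplaceMoment_le 2 hu
  rw [hexp] at hv
  have h3 : Real.exp (-(2 / η)) / C / 32 * F2 ≤
      1 / (4 * u ^ 2) * (Real.exp (-(2 / η)) / C) * laplaceMoment b 0 (u / 2) := by
    have h4 : F2 ≤ 8 / u ^ 2 * laplaceMoment b 0 (u / 2) := by
      rw [div_mul_eq_mul_div, le_div_iff₀ (by positivity)]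
      refine h2.trans (le_of_eq ?_)
      norm_num [Nat.factorial]
    calc _ ≤ Real.exp (-(2 / η)) / C / 32 * (8 / u ^ 2 * laplaceMoment b 0 (u / 2)) := by gcongr
      _ = _ := by ring
  have h5 := mul_le_mul_of_nonneg_right (h3.trans hv) h0.le
  rw [sub_mul, div_mul_cancel₀ _ h0.ne'] at h5
  linarith

lemma inv_sub_one_le (h : WindowDominated b c S A η C u₀) (hu : 0 < u) :
    c * (1 / u - 1) ≤ laplaceMoment b 0 u := by
  have hr : Real.exp (-u) < 1 := Real.exp_lt_one_iff.2 (by linarith)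
  have hg := hasSum_geometric_of_lt_one (Real.exp_nonneg (-u)) hr
  have hg' := (hasSum_nat_add_iff' 1).2 hg
  simp only [Finset.range_one, Finset.sum_singleton, pow_zero] at hg'
  have hs := h.summable 0 hu
  have h1 : c * ((1 - Real.exp (-u))⁻¹ - 1) ≤ laplaceMoment b 0 u := by
    rw [laplaceMoment, hs.tsum_eq_zero_add, ← (hg'.mul_left c).tsum_eq, h.zero, zero_mul, zero_mul,
      zero_add]
    refine (hg'.mul_left c).summable.tsum_le_tsum (fun δ => ?_) ((summable_nat_add_iff 1).2 hs)
    rw [pow_zero, mul_one, ← Real.exp_nat_mul, mul_neg]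
    exact mul_le_mul_of_nonneg_right (h.le_weight _ (by omega)) (Real.exp_nonneg _)
  refine le_trans (mul_le_mul_of_nonneg_left ?_ h.c_pos.le) h1
  have h2 : 1 - Real.exp (-u) ≤ u := by linarith [Real.add_one_le_exp (-u)]
  rw [one_div]
  have := inv_anti₀ (by linarith) h2
  linarith

lemma laplaceMoment_zero_le_one (h : WindowDominated b c S A η C u₀) (hu : 0 < u) :
    laplaceMoment b 0 u ≤ laplaceMoment b 1 u := by
  refine (h.summable 0 hu).tsum_le_tsum (fun δ => ?_) (h.summable 1 hu)
  rcases Nat.eq_zero_or_pos δ with rfl | hδ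
  · simp [h.zero]
  · have : (1 : ℝ) ≤ δ := by exact_mod_cast hδ
    rw [pow_zero, pow_one]
    have := h.nonneg δ
    gcongr

lemma tendsto_laplaceMoment_zero (h : WindowDominated b c S A η C u₀) :
    Tendsto (laplaceMoment b 0) (𝓝[>] 0) atTop := by
  have h1 : Tendsto (fun u : ℝ => c * (1 / u - 1)) (𝓝[>] 0) atTop := by
    simp only [one_div]
    exact (tendsto_atTop_add_const_right _ _ tendsto_inv_nhdsGT_zero).const_mul_atTop h.c_pos
  refine tendsto_atTop_mono' _ ?_ h1
  filter_upwards [self_mem_nhdsWithin] with u hu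
  exact h.inv_sub_one_le hu

lemma exists_laplaceMoment_two_le (h : WindowDominated b c S A η C u₀) :
    ∃ D, 0 ≤ D ∧ ∀ u, 0 < u → laplaceMoment b 2 u * u ^ (A + 4) ≤ D := by
  have hz : Summable fun δ : ℕ => 1 / (δ : ℝ) ^ 2 := Real.summable_one_div_nat_pow.2 one_lt_two
  have hS : 0 ≤ S := by
    have := (h.nonneg 1).trans (h.weight_le 1)
    simpa using this
  refine ⟨∑' δ : ℕ, S * (A + 4).factorial * (1 / (δ : ℝ) ^ 2), tsum_nonneg fun δ => by positivity,
    fun u hu => ?_⟩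
  rw [laplaceMoment, ← tsum_mul_right]
  refine ((h.summable 2 hu).mul_right _).tsum_le_tsum (fun δ => ?_) (hz.mul_left _)
  rcases Nat.eq_zero_or_pos δ with rfl | hδ
  · simp [h.zero]
  have hδ' : (0 : ℝ) < δ := by exact_mod_cast hδ
  have h1 := Real.pow_div_factorial_le_exp (δ * u) (by positivity) (A + 4)
  rw [div_le_iff₀ (by positivity)] at h1
  have h2 : (δ * u) ^ (A + 4) * Real.exp (-(δ * u)) ≤ (A + 4).factorial := by
    rw [Real.exp_neg, ← div_eq_mul_inv, div_le_iff₀ (Real.exp_pos _)]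
    linarith
  rw [mul_one_div, le_div_iff₀ (by positivity)]
  calc b δ * (δ : ℝ) ^ 2 * Real.exp (-(δ * u)) * u ^ (A + 4) * (δ : ℝ) ^ 2
      ≤ (S * (δ : ℝ) ^ A) * (δ : ℝ) ^ 2 * Real.exp (-(δ * u)) * u ^ (A + 4) * (δ : ℝ) ^ 2 := by
        gcongr
        exact h.weight_le δ
    _ = S * ((δ * u) ^ (A + 4) * Real.exp (-(δ * u))) := by ring
    _ ≤ _ := by gcongr

lemma continuousOn_laplaceMoment (h : WindowDominated b c S A η C u₀) (k : ℕ) {v : ℝ} (hv : 0 < v) :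
    ContinuousOn (laplaceMoment b k) (Ici v) := by
  refine continuousOn_tsum (fun δ => Continuous.continuousOn (by fun_prop)) (h.summable k hv)
    fun δ u hu => ?_
  rw [Real.norm_of_nonneg (mul_nonneg (mul_nonneg (h.nonneg δ) (by positivity)) (Real.exp_nonneg _))]
  refine mul_le_mul_of_nonneg_left (Real.exp_le_exp.2 ?_)
    (mul_nonneg (h.nonneg δ) (by positivity))
  have := mul_le_mul_of_nonneg_left (mem_Ici.1 hu) (δ.cast_nonneg (α := ℝ))
  linarith

/-- Solutions of the saddle point equation. -/
lemma exists_saddle (h : WindowDominated b c S A η C u₀) {x : ℝ} (hx : 0 < x) :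
    ∃ u : ℕ → ℝ, Tendsto u atTop (𝓝[>] 0) ∧ ∀ᶠ n : ℕ in atTop, x * laplaceMoment b 1 (u n) = n := by
  have hlim : Tendsto (laplaceMoment b 1) (𝓝[>] 0) atTop := by
    refine tendsto_atTop_mono' _ ?_ h.tendsto_laplaceMoment_zero
    filter_upwards [self_mem_nhdsWithin] with u hu
    exact h.laplaceMoment_zero_le_one hu
  have hex : ∀ᶠ n : ℕ in atTop, ∃ u, 0 < u ∧ x * laplaceMoment b 1 u = n := by
    filter_upwards [tendsto_natCast_atTop_atTop.eventually_ge_atTop (x * laplaceMoment b 1 1)]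
      with n hn
    obtain ⟨v, hv, hv01⟩ := ((hlim.eventually_ge_atTop (n / x)).and
      (Ioo_mem_nhdsGT (one_pos (α := ℝ)))).exists
    rw [div_le_iff₀ hx, mul_comm] at hv
    have hc : ContinuousOn (fun u => x * laplaceMoment b 1 u) (Icc v 1) :=
      ((h.continuousOn_laplaceMoment 1 hv01.1).mono Icc_subset_Ici_self).const_mul x
    obtain ⟨u, hu, hun⟩ := intermediate_value_Icc' hv01.2.le hc ⟨hn, hv⟩
    exact ⟨u, hv01.1.trans_le hu.1, hun⟩
  obtain ⟨N, hN⟩ := eventually_atTop.1 hex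
  choose! u hu0 hu using hN
  refine ⟨u, tendsto_nhdsWithin_iff.2 ⟨?_, eventually_atTop.2 ⟨N, hu0⟩⟩, eventually_atTop.2 ⟨N, hu⟩⟩
  refine tendsto_order.2 ⟨fun a ha => ?_, fun a ha => ?_⟩
  · exact eventually_atTop.2 ⟨N, fun n hn => ha.trans (hu0 n hn)⟩
  · filter_upwards [eventually_ge_atTop N,
      tendsto_natCast_atTop_atTop.eventually_gt_atTop (x * laplaceMoment b 1 a)] with n hn hna
    by_contra! hle
    have := mul_le_mul_of_nonneg_left (h.laplaceMoment_anti 1 ha hle) hx.le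
    rw [hu n hn] at this
    linarith

end WindowDominated

end LaplaceMoments

section ExponentialRemainder

open Complex

/-- The exponential with its Taylor polynomial of degree one removed. -/
noncomputable def expRemainder (z : ℂ) : ℂ := cexp z - 1 - z

lemma continuous_expRemainder : Continuous expRemainder := by
  unfold expRemainder
  fun_prop

lemma re_expRemainder_le {w : ℂ} (hw : ‖w‖ ≤ 1) (q : ℝ) :
    (expRemainder (w + q * I)).re ≤ ‖w‖ ^ 2 - (1 - Real.cos q) / 6 := by
  have hre : |w.re| ≤ 1 := (Complex.abs_re_le_norm w).trans hw
  have hexp : Real.exp w.re - 1 - w.re ≤ w.re ^ 2 := by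
    have := Real.abs_exp_sub_one_sub_id_le hre
    exact (abs_le.1 this).2
  have hlow : 1 / 3 ≤ Real.exp w.re := by
    have h1 : Real.exp (-1) ≤ Real.exp w.re := Real.exp_le_exp.2 (abs_le.1 hre).1
    have h2 : Real.exp 1 ≤ 3 := by linarith [Real.exp_one_lt_d9]
    rw [Real.exp_neg] at h1
    have h3 := inv_anti₀ (Real.exp_pos 1) h2
    linarith
  have hnorm : ‖w‖ ^ 2 = w.re ^ 2 + w.im ^ 2 := by
    rw [Complex.sq_norm, Complex.normSq_apply]
    ring
  have hcos : 1 - Real.cos q ≤ 2 * (1 - Real.cos (w.im + q)) + w.im ^ 2 := by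
    have h1 := Real.one_sub_sq_div_two_le_cos (x := w.im)
    have h2 : Real.cos q = Real.cos (w.im + q) * Real.cos w.im +
        Real.sin (w.im + q) * Real.sin w.im := by
      rw [← Real.cos_sub, add_sub_cancel_left]
    have h3 := Real.sin_sq_add_cos_sq w.im
    have h4 := Real.sin_sq_add_cos_sq (w.im + q)
    have h5 : 1 - Real.cos q ≤ 2 * (1 - Real.cos (w.im + q)) + 2 * (1 - Real.cos w.im) := by
      rw [h2]
      nlinarith [sq_nonneg (Real.sin (w.im + q) + Real.sin w.im),
        sq_nonneg (Real.cos (w.im + q) + Real.cos w.im - 2)]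
    linarith
  have heq : (expRemainder (w + q * I)).re =
      Real.exp w.re * Real.cos (w.im + q) - 1 - w.re := by
    simp [expRemainder, Complex.exp_re]
  rw [heq, hnorm]
  have h6 := Real.cos_le_one (w.im + q)
  nlinarith [sq_nonneg w.im]

lemma norm_expRemainder_sub_le {z : ℂ} (hz : z.re ≤ 1) :
    ‖expRemainder z - z ^ 2 / 2‖ ≤ 6 * ‖z‖ ^ 3 := by
  rcases le_total ‖z‖ 1 with h | h
  · have h1 := Complex.exp_bound h (n := 3) (by norm_num)
    have h2 : expRemainder z - z ^ 2 / 2 =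
        cexp z - ∑ m ∈ Finset.range 3, z ^ m / m.factorial := by
      simp [expRemainder, Finset.sum_range_succ, Nat.factorial]
      ring
    rw [h2]
    refine h1.trans ?_
    rw [mul_comm]
    gcongr
    norm_num [Nat.factorial]
  · have h1 : ‖cexp z‖ ≤ 3 := by
      rw [Complex.norm_exp]
      exact (Real.exp_le_exp.2 hz).trans (by linarith [Real.exp_one_lt_d9])
    have h2 : ‖expRemainder z - z ^ 2 / 2‖ ≤ ‖cexp z‖ + 1 + ‖z‖ + ‖z‖ ^ 2 / 2 := by
      refine (norm_sub_le _ _).trans (add_le_add ?_ (by simp))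
      exact (norm_sub_le _ _).trans (add_le_add ((norm_sub_le _ _).trans (by simp)) le_rfl)
    have h3 : ‖z‖ ≤ ‖z‖ ^ 3 := le_self_pow₀ h (by norm_num)
    have h4 : ‖z‖ ^ 2 ≤ ‖z‖ ^ 3 := pow_le_pow_right₀ h (by norm_num)
    linarith

lemma norm_expRemainder_le {w : ℂ} (hw : ‖w‖ ≤ 1) (q : ℝ) :
    ‖expRemainder (w + q * I)‖ ≤ 5 + |q| := by
  have h1 : ‖cexp (w + q * I)‖ ≤ 3 := by
    rw [Complex.norm_exp]
    have : (w + q * I).re ≤ 1 := by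
      simpa using (Complex.re_le_norm w).trans hw
    exact (Real.exp_le_exp.2 this).trans (by linarith [Real.exp_one_lt_d9])
  have h2 : ‖w + q * I‖ ≤ 1 + |q| :=
    (norm_add_le _ _).trans (add_le_add hw (by simp))
  have h3 := norm_sub_le (cexp (w + q * I) - 1) (w + q * I)
  have h4 := norm_sub_le (cexp (w + q * I)) 1
  rw [norm_one] at h4
  rw [expRemainder]
  linarith

end ExponentialRemainder

section CosineEnergy

open Complex

/-- The loss of mass of the tilted weights at frequency `θ`. -/
noncomputable def cosineEnergy (b : ℕ → ℝ) (u θ : ℝ) : ℝ :=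
  ∑' δ : ℕ, b δ * (1 - Real.cos (δ * θ)) * Real.exp (-(δ * u))

lemma sq_le_mul_one_sub_cos {θ : ℝ} (hθ : |θ| ≤ Real.pi) : θ ^ 2 ≤ 5 * (1 - Real.cos θ) := by
  have h1 := Real.cos_le_one_sub_mul_cos_sq hθ
  have hπ : Real.pi ^ 2 ≤ 10 := by nlinarith [Real.pi_lt_d2, Real.pi_pos]
  have h2 : 1 / 5 * θ ^ 2 ≤ 2 / Real.pi ^ 2 * θ ^ 2 := by
    refine mul_le_mul_of_nonneg_right ?_ (sq_nonneg θ)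
    rw [div_le_div_iff₀ (by norm_num) (by positivity)]
    linarith
  linarith

lemma hasSum_pow_mul_one_sub_cos {r : ℝ} (hr0 : 0 ≤ r) (hr1 : r < 1) (θ : ℝ) :
    HasSum (fun δ : ℕ => r ^ δ * (1 - Real.cos (δ * θ)))
      ((1 - r)⁻¹ - (1 - r * Real.cos θ) / ((1 - r) ^ 2 + 2 * r * (1 - Real.cos θ))) := by
  have hz : ‖(r : ℂ) * cexp (θ * I)‖ < 1 := by
    rw [norm_mul, Complex.norm_exp_ofReal_mul_I, mul_one, Complex.norm_real,
      Real.norm_of_nonneg hr0]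
    exact hr1
  have h1 := Complex.hasSum_re (hasSum_geometric_of_norm_lt_one hz)
  have h2 : ((1 - (r : ℂ) * cexp (θ * I))⁻¹).re =
      (1 - r * Real.cos θ) / ((1 - r) ^ 2 + 2 * r * (1 - Real.cos θ)) := by
    rw [Complex.inv_re, Complex.normSq_apply]
    simp only [Complex.sub_re, Complex.one_re, Complex.mul_re, Complex.ofReal_re,
      Complex.ofReal_im, Complex.exp_ofReal_mul_I_re, Complex.exp_ofReal_mul_I_im,
      Complex.sub_im, Complex.one_im, Complex.mul_im, zero_mul, sub_zero, add_zero]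
    congr 1
    nlinarith [Real.sin_sq_add_cos_sq θ]
  rw [h2] at h1
  refine ((hasSum_geometric_of_lt_one hr0 hr1).sub h1).congr_fun fun δ => ?_
  rw [mul_pow, ← Complex.exp_nat_mul, ← Complex.ofReal_pow, Complex.re_ofReal_mul]
  have : (δ : ℂ) * (θ * I) = ((δ * θ : ℝ) : ℂ) * I := by push_cast; ring
  rw [this, Complex.exp_ofReal_mul_I_re]
  ring

lemma inv_le_tsum_pow_mul_one_sub_cos {u θ : ℝ} (hu : 0 < u) (hu1 : u ≤ 1) (hθu : u ≤ |θ|)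
    (hθ : |θ| ≤ Real.pi) :
    1 / (21 * u) ≤ ∑' δ : ℕ, Real.exp (-u) ^ δ * (1 - Real.cos (δ * θ)) := by
  have hr1 : Real.exp (-u) < 1 := Real.exp_lt_one_iff.2 (by linarith)
  have hru : 1 - u ≤ Real.exp (-u) := by linarith [Real.add_one_le_exp (-u)]
  have hr3 : 1 / 3 ≤ Real.exp (-u) := by
    have h1 : Real.exp (-1) ≤ Real.exp (-u) := Real.exp_le_exp.2 (by linarith)
    have h2 : Real.exp 1 ≤ 3 := by linarith [Real.exp_one_lt_d9]
    rw [Real.exp_neg 1] at h1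
    have h3 := inv_anti₀ (Real.exp_pos 1) h2
    linarith
  rw [(hasSum_pow_mul_one_sub_cos (Real.exp_nonneg _) hr1 θ).tsum_eq]
  set r := Real.exp (-u)
  have ht := sq_le_mul_one_sub_cos hθ
  set t := 1 - Real.cos θ with ht_def
  have hcos : Real.cos θ = 1 - t := by rw [ht_def]; ring
  have hu2 : u ^ 2 ≤ θ ^ 2 := by
    rw [← sq_abs θ]
    exact pow_le_pow_left₀ hu.le hθu 2
  have ht0 : 0 < t := by nlinarith
  have hr : (1 - r) ^ 2 ≤ u ^ 2 := pow_le_pow_left₀ (by linarith) (by linarith) 2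
  have hD : (1 - r) ^ 2 + 2 * r * t ≤ 7 * t := by nlinarith
  have hD0 : 0 < (1 - r) ^ 2 + 2 * r * t := by positivity
  have hr0 : 0 < 1 - r := by linarith
  have heq : (1 - r)⁻¹ - (1 - r * Real.cos θ) / ((1 - r) ^ 2 + 2 * r * t) =
      r * (1 + r) * t / ((1 - r) * ((1 - r) ^ 2 + 2 * r * t)) := by
    rw [hcos]
    field_simp
    ring
  rw [heq, div_le_div_iff₀ (by positivity) (by positivity), one_mul]
  calc (1 - r) * ((1 - r) ^ 2 + 2 * r * t) ≤ u * (7 * t) := by gcongr; linarith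
    _ = 1 / 3 * (1 + 0) * t * (21 * u) := by ring
    _ ≤ r * (1 + r) * t * (21 * u) := by gcongr; linarith

namespace WindowDominated

variable {b : ℕ → ℝ} {c S : ℝ} {A : ℕ} {η C u₀ : ℝ} {u : ℝ}

lemma summable_mul (h : WindowDominated b c S A η C u₀) (hu : 0 < u) {φ : ℕ → ℝ} {B : ℝ}
    (hφ : ∀ δ, ‖φ δ‖ ≤ B) : Summable fun δ : ℕ => b δ * φ δ * Real.exp (-(δ * u)) := by
  refine Summable.of_norm_bounded ((h.summable 0 hu).mul_left B) fun δ => ?_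
  rw [norm_mul, norm_mul, Real.norm_of_nonneg (h.nonneg δ), Real.norm_of_nonneg (Real.exp_nonneg _),
    pow_zero, mul_one, mul_comm (b δ), mul_assoc]
  exact mul_le_mul_of_nonneg_right (hφ δ) (mul_nonneg (h.nonneg δ) (Real.exp_nonneg _))

lemma summable_cosineEnergy (h : WindowDominated b c S A η C u₀) (hu : 0 < u) (θ : ℝ) :
    Summable fun δ : ℕ => b δ * (1 - Real.cos (δ * θ)) * Real.exp (-(δ * u)) := by
  refine h.summable_mul hu (B := 2) fun δ => ?_
  rw [Real.norm_eq_abs, abs_le]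
  constructor <;> linarith [Real.cos_le_one (δ * θ), Real.neg_one_le_cos (δ * θ)]

lemma cosineEnergy_ge_of_abs_le (h : WindowDominated b c S A η C u₀) (hu : 0 < u) (hu₀ : u < u₀)
    {θ : ℝ} (hθ : |θ| ≤ u) :
    η ^ 2 * Real.exp (-1) / (40 * C) * (laplaceMoment b 2 u * θ ^ 2) ≤ cosineEnergy b u θ := by
  have hC := h.C_pos
  have hη := h.η_pos
  have h1 : η ^ 2 * θ ^ 2 / (5 * u ^ 2) * (Real.exp (-1) / C) * laplaceMoment b 0 (u / 2) ≤
      cosineEnergy b u θ := by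
    refine h.le_tsum hu le_rfl hu₀ (one_mul u).ge
      (fun δ => by linarith [Real.cos_le_one (δ * θ)]) (by positivity) (fun δ h1 h2 => ?_)
      (h.summable_cosineEnergy hu θ)
    have h3 : |δ * θ| ≤ Real.pi := by
      rw [abs_mul, Nat.abs_cast]
      have := mul_le_mul_of_nonneg_left hθ (δ.cast_nonneg (α := ℝ))
      linarith [Real.pi_gt_three]
    have h4 := sq_le_mul_one_sub_cos h3
    have h5 : η ^ 2 * θ ^ 2 ≤ (δ * u) ^ 2 * θ ^ 2 := by gcongr
    rw [div_le_iff₀ (by positivity)]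
    nlinarith [sq_nonneg u]
  have h2 := h.laplaceMoment_le 2 hu
  norm_num [Nat.factorial] at h2
  refine le_trans ?_ h1
  calc η ^ 2 * Real.exp (-1) / (40 * C) * (laplaceMoment b 2 u * θ ^ 2)
      = η ^ 2 * Real.exp (-1) * θ ^ 2 / (40 * C * u ^ 2) * (laplaceMoment b 2 u * u ^ 2) := by
        field_simp
    _ ≤ η ^ 2 * Real.exp (-1) * θ ^ 2 / (40 * C * u ^ 2) * (8 * laplaceMoment b 0 (u / 2)) := by
        gcongr
    _ = _ := by
        field_simp
        ring

lemma cosineEnergy_ge_of_le_abs (h : WindowDominated b c S A η C u₀) (hu : 0 < u) (hu1 : u ≤ 1)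
    {θ : ℝ} (hθu : u ≤ |θ|) (hθ : |θ| ≤ Real.pi) : c / (21 * u) ≤ cosineEnergy b u θ := by
  have hr1 : Real.exp (-u) < 1 := Real.exp_lt_one_iff.2 (by linarith)
  have h1 := mul_le_mul_of_nonneg_left (inv_le_tsum_pow_mul_one_sub_cos hu hu1 hθu hθ) h.c_pos.le
  rw [mul_one_div, ← tsum_mul_left] at h1
  refine h1.trans (((hasSum_pow_mul_one_sub_cos (Real.exp_nonneg _) hr1 θ).summable.mul_left
    c).tsum_le_tsum (fun δ => ?_) (h.summable_cosineEnergy hu θ))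
  rcases Nat.eq_zero_or_pos δ with rfl | hδ
  · simp
  · have h2 := Real.cos_le_one (δ * θ)
    have h3 := mul_le_mul_of_nonneg_right (h.le_weight δ hδ)
      (mul_nonneg (sub_nonneg.2 h2) (Real.exp_nonneg (-(δ * u))))
    rw [← Real.exp_nat_mul, mul_neg]
    linarith

end WindowDominated

end CosineEnergy

section SaddleExponent

open Complex MeasureTheory Filter Set
open scoped Topology

/-- The exponent of the generating function near the saddle point. -/
noncomputable def saddleExponent (b : ℕ → ℝ) (u : ℝ) (w : ℂ) (θ : ℝ) : ℂ :=
  ∑' δ : ℕ, ((b δ * Real.exp (-(δ * u)) : ℝ) : ℂ) * expRemainder (w + (δ * θ : ℝ) * I)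

namespace WindowDominated

variable {b : ℕ → ℝ} {c S : ℝ} {A : ℕ} {η C u₀ : ℝ} {u : ℝ}

lemma norm_saddleExponent_term_le (h : WindowDominated b c S A η C u₀) {w : ℂ} (hw : ‖w‖ ≤ 1)
    {θ B : ℝ} (hθ : |θ| ≤ B) (δ : ℕ) :
    ‖((b δ * Real.exp (-(δ * u)) : ℝ) : ℂ) * expRemainder (w + (δ * θ : ℝ) * I)‖ ≤
      5 * (b δ * (δ : ℝ) ^ 0 * Real.exp (-(δ * u))) +
        B * (b δ * (δ : ℝ) ^ 1 * Real.exp (-(δ * u))) := by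
  have h0 : 0 ≤ b δ * Real.exp (-(δ * u)) := mul_nonneg (h.nonneg δ) (Real.exp_nonneg _)
  rw [norm_mul, Complex.norm_real, Real.norm_of_nonneg h0]
  have h1 : |δ * θ| ≤ δ * B := by
    rw [abs_mul, Nat.abs_cast]
    exact mul_le_mul_of_nonneg_left hθ δ.cast_nonneg
  calc _ ≤ b δ * Real.exp (-(δ * u)) * (5 + δ * B) := by
        refine mul_le_mul_of_nonneg_left ?_ h0
        exact (norm_expRemainder_le hw _).trans (by linarith)
    _ = _ := by ring

lemma summable_saddleExponent (h : WindowDominated b c S A η C u₀) (hu : 0 < u) {w : ℂ}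
    (hw : ‖w‖ ≤ 1) (θ : ℝ) : Summable fun δ : ℕ =>
      ((b δ * Real.exp (-(δ * u)) : ℝ) : ℂ) * expRemainder (w + (δ * θ : ℝ) * I) :=
  Summable.of_norm_bounded (((h.summable 0 hu).mul_left 5).add ((h.summable 1 hu).mul_left |θ|))
    fun δ => h.norm_saddleExponent_term_le hw le_rfl δ

lemma continuousOn_saddleExponent (h : WindowDominated b c S A η C u₀) (hu : 0 < u) {w : ℂ}
    (hw : ‖w‖ ≤ 1) (B : ℝ) : ContinuousOn (saddleExponent b u w) (Icc (-B) B) := by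
  refine continuousOn_tsum (fun δ => Continuous.continuousOn ?_)
    (((h.summable 0 hu).mul_left 5).add ((h.summable 1 hu).mul_left B))
    fun δ θ hθ => h.norm_saddleExponent_term_le hw (abs_le.2 hθ) δ
  exact continuous_const.mul (continuous_expRemainder.comp (by fun_prop))

lemma re_saddleExponent_le (h : WindowDominated b c S A η C u₀) (hu : 0 < u) {w : ℂ}
    (hw : ‖w‖ ≤ 1) (θ : ℝ) : (saddleExponent b u w θ).re ≤
      ‖w‖ ^ 2 * laplaceMoment b 0 u - cosineEnergy b u θ / 6 := by
  have h1 := Complex.hasSum_re (h.summable_saddleExponent hu hw θ).hasSum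
  have h2 := ((h.summable 0 hu).hasSum.mul_left (‖w‖ ^ 2)).sub
    ((h.summable_cosineEnergy hu θ).hasSum.div_const 6)
  refine hasSum_le (fun δ => ?_) h1 h2
  rw [Complex.re_ofReal_mul]
  have h3 := mul_le_mul_of_nonneg_left (re_expRemainder_le hw (δ * θ))
    (mul_nonneg (h.nonneg δ) (Real.exp_nonneg (-(δ * u))))
  refine h3.trans (le_of_eq ?_)
  ring

lemma norm_saddleExponent_sub_le (h : WindowDominated b c S A η C u₀) (hu : 0 < u) {w : ℂ}
    (hw : ‖w‖ ≤ 1) (θ : ℝ) :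
    ‖saddleExponent b u w θ - (w ^ 2 * (laplaceMoment b 0 u : ℂ) +
      2 * w * θ * I * (laplaceMoment b 1 u : ℂ) - θ ^ 2 * (laplaceMoment b 2 u : ℂ)) / 2‖ ≤
      24 * (‖w‖ ^ 3 * laplaceMoment b 0 u + |θ| ^ 3 * laplaceMoment b 3 u) := by
  have hs := fun k => (Complex.hasSum_ofReal.2 (h.summable k hu).hasSum)
  have h1 := (h.summable_saddleExponent hu hw θ).hasSum.sub
    (((((hs 0).mul_left (w ^ 2)).add ((hs 1).mul_left (2 * w * θ * I))).sub
      ((hs 2).mul_left ((θ : ℂ) ^ 2))).div_const 2)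
  have h2 := (((h.summable 0 hu).hasSum.mul_left (‖w‖ ^ 3)).add
    ((h.summable 3 hu).hasSum.mul_left (|θ| ^ 3))).mul_left 24
  refine (congrArg norm h1.tsum_eq).symm.le.trans (tsum_of_norm_bounded h2 fun δ => ?_)
  have h0 : 0 ≤ b δ * Real.exp (-(δ * u)) := mul_nonneg (h.nonneg δ) (Real.exp_nonneg _)
  set z : ℂ := w + (δ * θ : ℝ) * I with hz
  have hzre : z.re ≤ 1 := by
    simpa [hz] using (Complex.re_le_norm w).trans hw
  have heq : ((b δ * Real.exp (-(δ * u)) : ℝ) : ℂ) * expRemainder z -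
      (w ^ 2 * ((b δ * (δ : ℝ) ^ 0 * Real.exp (-(δ * u)) : ℝ) : ℂ) +
        2 * w * θ * I * ((b δ * (δ : ℝ) ^ 1 * Real.exp (-(δ * u)) : ℝ) : ℂ) -
        θ ^ 2 * ((b δ * (δ : ℝ) ^ 2 * Real.exp (-(δ * u)) : ℝ) : ℂ)) / 2 =
      ((b δ * Real.exp (-(δ * u)) : ℝ) : ℂ) * (expRemainder z - z ^ 2 / 2) := by
    rw [hz]
    push_cast
    linear_combination (b δ * cexp (-(δ * u)) * (δ * θ) ^ 2 / 2 : ℂ) * I_sq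
  rw [heq, norm_mul, Complex.norm_real, Real.norm_of_nonneg h0]
  have hzn : ‖z‖ ≤ ‖w‖ + |θ| * δ := by
    refine (norm_add_le _ _).trans (add_le_add le_rfl ?_)
    rw [norm_mul, Complex.norm_I, mul_one, Complex.norm_real, Real.norm_eq_abs, abs_mul,
      Nat.abs_cast, mul_comm]
  have hz3 : ‖z‖ ^ 3 ≤ 4 * (‖w‖ ^ 3 + (|θ| * δ) ^ 3) :=
    (pow_le_pow_left₀ (norm_nonneg z) hzn 3).trans
      ((add_pow_le (norm_nonneg w) (by positivity) 3).trans (le_of_eq (by norm_num)))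
  calc b δ * Real.exp (-(δ * u)) * ‖expRemainder z - z ^ 2 / 2‖
      ≤ b δ * Real.exp (-(δ * u)) * (6 * (4 * (‖w‖ ^ 3 + (|θ| * δ) ^ 3))) := by
        refine mul_le_mul_of_nonneg_left ?_ h0
        exact (norm_expRemainder_sub_le hzre).trans (by linarith)
    _ = _ := by ring

lemma saddleExponent_eq (h : WindowDominated b c S A η C u₀) (hu : 0 < u) {w : ℂ} (hw : ‖w‖ ≤ 1)
    (θ : ℝ) : cexp w * ∑' δ : ℕ, (b δ : ℂ) * ((Real.exp (-u) : ℝ) * cexp (θ * I)) ^ δ =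
      saddleExponent b u w θ + (laplaceMoment b 0 u : ℂ) * (1 + w) +
        θ * I * (laplaceMoment b 1 u : ℂ) := by
  have hs := fun k => (Complex.hasSum_ofReal.2 (h.summable k hu).hasSum)
  have h1 := ((h.summable_saddleExponent hu hw θ).hasSum.add ((hs 0).mul_right (1 + w))).add
    ((hs 1).mul_left (θ * I))
  rw [← tsum_mul_left]
  refine Eq.trans (tsum_congr fun δ => ?_) h1.tsum_eq
  have h2 : ((Real.exp (-u) : ℝ) * cexp (θ * I)) ^ δ =
      ((Real.exp (-(δ * u)) : ℝ) : ℂ) * cexp ((δ * θ : ℝ) * I) := by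
    rw [mul_pow, ← Complex.exp_nat_mul, ← Complex.ofReal_pow, ← Real.exp_nat_mul]
    push_cast
    ring_nf
  rw [h2, expRemainder, Complex.exp_add]
  push_cast
  ring

end WindowDominated

end SaddleExponent

section SaddleIntegral

open Complex MeasureTheory Filter Set
open scoped Topology

lemma exp_neg_div_le {a u : ℝ} (ha : 0 < a) (hu : 0 < u) (k : ℕ) :
    Real.exp (-(a / u)) ≤ k.factorial / a ^ k * u ^ k := by
  have h := Real.pow_div_factorial_le_exp (a / u) (by positivity) k
  rw [Real.exp_neg]
  refine (inv_anti₀ (by positivity) h).trans (le_of_eq ?_)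
  rw [div_pow]
  field_simp

namespace WindowDominated

variable {b : ℕ → ℝ} {c S : ℝ} {A : ℕ} {η C u₀ : ℝ} {u x : ℝ}

lemma laplaceMoment_pos (h : WindowDominated b c S A η C u₀) (k : ℕ) (hu : 0 < u) :
    0 < laplaceMoment b k u := by
  refine (h.summable k hu).tsum_pos (fun δ => mul_nonneg (mul_nonneg (h.nonneg δ) (by positivity))
    (Real.exp_nonneg _)) 1 ?_
  have := h.c_pos.trans_le (h.le_weight 1 le_rfl)
  positivity

lemma exists_laplaceMoment_three_le (h : WindowDominated b c S A η C u₀) (hx : 0 < x) :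
    ∃ D, 0 ≤ D ∧ ∀ u, 0 < u → u < u₀ → x * laplaceMoment b 3 u ≤
      D * √(x * laplaceMoment b 2 u) ^ 3 / √(x * laplaceMoment b 0 u) := by
  have hη := h.η_pos
  have hC := h.C_pos
  set q := η * √(Real.exp (-1) / C) with hq
  have hq0 : 0 < q := by positivity
  have hq2 : q ^ 2 = η ^ 2 * (Real.exp (-1) / C) := by
    rw [hq, mul_pow, Real.sq_sqrt (by positivity)]
  refine ⟨48 / q ^ 3, by positivity, fun u hu hu₀ => ?_⟩
  have h0 := h.laplaceMoment_pos 0 hu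
  have hW0 := h.laplaceMoment_pos 0 (half_pos hu)
  have h2 := h.le_laplaceMoment_two hu hu₀
  have h3 := h.laplaceMoment_le 3 hu
  have h0W := h.laplaceMoment_anti 0 (half_pos hu) (half_le_self hu.le)
  norm_num [Nat.factorial] at h3
  set W := laplaceMoment b 0 (u / 2)
  set s := √(x * W) with hs
  have hs2 : s ^ 2 = x * W := Real.sq_sqrt (by positivity)
  have hs0 : 0 < s := Real.sqrt_pos.2 (by positivity)
  have hsqrt : q * s / u ≤ √(x * laplaceMoment b 2 u) := by
    refine Real.le_sqrt_of_sq_le ?_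
    rw [div_pow, mul_pow, hs2, hq2]
    calc _ = x * (η ^ 2 / u ^ 2 * (Real.exp (-1) / C) * W) := by ring
      _ ≤ _ := by gcongr
  have hs0' : √(x * laplaceMoment b 0 u) ≤ s := Real.sqrt_le_sqrt (by gcongr)
  have hpos : 0 < √(x * laplaceMoment b 0 u) := Real.sqrt_pos.2 (by positivity)
  rw [le_div_iff₀ hpos]
  calc x * laplaceMoment b 3 u * √(x * laplaceMoment b 0 u)
      = x * (laplaceMoment b 3 u * u ^ 3) / u ^ 3 * √(x * laplaceMoment b 0 u) := by field_simp
    _ ≤ x * (48 * W) / u ^ 3 * s := by gcongr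
    _ = 48 / q ^ 3 * (q * s / u) ^ 3 := by
        field_simp
        linear_combination -hs2
    _ ≤ _ := by gcongr

lemma exists_norm_exp_saddleExponent_le (h : WindowDominated b c S A η C u₀) (hx : 0 < x) :
    ∃ C₁ C₂ : ℝ, 0 < C₁ ∧ 0 ≤ C₂ ∧ ∀ u, 0 < u → u < u₀ → u ≤ 1 → ∀ w : ℂ, ‖w‖ ≤ 1 →
      ∀ θ : ℝ, |θ| ≤ Real.pi → ‖cexp (x * saddleExponent b u w θ)‖ ≤
        Real.exp (‖w‖ ^ 2 * (x * laplaceMoment b 0 u)) *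
          (Real.exp (-C₁ * (x * laplaceMoment b 2 u * θ ^ 2)) +
            C₂ * (1 + x * laplaceMoment b 2 u * θ ^ 2)⁻¹) := by
  have hη := h.η_pos
  have hC := h.C_pos
  have hc := h.c_pos
  obtain ⟨D, hD0, hD⟩ := h.exists_laplaceMoment_two_le
  set a := x * c / 126 with ha
  have ha0 : 0 < a := by positivity
  refine ⟨η ^ 2 * Real.exp (-1) / (240 * C), (A + 4).factorial / a ^ (A + 4) *
    (1 + x * D * Real.pi ^ 2), by positivity, by positivity,
    fun u hu hu₀ hu1 w hw θ hθ => ?_⟩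
  have h2 := h.laplaceMoment_pos 2 hu
  have hre := mul_le_mul_of_nonneg_left (h.re_saddleExponent_le hu hw θ) hx.le
  have hnorm : ‖cexp (x * saddleExponent b u w θ)‖ ≤
      Real.exp (‖w‖ ^ 2 * (x * laplaceMoment b 0 u)) *
        Real.exp (-(x / 6 * cosineEnergy b u θ)) := by
    rw [Complex.norm_exp, Complex.re_ofReal_mul, ← Real.exp_add]
    refine Real.exp_le_exp.2 (hre.trans (le_of_eq ?_))
    ring
  refine hnorm.trans (mul_le_mul_of_nonneg_left ?_ (Real.exp_nonneg _))
  have hV : 0 ≤ x * laplaceMoment b 2 u * θ ^ 2 := by positivity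
  rcases le_total |θ| u with hθu | hθu
  · refine le_add_of_le_of_nonneg (Real.exp_le_exp.2 ?_) (by positivity)
    have := mul_le_mul_of_nonneg_left (h.cosineEnergy_ge_of_abs_le hu hu₀ hθu)
      (show 0 ≤ x / 6 by positivity)
    refine (neg_le_neg this).trans (le_of_eq ?_)
    field_simp
    ring
  · refine le_add_of_nonneg_of_le (Real.exp_nonneg _) ?_
    have h3 := mul_le_mul_of_nonneg_left (h.cosineEnergy_ge_of_le_abs hu hu1 hθu hθ)
      (show 0 ≤ x / 6 by positivity)
    have h4 : Real.exp (-(x / 6 * cosineEnergy b u θ)) ≤ Real.exp (-(a / u)) := by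
      refine Real.exp_le_exp.2 ((neg_le_neg h3).trans (le_of_eq ?_))
      rw [ha]
      field_simp
      ring
    refine h4.trans ((exp_neg_div_le ha0 hu (A + 4)).trans ?_)
    rw [mul_assoc]
    refine mul_le_mul_of_nonneg_left ?_ (by positivity)
    rw [← div_eq_mul_inv, le_div_iff₀ (by positivity)]
    have hθ2 : θ ^ 2 ≤ Real.pi ^ 2 := by
      rw [← sq_abs θ]
      exact pow_le_pow_left₀ (abs_nonneg θ) hθ 2
    have h5 : u ^ (A + 4) ≤ 1 := pow_le_one₀ hu.le hu1
    calc u ^ (A + 4) * (1 + x * laplaceMoment b 2 u * θ ^ 2)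
        = u ^ (A + 4) + x * (laplaceMoment b 2 u * u ^ (A + 4)) * θ ^ 2 := by ring
      _ ≤ 1 + x * D * Real.pi ^ 2 := by
          have := hD u hu
          gcongr

lemma sqrt_mul_integral_eq {V : ℝ} (hV : 0 < V) (f : ℝ → ℂ) :
    (√V : ℂ) * ∫ θ in -Real.pi..Real.pi, f θ =
      ∫ τ : ℝ, (Ioc (-(Real.pi * √V)) (Real.pi * √V)).indicator (fun τ => f (τ / √V)) τ := by
  have hs : 0 < √V := Real.sqrt_pos.2 hV
  rw [integral_indicator measurableSet_Ioc, ← intervalIntegral.integral_of_le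
    (by nlinarith [Real.pi_pos]), intervalIntegral.integral_comp_div _ hs.ne', neg_div,
    mul_div_cancel_right₀ _ hs.ne', real_smul]

lemma tendsto_saddleExponent (h : WindowDominated b c S A η C u₀) (hx : 0 < x) {u : ℕ → ℝ}
    (hu : Tendsto u atTop (𝓝[>] 0)) {ρ : ℝ}
    (hρ : Tendsto (fun k => x * laplaceMoment b 1 (u k) /
      (√(x * laplaceMoment b 0 (u k)) * √(x * laplaceMoment b 2 (u k)))) atTop (𝓝 ρ))
    (ζ : ℂ) (τ : ℝ) :
    Tendsto (fun k => x * saddleExponent b (u k) (ζ / √(x * laplaceMoment b 0 (u k)))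
      (τ / √(x * laplaceMoment b 2 (u k)))) atTop
      (𝓝 ((-(1 / 2)) * τ ^ 2 + ζ * ρ * I * τ + ζ ^ 2 / 2)) := by
  obtain ⟨D, hD0, hD⟩ := h.exists_laplaceMoment_three_le hx
  have hu0 : ∀ᶠ k in atTop, 0 < u k := hu.eventually self_mem_nhdsWithin
  have huu₀ : ∀ᶠ k in atTop, u k < u₀ :=
    (tendsto_nhdsWithin_iff.1 hu).1.eventually_lt_const h.u₀_pos
  have hs : Tendsto (fun k => √(x * laplaceMoment b 0 (u k))) atTop atTop :=
    Real.tendsto_sqrt_atTop.comp ((h.tendsto_laplaceMoment_zero.comp hu).const_mul_atTop hx)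
  have hmain : Tendsto (fun k => (-(1 / 2)) * (τ : ℂ) ^ 2 + ζ * ((x * laplaceMoment b 1 (u k) /
      (√(x * laplaceMoment b 0 (u k)) * √(x * laplaceMoment b 2 (u k))) : ℝ) : ℂ) * I * τ +
        ζ ^ 2 / 2) atTop (𝓝 ((-(1 / 2)) * τ ^ 2 + ζ * ρ * I * τ + ζ ^ 2 / 2)) := by
    have h1 := (Complex.continuous_ofReal.tendsto ρ).comp hρ
    exact ((((h1.const_mul ζ).mul_const I).mul_const (τ : ℂ)).const_add _).add_const _
  refine hmain.congr_dist ?_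
  have hbound : Tendsto (fun k => 24 * (‖ζ‖ ^ 3 + |τ| ^ 3 * D) /
      √(x * laplaceMoment b 0 (u k))) atTop (𝓝 0) := hs.const_div_atTop _
  refine squeeze_zero' (Eventually.of_forall fun k => dist_nonneg) ?_ hbound
  filter_upwards [hu0, huu₀, hs.eventually_ge_atTop ‖ζ‖] with k hk hk₀ hkζ
  have h0 := h.laplaceMoment_pos 0 hk
  have h2 := h.laplaceMoment_pos 2 hk
  have hD' := hD _ hk hk₀
  set s := √(x * laplaceMoment b 0 (u k)) with hs_def
  set v := √(x * laplaceMoment b 2 (u k)) with hv_def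
  have hs0 : 0 < s := Real.sqrt_pos.2 (by positivity)
  have hv0 : 0 < v := Real.sqrt_pos.2 (by positivity)
  have hs2 : s ^ 2 = x * laplaceMoment b 0 (u k) := Real.sq_sqrt (by positivity)
  have hv2 : v ^ 2 = x * laplaceMoment b 2 (u k) := Real.sq_sqrt (by positivity)
  have hw : ‖ζ / s‖ ≤ 1 := by
    rw [norm_div, Complex.norm_real, Real.norm_of_nonneg hs0.le]
    exact div_le_one_of_le₀ hkζ hs0.le
  have hE := h.norm_saddleExponent_sub_le hk hw (τ / v)
  have heq : (-(1 / 2)) * (τ : ℂ) ^ 2 + ζ * ((x * laplaceMoment b 1 (u k) / (s * v) : ℝ) : ℂ) * I * τ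
      + ζ ^ 2 / 2 = x * (((ζ / s) ^ 2 * (laplaceMoment b 0 (u k) : ℂ) +
      2 * (ζ / s) * (τ / v : ℝ) * I * (laplaceMoment b 1 (u k) : ℂ) -
        (τ / v : ℝ) ^ 2 * (laplaceMoment b 2 (u k) : ℂ)) / 2) := by
    have hs2' : (s : ℂ) ^ 2 = x * laplaceMoment b 0 (u k) := by exact_mod_cast hs2
    have hv2' : (v : ℂ) ^ 2 = x * laplaceMoment b 2 (u k) := by exact_mod_cast hv2
    have hs0' : (s : ℂ) ≠ 0 := by exact_mod_cast hs0.ne'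
    have hv0' : (v : ℂ) ≠ 0 := by exact_mod_cast hv0.ne'
    push_cast
    field_simp
    linear_combination (ζ ^ 2 * v ^ 2) * hs2' - (τ ^ 2 * s ^ 2 : ℂ) * hv2'
  rw [heq, dist_comm, dist_eq_norm, ← mul_sub, norm_mul, Complex.norm_real,
    Real.norm_of_nonneg hx.le]
  refine (mul_le_mul_of_nonneg_left hE hx.le).trans ?_
  rw [norm_div, Complex.norm_real, Real.norm_of_nonneg hs0.le, abs_div, abs_of_pos hv0]
  have h5 : x * ((‖ζ‖ / s) ^ 3 * laplaceMoment b 0 (u k)) = ‖ζ‖ ^ 3 / s := by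
    field_simp
    linear_combination (-‖ζ‖ ^ 3) * hs2
  have h6 : x * ((|τ| / v) ^ 3 * laplaceMoment b 3 (u k)) ≤ |τ| ^ 3 * D / s := by
    calc _ = |τ| ^ 3 / v ^ 3 * (x * laplaceMoment b 3 (u k)) := by ring
      _ ≤ |τ| ^ 3 / v ^ 3 * (D * v ^ 3 / s) := by gcongr
      _ = _ := by field_simp
  calc _ = 24 * (x * ((‖ζ‖ / s) ^ 3 * laplaceMoment b 0 (u k)) +
        x * ((|τ| / v) ^ 3 * laplaceMoment b 3 (u k))) := by ring
    _ ≤ 24 * (‖ζ‖ ^ 3 / s + |τ| ^ 3 * D / s) := by rw [h5]; gcongr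
    _ = _ := by ring

lemma integral_cexp_gaussian (ρ : ℝ) (ζ : ℂ) :
    ∫ τ : ℝ, cexp ((-(1 / 2)) * τ ^ 2 + ζ * ρ * I * τ + ζ ^ 2 / 2) =
      (√(2 * Real.pi) : ℂ) * cexp ((1 - ρ ^ 2) * ζ ^ 2 / 2) := by
  rw [integral_cexp_quadratic (by norm_num)]
  congr 1
  · rw [Real.sqrt_eq_rpow, Complex.ofReal_cpow (by positivity)]
    push_cast
    congr 1
    ring
  · congr 1
    linear_combination (ζ ^ 2 * ρ ^ 2 / 2 : ℂ) * I_sq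

lemma tendsto_saddleIntegral (h : WindowDominated b c S A η C u₀) (hx : 0 < x) {u : ℕ → ℝ}
    (hu : Tendsto u atTop (𝓝[>] 0)) {ρ : ℝ}
    (hρ : Tendsto (fun k => x * laplaceMoment b 1 (u k) /
      (√(x * laplaceMoment b 0 (u k)) * √(x * laplaceMoment b 2 (u k)))) atTop (𝓝 ρ)) (ζ : ℂ) :
    Tendsto (fun k => (√(x * laplaceMoment b 2 (u k)) : ℂ) * ∫ θ in -Real.pi..Real.pi,
      cexp (x * saddleExponent b (u k) (ζ / √(x * laplaceMoment b 0 (u k))) θ)) atTop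
      (𝓝 ((√(2 * Real.pi) : ℂ) * cexp ((1 - ρ ^ 2) * ζ ^ 2 / 2))) := by
  obtain ⟨C₁, C₂, hC₁, hC₂, hb⟩ := h.exists_norm_exp_saddleExponent_le hx
  have hu0 : ∀ᶠ k in atTop, 0 < u k := hu.eventually self_mem_nhdsWithin
  have huu₀ : ∀ᶠ k in atTop, u k < u₀ :=
    (tendsto_nhdsWithin_iff.1 hu).1.eventually_lt_const h.u₀_pos
  have hu1 : ∀ᶠ k in atTop, u k < 1 :=
    (tendsto_nhdsWithin_iff.1 hu).1.eventually_lt_const one_pos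
  have hF0 := h.tendsto_laplaceMoment_zero.comp hu
  have hs : Tendsto (fun k => √(x * laplaceMoment b 0 (u k))) atTop atTop :=
    Real.tendsto_sqrt_atTop.comp (hF0.const_mul_atTop hx)
  have hv : Tendsto (fun k => √(x * laplaceMoment b 2 (u k))) atTop atTop := by
    refine tendsto_atTop_mono' _ ?_ hs
    filter_upwards [hu0] with k hk
    refine Real.sqrt_le_sqrt (mul_le_mul_of_nonneg_left ?_ hx.le)
    refine (h.summable 0 hk).tsum_le_tsum (fun δ => ?_) (h.summable 2 hk)
    rcases Nat.eq_zero_or_pos δ with rfl | hδ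
    · simp [h.zero]
    · have h1 : (1 : ℝ) ≤ (δ : ℝ) ^ 2 := one_le_pow₀ (by exact_mod_cast hδ)
      have := h.nonneg δ
      rw [pow_zero]
      gcongr
  rw [← integral_cexp_gaussian]
  have hw : ∀ᶠ k in atTop, ‖ζ / √(x * laplaceMoment b 0 (u k))‖ ≤ 1 := by
    filter_upwards [hs.eventually_ge_atTop ‖ζ‖] with k hk
    rw [norm_div, Complex.norm_real, Real.norm_of_nonneg (Real.sqrt_nonneg _)]
    exact div_le_one_of_le₀ hk (Real.sqrt_nonneg _)
  have hlim := tendsto_integral_filter_of_dominated_convergence (μ := volume)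
    (l := (atTop : Filter ℕ))
    (F := fun k τ => (Ioc (-(Real.pi * √(x * laplaceMoment b 2 (u k))))
      (Real.pi * √(x * laplaceMoment b 2 (u k)))).indicator (fun τ : ℝ => cexp (x *
        saddleExponent b (u k) (ζ / √(x * laplaceMoment b 0 (u k)))
          (τ / √(x * laplaceMoment b 2 (u k))))) τ)
    (f := fun τ : ℝ => cexp ((-(1 / 2)) * τ ^ 2 + ζ * ρ * I * τ + ζ ^ 2 / 2))
    (fun τ => Real.exp (‖ζ‖ ^ 2) * (Real.exp (-C₁ * τ ^ 2) + C₂ * (1 + τ ^ 2)⁻¹)) ?_ ?_ ?_ ?_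
  · refine hlim.congr' ?_
    filter_upwards [hu0] with k hk
    rw [sqrt_mul_integral_eq (mul_pos hx (h.laplaceMoment_pos 2 hk))]
  · filter_upwards [hu0, hw] with k hk hkw
    rw [aestronglyMeasurable_indicator_iff measurableSet_Ioc]
    refine ContinuousOn.aestronglyMeasurable ?_ measurableSet_Ioc
    have hv0 : 0 < √(x * laplaceMoment b 2 (u k)) :=
      Real.sqrt_pos.2 (mul_pos hx (h.laplaceMoment_pos 2 hk))
    refine Complex.continuous_exp.comp_continuousOn (continuousOn_const.mul
      ((h.continuousOn_saddleExponent hk hkw Real.pi).comp (by fun_prop) fun τ hτ => ?_))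
    rw [mem_Icc, le_div_iff₀ hv0, div_le_iff₀ hv0]
    exact ⟨by linarith [hτ.1], hτ.2⟩
  · filter_upwards [hu0, huu₀, hu1, hw] with k hk hk₀ hk1 hkw
    refine Eventually.of_forall fun τ => ?_
    have h0 := mul_pos hx (h.laplaceMoment_pos 0 hk)
    have h2 := mul_pos hx (h.laplaceMoment_pos 2 hk)
    have hv0 := Real.sqrt_pos.2 h2
    have hs0 := Real.sqrt_pos.2 h0
    by_cases hτ : τ ∈ Ioc (-(Real.pi * √(x * laplaceMoment b 2 (u k))))
      (Real.pi * √(x * laplaceMoment b 2 (u k)))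
    · rw [indicator_of_mem hτ]
      refine (hb _ hk hk₀ hk1.le _ hkw _ ?_).trans (le_of_eq ?_)
      · rw [abs_div, abs_of_pos hv0, div_le_iff₀ hv0, abs_le]
        exact ⟨by linarith [hτ.1], hτ.2⟩
      · have h3 : x * laplaceMoment b 2 (u k) * (τ / √(x * laplaceMoment b 2 (u k))) ^ 2 = τ ^ 2 := by
          rw [div_pow, Real.sq_sqrt h2.le, mul_div_cancel₀ _ h2.ne']
        have h4 : ‖ζ / √(x * laplaceMoment b 0 (u k))‖ ^ 2 * (x * laplaceMoment b 0 (u k)) =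
            ‖ζ‖ ^ 2 := by
          rw [norm_div, Complex.norm_real, Real.norm_of_nonneg hs0.le, div_pow, Real.sq_sqrt h0.le,
            div_mul_cancel₀ _ h0.ne']
        rw [h3, h4]
    · rw [indicator_of_notMem hτ, norm_zero]
      positivity
  · exact ((integrable_exp_neg_mul_sq hC₁).add (integrable_inv_one_add_sq.const_mul C₂)).const_mul _
  · refine Eventually.of_forall fun τ => ?_
    refine ((Complex.continuous_exp.tendsto _).comp (h.tendsto_saddleExponent hx hu hρ ζ τ)).congr' ?_
    filter_upwards [hv.eventually_gt_atTop |τ|] with k hk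
    rw [indicator_of_mem]
    · rfl
    · have h3 : √(x * laplaceMoment b 2 (u k)) ≤ Real.pi * √(x * laplaceMoment b 2 (u k)) :=
        le_mul_of_one_le_left (Real.sqrt_nonneg _) (by linarith [Real.pi_gt_three])
      have := abs_lt.1 hk
      exact ⟨by linarith, by linarith⟩

end WindowDominated

end SaddleIntegral

section OrbitGeneratingFunction

open Complex MeasureTheory Filter Set
open scoped Topology

namespace WindowDominated

variable {b : ℕ → ℝ} {c S : ℝ} {A : ℕ} {η C u₀ : ℝ} {u x : ℝ}

lemma summable_mul_pow (h : WindowDominated b c S A η C u₀) {r : ℝ} (hr0 : 0 ≤ r) (hr1 : r < 1) :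
    Summable fun δ => b δ * r ^ δ := by
  have hs : Summable fun δ : ℕ => S * ((δ : ℝ) ^ A * r ^ δ) :=
    (summable_pow_mul_geometric_of_norm_lt_one A
      (by rwa [Real.norm_of_nonneg hr0])).mul_left S
  refine Summable.of_nonneg_of_le (fun δ => mul_nonneg (h.nonneg δ) (by positivity))
    (fun δ => ?_) hs
  rw [← mul_assoc]
  exact mul_le_mul_of_nonneg_right (h.weight_le δ) (by positivity)

/-- The coefficients of `exp (y ∑ b δ z ^ δ)`, evaluated through the saddle point. -/
lemma integral_saddleExponent (h : WindowDominated b c S A η C u₀) {f : ℂ → ℕ → ℂ}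
    (hf0 : ∀ y, f y 0 = 1)
    (hf : ∀ y n, f y (n + 1) = y * ∑ k ∈ Finset.range (n + 1),
      ((k + 1 : ℕ) * b (k + 1) : ℂ) * (n.descFactorial k : ℂ) * f y (n - k))
    (hu : 0 < u) {n : ℕ} (hn : x * laplaceMoment b 1 u = n) {w : ℂ} (hw : ‖w‖ ≤ 1) :
    ∫ θ in -Real.pi..Real.pi, cexp (x * saddleExponent b u w θ) =
      cexp (-(x * laplaceMoment b 0 u)) * (2 * Real.pi * (Real.exp (-u) : ℝ) ^ n / n.factorial) *
        (cexp (-(x * laplaceMoment b 0 u * w)) * f (x * cexp w) n) := by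
  have h1 := integral_exp_series (y := x * cexp w) h.nonneg
    (fun r hr0 hr1 => h.summable_mul_pow hr0 hr1) h.zero (hf0 _) (hf _) (Real.exp_pos (-u))
    (Real.exp_lt_one_iff.2 (by linarith)) n
  have hn' : (x : ℂ) * laplaceMoment b 1 u = n := by exact_mod_cast hn
  have h2 : ∀ θ : ℝ, cexp (x * saddleExponent b u w θ) =
      cexp (-(x * laplaceMoment b 0 u * (1 + w))) *
        (cexp (x * cexp w * ∑' δ : ℕ, (b δ : ℂ) * ((Real.exp (-u) : ℝ) * cexp (θ * I)) ^ δ) *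
          cexp (-(n * θ * I))) := fun θ => by
    rw [mul_assoc (x : ℂ) (cexp w), h.saddleExponent_eq hu hw θ, ← Complex.exp_add, ← Complex.exp_add,
      ← hn']
    congr 1
    ring
  simp only [h2]
  rw [intervalIntegral.integral_const_mul, h1, mul_add, neg_add, Complex.exp_add]
  ring_nf

lemma exists_subseq_tendsto (h : WindowDominated b c S A η C u₀) {f : ℂ → ℕ → ℂ}
    (hf0 : ∀ y, f y 0 = 1)
    (hf : ∀ y n, f y (n + 1) = y * ∑ k ∈ Finset.range (n + 1),
      ((k + 1 : ℕ) * b (k + 1) : ℂ) * (n.descFactorial k : ℂ) * f y (n - k))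
    (hx : 0 < x) {N : ℕ → ℕ} (hN : Tendsto N atTop atTop) :
    ∃ (φ : ℕ → ℕ) (κ : ℝ) (a s : ℕ → ℝ), Tendsto φ atTop atTop ∧ 0 < κ ∧
      (∀ᶠ k in atTop, 0 < s k) ∧ ∀ ζ : ℂ, Tendsto (fun k => cexp (-(ζ * (a k / s k : ℝ))) *
        (f (x * cexp (ζ / s k)) (N (φ k)) / f x (N (φ k)))) atTop
        (𝓝 (cexp (κ * ζ ^ 2 / 2))) := by
  obtain ⟨u, hu, hun⟩ := h.exists_saddle hx
  obtain ⟨ε, hε, hcs⟩ := h.exists_sq_le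
  have hu' := hu.comp hN
  have hu0 : ∀ᶠ k in atTop, 0 < u (N k) := hu'.eventually self_mem_nhdsWithin
  have huu₀ : ∀ᶠ k in atTop, u (N k) < u₀ :=
    (tendsto_nhdsWithin_iff.1 hu').1.eventually_lt_const h.u₀_pos
  have hρ : ∀ᶠ k in atTop, x * laplaceMoment b 1 (u (N k)) /
      (√(x * laplaceMoment b 0 (u (N k))) * √(x * laplaceMoment b 2 (u (N k)))) ∈
        {ρ : ℝ | ρ ^ 2 ≤ 1 - ε} := by
    filter_upwards [hu0, huu₀] with k hk hk₀
    have h0 := h.laplaceMoment_pos 0 hk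
    have h2 := h.laplaceMoment_pos 2 hk
    change _ ^ 2 ≤ _
    rw [div_pow, mul_pow, mul_pow, Real.sq_sqrt (by positivity),
      Real.sq_sqrt (by positivity), div_le_iff₀ (by positivity)]
    have := mul_le_mul_of_nonneg_left (hcs _ hk hk₀ h0) (sq_nonneg x)
    linarith
  have hcpt : IsCompact {ρ : ℝ | ρ ^ 2 ≤ 1 - ε} := by
    refine Metric.isCompact_of_isClosed_isBounded (isClosed_le (by fun_prop) (by fun_prop))
      ((Metric.isBounded_Icc (-1 : ℝ) 1).subset fun ρ hρ => ?_)
    have h1 : ρ ^ 2 ≤ 1 - ε := hρ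
    exact abs_le.1 ((sq_le_one_iff_abs_le_one ρ).1 (by linarith))
  obtain ⟨ρ, hρε, φ, hφ, hlim⟩ := hcpt.tendsto_subseq' hρ.frequently
  have hφ' := hφ.tendsto_atTop
  have hu'' := hu'.comp hφ'
  refine ⟨φ, 1 - ρ ^ 2, fun k => x * laplaceMoment b 0 (u (N (φ k))),
    fun k => √(x * laplaceMoment b 0 (u (N (φ k)))), hφ', by
      have h1 : ρ ^ 2 ≤ 1 - ε := hρε
      linarith, ?_, fun ζ => ?_⟩
  · filter_upwards [hφ'.eventually hu0] with k hk
    exact Real.sqrt_pos.2 (mul_pos hx (h.laplaceMoment_pos 0 hk))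
  have hs : Tendsto (fun k => √(x * laplaceMoment b 0 (u (N (φ k))))) atTop atTop :=
    Real.tendsto_sqrt_atTop.comp ((h.tendsto_laplaceMoment_zero.comp hu'').const_mul_atTop hx)
  have hw : ∀ᶠ k in atTop, ‖ζ / √(x * laplaceMoment b 0 (u (N (φ k))))‖ ≤ 1 := by
    filter_upwards [hs.eventually_ge_atTop ‖ζ‖] with k hk
    rw [norm_div, Complex.norm_real, Real.norm_of_nonneg (Real.sqrt_nonneg _)]
    exact div_le_one_of_le₀ hk (Real.sqrt_nonneg _)
  have h2π : (√(2 * Real.pi) : ℂ) ≠ 0 := by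
    exact_mod_cast (Real.sqrt_pos.2 Real.two_pi_pos).ne'
  have hdiv := (h.tendsto_saddleIntegral hx hu'' hlim ζ).div
    (h.tendsto_saddleIntegral hx hu'' hlim 0) (mul_ne_zero h2π (Complex.exp_ne_zero _))
  rw [mul_div_mul_left _ _ h2π, zero_pow two_ne_zero, mul_zero, zero_div, Complex.exp_zero,
    div_one] at hdiv
  push_cast
  refine hdiv.congr' ?_
  filter_upwards [hφ'.eventually hu0, hw, (hN.comp hφ').eventually hun] with k hk hkw hkn
  have h0 := mul_pos hx (h.laplaceMoment_pos 0 hk)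
  have hv : (√(x * laplaceMoment b 2 (u (N (φ k)))) : ℂ) ≠ 0 := by
    exact_mod_cast (Real.sqrt_pos.2 (mul_pos hx (h.laplaceMoment_pos 2 hk))).ne'
  have hne : cexp (-(x * laplaceMoment b 0 (u (N (φ k))))) *
      (2 * Real.pi * (Real.exp (-u (N (φ k))) : ℝ) ^ N (φ k) / (N (φ k)).factorial) ≠ 0 := by
    refine mul_ne_zero (Complex.exp_ne_zero _) (div_ne_zero (mul_ne_zero (mul_ne_zero two_ne_zero
      ?_) (pow_ne_zero _ ?_)) ?_)
    · exact_mod_cast Real.pi_ne_zero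
    · exact_mod_cast (Real.exp_pos _).ne'
    · exact_mod_cast Nat.factorial_ne_zero _
  simp only [Pi.div_apply, Function.comp_apply]
  rw [mul_div_mul_left _ _ hv, h.integral_saddleExponent hf0 hf hk hkn hkw, zero_div,
    h.integral_saddleExponent hf0 hf hk hkn (by simp), mul_zero, neg_zero, Complex.exp_zero,
    one_mul, mul_one, Function.comp_apply, mul_div_mul_left _ _ hne, mul_div_assoc]
  ring_nf

end WindowDominated

end OrbitGeneratingFunction

section ExponentialMoments

open Complex MeasureTheory ProbabilityTheory Filter
open scoped Topology NNReal

/-- `f` cut off at height `M`. -/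
noncomputable def cutoff (M : ℝ) (f : ℝ → ℝ) (y : ℝ) : ℝ := max (-M) (min (f y) M)

lemma abs_cutoff_le {M : ℝ} (hM : 0 < M) (f : ℝ → ℝ) (y : ℝ) : |cutoff M f y| ≤ M := by
  rw [cutoff, abs_le]
  exact ⟨le_max_left _ _, max_le (by linarith) (min_le_right _ _)⟩

lemma abs_sub_cutoff_le {M : ℝ} (hM : 0 < M) (f : ℝ → ℝ) (y : ℝ) :
    |f y - cutoff M f y| ≤ f y ^ 2 / M := by
  rw [le_div_iff₀ hM, cutoff]
  rcases le_total (f y) M with h1 | h1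
  · rw [min_eq_left h1]
    rcases le_total (-M) (f y) with h2 | h2
    · rw [max_eq_right h2, sub_self, abs_zero, zero_mul]
      positivity
    · rw [max_eq_left h2, abs_of_nonpos (by linarith)]
      nlinarith
  · rw [min_eq_right h1, max_eq_right (by linarith), abs_of_nonneg (by linarith)]
    nlinarith

section

variable {Ω : Type*} [MeasurableSpace Ω] {μ : Measure Ω} {X : Ω → ℝ} {f : ℝ → ℝ} {B : ℝ}

lemma integrable_comp_of_abs_le (hX : Measurable X)
    (hint : ∀ t : ℝ, Integrable (fun ω => Real.exp (t * X ω)) μ) (hf : Continuous f)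
    (hB : ∀ y, |f y| ≤ B * (Real.exp y + Real.exp (-y))) : Integrable (fun ω => f (X ω)) μ := by
  refine (((hint 1).add (hint (-1))).const_mul B).mono'
    (hf.measurable.comp hX).aestronglyMeasurable (Eventually.of_forall fun ω => ?_)
  simpa using hB (X ω)

lemma sq_le_of_abs_le (hB : ∀ y, |f y| ≤ B * (Real.exp y + Real.exp (-y))) (y : ℝ) :
    f y ^ 2 ≤ 2 * B ^ 2 * (Real.exp (2 * y) + Real.exp (-2 * y)) := by
  have h1 := pow_le_pow_left₀ (abs_nonneg _) (hB y) 2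
  rw [sq_abs, mul_pow] at h1
  have h2 : Real.exp (2 * y) = Real.exp y ^ 2 := by rw [← Real.exp_nat_mul]; norm_num
  have h3 : Real.exp (-2 * y) = Real.exp (-y) ^ 2 := by rw [← Real.exp_nat_mul]; norm_num
  rw [h2, h3]
  nlinarith [sq_nonneg B, mul_nonneg (sq_nonneg B) (sq_nonneg (Real.exp y - Real.exp (-y)))]

lemma abs_integral_sub_cutoff_le (hX : Measurable X) [IsProbabilityMeasure μ]
    (hint : ∀ t : ℝ, Integrable (fun ω => Real.exp (t * X ω)) μ) (hf : Continuous f)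
    (hB : ∀ y, |f y| ≤ B * (Real.exp y + Real.exp (-y))) {M : ℝ} (hM : 0 < M) :
    |∫ ω, f (X ω) ∂μ - ∫ ω, cutoff M f (X ω) ∂μ| ≤
      2 * B ^ 2 * (∫ ω, Real.exp (2 * X ω) ∂μ + ∫ ω, Real.exp (-2 * X ω) ∂μ) / M := by
  have hcut : Continuous (cutoff M f) := by
    unfold cutoff
    fun_prop
  have h1 : Integrable (fun ω => cutoff M f (X ω)) μ :=
    (integrable_const M).mono' (hcut.measurable.comp hX).aestronglyMeasurable
      (Eventually.of_forall fun ω => abs_cutoff_le hM f (X ω))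
  have h2 := (((hint 2).add (hint (-2))).const_mul (2 * B ^ 2)).div_const M
  rw [← integral_sub (integrable_comp_of_abs_le hX hint hf hB) h1, ← integral_add (hint 2) (hint (-2)),
    ← integral_const_mul, ← integral_div, ← Real.norm_eq_abs]
  refine norm_integral_le_of_norm_le h2 (Eventually.of_forall fun ω => ?_)
  exact (abs_sub_cutoff_le hM f (X ω)).trans
    (div_le_div_of_nonneg_right (sq_le_of_abs_le hB (X ω)) hM.le)

end

variable {Ω : Type*} [MeasurableSpace Ω] {μ : ℕ → Measure Ω} {X : ℕ → Ω → ℝ} {κ : ℝ≥0}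

lemma tendsto_integral_exp (hlim : ∀ ζ : ℂ, Tendsto (fun k => ∫ ω, cexp (ζ * X k ω) ∂μ k) atTop
    (𝓝 (cexp (κ * ζ ^ 2 / 2)))) (t : ℝ) :
    Tendsto (fun k => ∫ ω, Real.exp (t * X k ω) ∂μ k) atTop (𝓝 (Real.exp (κ * t ^ 2 / 2))) := by
  have h1 := (Complex.continuous_re.tendsto _).comp (hlim t)
  have h2 : (cexp (κ * (t : ℂ) ^ 2 / 2)).re = Real.exp (κ * t ^ 2 / 2) := by
    rw [← Complex.ofReal_re (Real.exp _)]
    push_cast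
    rfl
  rw [h2] at h1
  refine h1.congr fun k => ?_
  rw [Function.comp_apply, ← Complex.ofReal_re (∫ ω, Real.exp (t * X k ω) ∂μ k),
    ← integral_complex_ofReal]
  push_cast
  rfl

variable [∀ k, IsProbabilityMeasure (μ k)]

/-- Convergence of the moment generating functions to that of a Gaussian implies convergence of
the expectations of continuous functions of at most exponential growth. -/
theorem tendsto_integral_of_tendsto_exp (hX : ∀ k, Measurable (X k))
    (hint : ∀ k (t : ℝ), Integrable (fun ω => Real.exp (t * X k ω)) (μ k))
    (hlim : ∀ ζ : ℂ, Tendsto (fun k => ∫ ω, cexp (ζ * X k ω) ∂μ k) atTop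
      (𝓝 (cexp (κ * ζ ^ 2 / 2)))) {f : ℝ → ℝ} (hf : Continuous f) {B : ℝ}
    (hB : ∀ y, |f y| ≤ B * (Real.exp y + Real.exp (-y))) :
    Tendsto (fun k => ∫ ω, f (X k ω) ∂μ k) atTop (𝓝 (∫ y, f y ∂gaussianReal 0 κ)) := by
  have hprob : ∀ k, IsProbabilityMeasure ((μ k).map (X k)) := fun k =>
    Measure.isProbabilityMeasure_map (hX k).aemeasurable
  let law : ℕ → ProbabilityMeasure ℝ := fun k => ⟨(μ k).map (X k), hprob k⟩
  let gauss : ProbabilityMeasure ℝ := ⟨gaussianReal 0 κ, inferInstance⟩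
  have hweak : Tendsto law atTop (𝓝 gauss) := by
    refine ProbabilityMeasure.tendsto_iff_tendsto_charFun.2 fun t => ?_
    have h1 := hlim (t * I)
    change Tendsto (fun k => charFun ((μ k).map (X k)) t) atTop (𝓝 (charFun (gaussianReal 0 κ) t))
    have h2 : charFun (gaussianReal 0 κ) t = cexp (κ * (t * I) ^ 2 / 2) := by
      rw [charFun_gaussianReal]
      congr 1
      push_cast
      linear_combination (-(κ * t ^ 2 / 2 : ℂ)) * I_sq
    rw [h2]
    refine h1.congr fun k => ?_
    rw [charFun_apply_real, integral_map (hX k).aemeasurable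
      (by fun_prop : Continuous fun y : ℝ => cexp (t * y * I)).aestronglyMeasurable]
    refine integral_congr_ae (Eventually.of_forall fun ω => ?_)
    simp only
    ring_nf
  have hG := fun M (hM : 0 < M) => abs_integral_sub_cutoff_le (μ := gaussianReal 0 κ) (X := fun y => y)
    measurable_id (fun t => integrable_exp_mul_gaussianReal t) hf hB hM
  set D' := 2 * B ^ 2 * (∫ y, Real.exp (2 * y) ∂gaussianReal 0 κ +
    ∫ y, Real.exp (-2 * y) ∂gaussianReal 0 κ)
  set D := 2 * B ^ 2 * (Real.exp (κ * 2 ^ 2 / 2) + Real.exp (κ * (-2) ^ 2 / 2))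
  have hD : Tendsto (fun k => 2 * B ^ 2 * (∫ ω, Real.exp (2 * X k ω) ∂μ k +
      ∫ ω, Real.exp (-2 * X k ω) ∂μ k)) atTop (𝓝 D) :=
    ((tendsto_integral_exp hlim 2).add (tendsto_integral_exp hlim (-2))).const_mul _
  rw [Metric.tendsto_atTop']
  intro ε hε
  obtain ⟨M, hM0, hM1, hM2⟩ := ((eventually_gt_atTop (0 : ℝ)).and
    (((tendsto_const_nhds.div_atTop tendsto_id).eventually_lt_const
      (show (0 : ℝ) < ε / 3 by positivity) : ∀ᶠ M : ℝ in atTop, (D + 1) / M < ε / 3).and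
    ((tendsto_const_nhds.div_atTop tendsto_id).eventually_lt_const
      (show (0 : ℝ) < ε / 3 by positivity) : ∀ᶠ M : ℝ in atTop, D' / M < ε / 3))).exists
  have hcut : Continuous (cutoff M f) := by
    unfold cutoff
    fun_prop
  have hbdd : Tendsto (fun k => ∫ ω, cutoff M f (X k ω) ∂μ k) atTop
      (𝓝 (∫ y, cutoff M f y ∂gaussianReal 0 κ)) := by
    have h1 := ProbabilityMeasure.tendsto_iff_forall_integral_tendsto.1 hweak
      (BoundedContinuousFunction.ofNormedAddCommGroup (cutoff M f) hcut M
        fun y => abs_cutoff_le hM0 f y)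
    refine h1.congr fun k => ?_
    exact integral_map (hX k).aemeasurable hcut.aestronglyMeasurable
  have hev := (hD.eventually_lt_const (lt_add_one D)).and
    (hbdd.eventually (Metric.ball_mem_nhds _ (show (0 : ℝ) < ε / 3 by positivity)))
  obtain ⟨K, hK⟩ := eventually_atTop.1 hev
  refine ⟨K, fun k hk => ?_⟩
  obtain ⟨h1, h2⟩ := hK k hk.le
  have h3 := abs_integral_sub_cutoff_le (hX k) (hint k) hf hB hM0
  have h4 := (h3.trans (div_le_div_of_nonneg_right h1.le hM0.le)).trans_lt hM1
  have h5 := (hG M hM0).trans_lt hM2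
  rw [Real.dist_eq] at h2
  rw [Real.dist_eq]
  rw [abs_lt] at *
  constructor <;> linarith [h2.1, h2.2, h4.1, h4.2, h5.1, h5.2]

end ExponentialMoments

section Standardization

open Complex MeasureTheory ProbabilityTheory Filter
open scoped Topology NNReal

lemma norm_cexp_sub_cexp_le {R : ℝ} {z w : ℂ} (hz : ‖z‖ ≤ R) (hw : ‖w‖ ≤ R) :
    ‖cexp z - cexp w‖ ≤ Real.exp R * ‖z - w‖ := by
  refine (convex_closedBall (0 : ℂ) R).norm_image_sub_le_of_norm_deriv_le
    (fun y _ => Complex.differentiableAt_exp) (fun y hy => ?_) (by simpa using hw) (by simpa using hz)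
  rw [Complex.deriv_exp, Complex.norm_exp]
  exact Real.exp_le_exp.2 ((Complex.re_le_norm y).trans (by simpa using hy))

lemma exp_mul_abs_le (t y : ℝ) : Real.exp (t * |y|) ≤ Real.exp (t * y) + Real.exp (-t * y) := by
  have h1 := Real.exp_pos (t * y)
  have h2 := Real.exp_pos (-t * y)
  rcases abs_cases y with ⟨h, _⟩ | ⟨h, _⟩
  · rw [h]
    linarith
  · rw [h, show t * -y = -t * y by ring]
    linarith

lemma norm_cexp_mul_sub_le {R : ℝ} {ζ w : ℂ} (hζ : ‖ζ‖ ≤ R) (hw : ‖w‖ ≤ R) (y : ℝ) :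
    ‖cexp (ζ * y) - cexp (w * y)‖ ≤
      ‖ζ - w‖ * (Real.exp ((R + 1) * y) + Real.exp (-(R + 1) * y)) := by
  have h1 : ‖cexp (ζ * y) - cexp (w * y)‖ ≤ Real.exp (R * |y|) * ‖ζ * y - w * y‖ := by
    apply norm_cexp_sub_cexp_le <;> rw [norm_mul, Complex.norm_real, Real.norm_eq_abs] <;> gcongr
  have h2 : Real.exp (R * |y|) * |y| ≤ Real.exp ((R + 1) * |y|) := by
    rw [add_mul, Real.exp_add, one_mul]
    gcongr
    linarith [Real.add_one_le_exp |y|]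
  rw [← sub_mul, norm_mul, Complex.norm_real, Real.norm_eq_abs] at h1
  calc _ ≤ ‖ζ - w‖ * (Real.exp (R * |y|) * |y|) := by linarith
    _ ≤ _ := mul_le_mul_of_nonneg_left (h2.trans (exp_mul_abs_le _ _)) (norm_nonneg _)

lemma integrable_cexp_mul {Ω : Type*} [MeasurableSpace Ω] {μ : Measure Ω} {X : Ω → ℝ}
    (hX : Measurable X) (hint : ∀ t : ℝ, Integrable (fun ω => Real.exp (t * X ω)) μ) (ζ : ℂ) :
    Integrable (fun ω => cexp (ζ * X ω)) μ := by
  refine (hint ζ.re).mono' (by fun_prop) (Eventually.of_forall fun ω => ?_)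
  rw [Complex.norm_exp]
  simp

lemma abs_le_exp_add_exp (y : ℝ) : |y| ≤ 1 * (Real.exp y + Real.exp (-y)) := by
  have h := exp_mul_abs_le 1 y
  simp only [one_mul, neg_mul] at h ⊢
  linarith [Real.add_one_le_exp |y|]

lemma abs_pow_le_exp_add_exp (n : ℕ) (y : ℝ) :
    |y ^ n| ≤ n.factorial * (Real.exp y + Real.exp (-y)) := by
  have h := exp_mul_abs_le 1 y
  simp only [one_mul, neg_mul] at h
  have h1 := Real.pow_div_factorial_le_exp |y| (abs_nonneg y) n
  rw [div_le_iff₀ (by positivity)] at h1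
  rw [abs_pow]
  calc _ ≤ _ := h1
    _ = n.factorial * Real.exp |y| := mul_comm _ _
    _ ≤ _ := by gcongr

variable {Ω : Type*} [MeasurableSpace Ω] {μ : ℕ → Measure Ω} {X : ℕ → Ω → ℝ} {κ : ℝ≥0}

lemma tendsto_integral_cexp_of_tendsto (hX : ∀ k, Measurable (X k))
    (hint : ∀ k (t : ℝ), Integrable (fun ω => Real.exp (t * X k ω)) (μ k))
    (hlim : ∀ ζ : ℂ, Tendsto (fun k => ∫ ω, cexp (ζ * X k ω) ∂μ k) atTop
      (𝓝 (cexp (κ * ζ ^ 2 / 2)))) {w : ℕ → ℂ} {ζ : ℂ} (hw : Tendsto w atTop (𝓝 ζ)) :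
    Tendsto (fun k => ∫ ω, cexp (w k * X k ω) ∂μ k) atTop (𝓝 (cexp (κ * ζ ^ 2 / 2))) := by
  set R := ‖ζ‖ + 1
  have hbound : Tendsto (fun k => ‖w k - ζ‖ * (∫ ω, Real.exp ((R + 1) * X k ω) ∂μ k +
      ∫ ω, Real.exp (-(R + 1) * X k ω) ∂μ k)) atTop (𝓝 0) := by
    have h1 := ((tendsto_integral_exp hlim (R + 1)).add (tendsto_integral_exp hlim (-(R + 1))))
    have h2 := (tendsto_iff_norm_sub_tendsto_zero.1 hw).mul h1
    rwa [zero_mul] at h2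
  have hdiff : Tendsto (fun k => ∫ ω, cexp (w k * X k ω) ∂μ k - ∫ ω, cexp (ζ * X k ω) ∂μ k)
      atTop (𝓝 0) := by
    refine squeeze_zero_norm' ?_ hbound
    filter_upwards [hw.norm.eventually_lt_const (lt_add_one ‖ζ‖)] with k hk
    rw [← integral_sub (integrable_cexp_mul (hX k) (hint k) _)
      (integrable_cexp_mul (hX k) (hint k) _), ← integral_add (hint k _) (hint k _),
      ← integral_const_mul]
    exact norm_integral_le_of_norm_le (((hint k _).add (hint k _)).const_mul _)
      (Eventually.of_forall fun ω => norm_cexp_mul_sub_le hk.le (lt_add_one ‖ζ‖).le _)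
  simpa using hdiff.add (hlim ζ)

variable [∀ k, IsProbabilityMeasure (μ k)]

/-- If the moment generating functions of `X k` converge to that of a nondegenerate centred
Gaussian, then the expectations of functions of at most exponential growth of the standardization
of `X k` converge to those of the standard Gaussian. -/
theorem tendsto_integral_standardized (hX : ∀ k, Measurable (X k))
    (hint : ∀ k (t : ℝ), Integrable (fun ω => Real.exp (t * X k ω)) (μ k)) (hκ : 0 < κ)
    (hlim : ∀ ζ : ℂ, Tendsto (fun k => ∫ ω, cexp (ζ * X k ω) ∂μ k) atTop
      (𝓝 (cexp (κ * ζ ^ 2 / 2)))) {f : ℝ → ℝ} (hf : Continuous f) {B : ℝ}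
    (hB : ∀ y, |f y| ≤ B * (Real.exp y + Real.exp (-y))) :
    Tendsto (fun k => ∫ ω, f ((X k ω - ∫ ω, X k ω ∂μ k) /
      √(∫ ω, X k ω ^ 2 ∂μ k - (∫ ω, X k ω ∂μ k) ^ 2)) ∂μ k) atTop
      (𝓝 (∫ y, f y ∂gaussianReal 0 1)) := by
  have hmean : Tendsto (fun k => ∫ ω, X k ω ∂μ k) atTop (𝓝 0) := by
    simpa using tendsto_integral_of_tendsto_exp hX hint hlim continuous_id
      (fun y => abs_le_exp_add_exp y)
  have hsq : Tendsto (fun k => ∫ ω, X k ω ^ 2 ∂μ k) atTop (𝓝 κ) := by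
    have h1 := tendsto_integral_of_tendsto_exp hX hint hlim (continuous_pow 2)
      (fun y => abs_pow_le_exp_add_exp 2 y)
    have h2 : ∫ y, y ^ 2 ∂gaussianReal 0 κ = κ := by
      have h3 := variance_fun_id_gaussianReal (μ := 0) (v := κ)
      rwa [variance_eq_integral measurable_id'.aemeasurable, integral_id_gaussianReal,
        show (fun y : ℝ => (y - 0) ^ 2) = fun y => y ^ 2 by simp] at h3
    rwa [h2] at h1
  set m := fun k => ∫ ω, X k ω ∂μ k
  set σ := fun k => √(∫ ω, X k ω ^ 2 ∂μ k - m k ^ 2)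
  have hσ : Tendsto σ atTop (𝓝 √κ) := by
    have h1 := (hsq.sub (hmean.pow 2)).sqrt
    simpa using h1
  have hκ' : √(κ : ℝ) ≠ 0 := (Real.sqrt_pos.2 (by exact_mod_cast hκ)).ne'
  refine tendsto_integral_of_tendsto_exp (X := fun k ω => (X k ω - m k) / σ k)
    (fun k => ((hX k).sub_const _).div_const _) (fun k t => ?_) (fun ζ => ?_) hf hB
  · refine ((hint k (t / σ k)).const_mul (Real.exp (-(t * m k / σ k)))).congr
      (Eventually.of_forall fun ω => ?_)
    simp only
    rw [← Real.exp_add]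
    congr 1
    ring
  · have hw : Tendsto (fun k => ζ / (σ k : ℂ)) atTop (𝓝 (ζ / (√κ : ℝ))) :=
      tendsto_const_nhds.div ((Complex.continuous_ofReal.tendsto _).comp hσ) (by exact_mod_cast hκ')
    have h1 := tendsto_integral_cexp_of_tendsto hX hint hlim hw
    have h2 : Tendsto (fun k => cexp (-(ζ / (σ k : ℂ) * m k))) atTop (𝓝 1) := by
      have h3 := (hw.mul ((Complex.continuous_ofReal.tendsto _).comp hmean)).neg.cexp
      simpa using h3
    have h4 := h2.mul h1
    have h5 : (κ : ℂ) * (ζ / (√κ : ℝ)) ^ 2 / 2 = ((1 : ℝ≥0) : ℂ) * ζ ^ 2 / 2 := by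
      have h6 : ((√κ : ℝ) : ℂ) ^ 2 = κ := by
        rw [← Complex.ofReal_pow, Real.sq_sqrt κ.coe_nonneg]
      have h7 : (κ : ℂ) ≠ 0 := by
        have : (κ : ℝ) ≠ 0 := by exact_mod_cast hκ.ne'
        exact_mod_cast this
      rw [div_pow, h6]
      field_simp
      simp
    rw [one_mul, h5] at h4
    refine h4.congr fun k => ?_
    rw [← integral_const_mul]
    refine integral_congr_ae (Eventually.of_forall fun ω => ?_)
    simp only
    rw [← Complex.exp_add]
    congr 1
    push_cast
    ring

end Standardization

section OrbitLaw

open Complex MeasureTheory ProbabilityTheory Filter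
open scoped Topology NNReal

variable (G : Type*) [Group G] [Group.FG G] (n : ℕ) (x : ℝ)

/-- The partition function of the `x`-biased measure on `Hom(G, S_n)`. -/
noncomputable def orbitPartition : ℝ := ∑ᶠ φ : G →* Equiv.Perm (Fin n), x ^ numOrbits φ

/-- The law of the number of orbits under the `x`-biased measure on `Hom(G, S_n)`. -/
noncomputable def orbitLaw : Measure ℝ :=
  Measure.sum fun φ : G →* Equiv.Perm (Fin n) =>
    ENNReal.ofReal (x ^ numOrbits φ / orbitPartition G n x) • Measure.dirac (numOrbits φ : ℝ)

variable {G n x}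

lemma orbitPartition_pos (hx : 0 < x) : 0 < orbitPartition G n x := by
  have := Fintype.ofFinite (G →* Equiv.Perm (Fin n))
  rw [orbitPartition, finsum_eq_sum_of_fintype]
  exact Finset.sum_pos (fun φ _ => pow_pos hx _) Finset.univ_nonempty

lemma integrable_orbitLaw {E : Type*} [NormedAddCommGroup E] (f : ℝ → E) :
    Integrable f (orbitLaw G n x) := by
  have := Fintype.ofFinite (G →* Equiv.Perm (Fin n))
  rw [orbitLaw, Measure.sum_fintype, integrable_finsetSum_measure]
  exact fun φ _ => (integrable_dirac (by simp)).smul_measure ENNReal.ofReal_ne_top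

lemma integral_orbitLaw {E : Type*} [NormedAddCommGroup E] [NormedSpace ℝ E] [CompleteSpace E]
    (hx : 0 < x) (f : ℝ → E) : ∫ y, f y ∂orbitLaw G n x =
      ∑ᶠ φ : G →* Equiv.Perm (Fin n), (x ^ numOrbits φ / orbitPartition G n x) • f (numOrbits φ) := by
  have := Fintype.ofFinite (G →* Equiv.Perm (Fin n))
  rw [orbitLaw, Measure.sum_fintype, integral_finsetSum_measure, finsum_eq_sum_of_fintype]
  · refine Finset.sum_congr rfl fun φ _ => ?_
    rw [integral_smul_measure, integral_dirac, ENNReal.toReal_ofReal]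
    exact div_nonneg (pow_nonneg hx.le _) (orbitPartition_pos hx).le
  · exact fun φ _ => (integrable_dirac (by simp)).smul_measure ENNReal.ofReal_ne_top

lemma expVal_eq_integral (hx : 0 < x) (f : ℝ → ℝ) :
    expVal G n x f = ∫ y, f y ∂orbitLaw G n x := by
  have := Fintype.ofFinite (G →* Equiv.Perm (Fin n))
  rw [integral_orbitLaw hx, expVal, ← orbitPartition, finsum_eq_sum_of_fintype,
    finsum_eq_sum_of_fintype, Finset.sum_div]
  refine Finset.sum_congr rfl fun φ _ => ?_
  rw [smul_eq_mul]
  ring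

lemma isProbabilityMeasure_orbitLaw (hx : 0 < x) : IsProbabilityMeasure (orbitLaw G n x) := by
  have := Fintype.ofFinite (G →* Equiv.Perm (Fin n))
  have hZ := orbitPartition_pos (G := G) (n := n) hx
  constructor
  rw [orbitLaw, Measure.sum_fintype, Measure.finsetSum_apply]
  simp only [Measure.smul_apply, measure_univ, smul_eq_mul, mul_one]
  rw [← ENNReal.ofReal_sum_of_nonneg fun φ _ => div_nonneg (pow_nonneg hx.le _) hZ.le,
    ← Finset.sum_div, ← finsum_eq_sum_of_fintype, ← orbitPartition, div_self hZ.ne',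
    ENNReal.ofReal_one]

lemma integral_cexp_orbitLaw (hx : 0 < x) (ζ : ℂ) :
    ∫ y, cexp (ζ * y) ∂orbitLaw G n x = orbitSum G n (x * cexp ζ) / orbitSum G n x := by
  have := Fintype.ofFinite (G →* Equiv.Perm (Fin n))
  have hZ : orbitSum G n x = (orbitPartition G n x : ℂ) := by
    rw [orbitSum, orbitPartition, finsum_eq_sum_of_fintype, finsum_eq_sum_of_fintype]
    push_cast
    rfl
  rw [integral_orbitLaw hx, hZ, orbitSum, finsum_eq_sum_of_fintype, finsum_eq_sum_of_fintype,
    Finset.sum_div]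
  refine Finset.sum_congr rfl fun φ _ => ?_
  change _ = ((x : ℂ) * cexp ζ) ^ numOrbits φ / _
  rw [real_smul, mul_pow, ← Complex.exp_nat_mul]
  push_cast
  rw [mul_comm ζ]
  ring

/-- If the moment generating function of an affine normalization of the orbit count converges to
that of a nondegenerate Gaussian, then the standardized orbit count converges to the standard
Gaussian. -/
lemma tendsto_expVal_of_tendsto_orbitSum (hx : 0 < x) {N : ℕ → ℕ} {κ : ℝ} (hκ : 0 < κ)
    {a s : ℕ → ℝ} (hs : ∀ᶠ k in atTop, 0 < s k)
    (hlim : ∀ ζ : ℂ, Tendsto (fun k => cexp (-(ζ * (a k / s k : ℝ))) *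
      (orbitSum G (N k) (x * cexp (ζ / s k)) / orbitSum G (N k) x)) atTop
      (𝓝 (cexp (κ * ζ ^ 2 / 2)))) {f : ℝ → ℝ} (hf : Continuous f) {B : ℝ}
    (hB : ∀ y, |f y| ≤ B * (Real.exp y + Real.exp (-y))) :
    Tendsto (fun k => expVal G (N k) x fun y => f ((y - expVal G (N k) x id) /
      √(expVal G (N k) x (fun y => y ^ 2) - expVal G (N k) x id ^ 2))) atTop
      (𝓝 (∫ y, f y ∂gaussianReal 0 1)) := by
  have hprob : ∀ k, IsProbabilityMeasure (orbitLaw G (N k) x) :=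
    fun k => isProbabilityMeasure_orbitLaw hx
  lift κ to ℝ≥0 using hκ.le
  have hstd := tendsto_integral_standardized (μ := fun k => orbitLaw G (N k) x)
    (X := fun k y => (y - a k) / s k) (fun k => by fun_prop) (fun k t => integrable_orbitLaw _)
    (by exact_mod_cast hκ) (fun ζ => (hlim ζ).congr fun k => ?_) hf hB
  · refine hstd.congr' (hs.mono fun k hk => ?_)
    simp only [expVal_eq_integral hx, id]
    set m := ∫ y, y ∂orbitLaw G (N k) x
    set q := ∫ y, y ^ 2 ∂orbitLaw G (N k) x
    have h1 : ∫ y, (y - a k) / s k ∂orbitLaw G (N k) x = (m - a k) / s k := by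
      rw [integral_div, integral_sub (integrable_orbitLaw _) (integrable_orbitLaw _)]
      simp [m]
    have h2 : ∫ y, ((y - a k) / s k) ^ 2 ∂orbitLaw G (N k) x =
        (q - 2 * a k * m + a k ^ 2) / s k ^ 2 := by
      simp only [div_pow]
      rw [integral_div]
      congr 1
      have h3 : ∀ y, (y - a k) ^ 2 = y ^ 2 - 2 * a k * y + a k ^ 2 := fun y => by ring
      simp only [h3]
      rw [integral_add (integrable_orbitLaw _) (integrable_orbitLaw _),
        integral_sub (integrable_orbitLaw _) (integrable_orbitLaw _), integral_const_mul]
      simp [m, q]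
    rw [h1, h2]
    have h4 : (q - 2 * a k * m + a k ^ 2) / s k ^ 2 - ((m - a k) / s k) ^ 2 =
        (q - m ^ 2) / s k ^ 2 := by
      ring
    rw [h4, Real.sqrt_div' _ (by positivity), Real.sqrt_sq hk.le]
    refine integral_congr_ae (Eventually.of_forall fun y => ?_)
    simp only
    congr 1
    rw [← sub_div, div_div_div_cancel_right₀ hk.ne']
    ring_nf
  · rw [← integral_cexp_orbitLaw hx, ← integral_const_mul]
    refine integral_congr_ae (Eventually.of_forall fun y => ?_)
    simp only
    rw [← Complex.exp_add]
    congr 1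
    push_cast
    ring

lemma integral_gaussianReal_zero_one (f : ℝ → ℝ) : ∫ y, f y ∂gaussianReal 0 1 =
    (√(2 * Real.pi))⁻¹ * ∫ s : ℝ, f s * Real.exp (-(s ^ 2) / 2) := by
  rw [integral_gaussianReal_eq_integral_smul one_ne_zero, ← integral_const_mul]
  refine integral_congr_ae (Eventually.of_forall fun y => ?_)
  simp [gaussianPDFReal]
  ring

lemma exists_continuous_abs_le_exp {f : ℝ → ℝ}
    (hf : (Continuous f ∧ ∃ M : ℝ, ∀ y : ℝ, |f y| ≤ M) ∨
      (∃ p : Polynomial ℝ, ∀ y : ℝ, f y = p.eval y)) :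
    Continuous f ∧ ∃ B : ℝ, ∀ y, |f y| ≤ B * (Real.exp y + Real.exp (-y)) := by
  rcases hf with ⟨hf, M, hM⟩ | ⟨p, hp⟩
  · refine ⟨hf, M, fun y => (hM y).trans ?_⟩
    have h1 := abs_pow_le_exp_add_exp 0 y
    simp only [pow_zero, abs_one, Nat.factorial_zero, Nat.cast_one, one_mul] at h1
    exact le_mul_of_one_le_right ((abs_nonneg _).trans (hM 0)) h1
  · obtain rfl : f = fun y => p.eval y := funext hp
    refine ⟨p.continuous, ∑ i ∈ p.support, |p.coeff i| * i.factorial, fun y => ?_⟩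
    rw [hp, Polynomial.eval_eq_sum, Polynomial.sum, Finset.sum_mul]
    refine (Finset.abs_sum_le_sum_abs _ _).trans (Finset.sum_le_sum fun i _ => ?_)
    rw [abs_mul, mul_assoc]
    exact mul_le_mul_of_nonneg_left (abs_pow_le_exp_add_exp i y) (abs_nonneg _)

end OrbitLaw

theorem clt_for_orbit_counts
    (G : Type*) [Group G] [Group.FG G]
    (c : ℝ) (hc : 0 < c) (hgrowth : ∀ n : ℕ, 1 ≤ n → c * n ≤ (aCount G n : ℝ))
    (α : ℝ) (hα : 2 ≤ α) (m : ℕ) (hm : 1 ≤ m) (γ : ℝ) (hγ : 0 < γ)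
    (ν : ℕ → ℂ) (Φ : ℂ → ℂ)
    (hΦc : ContinuousOn Φ {s : ℂ | α ≤ s.re})
    (hΦd : DifferentiableOn ℂ Φ {s : ℂ | α < s.re})
    (hsum : ∀ s : ℂ, α < s.re →
      Summable fun δ : ℕ => ‖(aCount G (δ + 1) : ℂ) * ((δ + 1 : ℕ) : ℂ) ^ (-s)‖)
    (hval : ∀ s : ℂ, α < s.re →
      ∑' δ : ℕ, (aCount G (δ + 1) : ℂ) * ((δ + 1 : ℕ) : ℂ) ^ (-s) =
        (γ : ℂ) / (s - (α : ℂ)) ^ m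
          + (∑ j ∈ Finset.Icc 1 (m - 1), ν j / (s - (α : ℂ)) ^ j) + Φ s)
    (x : ℝ) (hx : 0 < x)
    (f : ℝ → ℝ)
    (hf : (Continuous f ∧ ∃ M : ℝ, ∀ y : ℝ, |f y| ≤ M) ∨
      (∃ p : Polynomial ℝ, ∀ y : ℝ, f y = p.eval y)) :
    Filter.Tendsto
      (fun n : ℕ =>
        expVal G n x (fun y =>
          f ((y - expVal G n x id) /
            Real.sqrt (expVal G n x (fun y => y ^ 2) - (expVal G n x id) ^ 2))))
      Filter.atTop
      (nhds ((Real.sqrt (2 * Real.pi))⁻¹ * ∫ s : ℝ, f s * Real.exp (-(s ^ 2) / 2))) := by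
  obtain ⟨hfc, B, hB⟩ := exists_continuous_abs_le_exp hf
  obtain ⟨S, A, hSA⟩ := exists_aCount_div_le hsum
  have hb0 : (aCount G 0 : ℝ) / ((0 : ℕ) : ℝ) = 0 := by simp
  obtain ⟨η, C, u₀, hη0, hη1, hC, hu₀, hlap⟩ :=
    HasPoleExpansion.exists_laplace_le_window (b := fun δ => (aCount G δ : ℝ) / δ) hα
      (fun δ => by positivity) hb0 hSA (hasPoleExpansion_aCount hm hγ hΦc hsum hval)
  have hW : WindowDominated (fun δ => (aCount G δ : ℝ) / δ) c S A η C u₀ :=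
    { zero := hb0
      c_pos := hc
      le_weight := fun δ hδ => (le_div_iff₀ (by exact_mod_cast hδ)).2 (hgrowth δ hδ)
      weight_le := hSA
      η_pos := hη0
      η_lt_one := hη1
      C_pos := hC
      u₀_pos := hu₀
      laplace_le := hlap }
  have hrec : ∀ (y : ℂ) (n : ℕ), orbitSum G (n + 1) y = y * ∑ k ∈ Finset.range (n + 1),
      ((k + 1 : ℕ) * ((aCount G (k + 1) : ℝ) / ((k + 1 : ℕ) : ℝ) : ℝ) : ℂ) *
        (n.descFactorial k : ℂ) * orbitSum G (n - k) y := by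
    intro y n
    rw [orbitSum_succ]
    congr 1
    refine Finset.sum_congr rfl fun k _ => ?_
    congr 2
    push_cast
    rw [mul_div_cancel₀]
    exact_mod_cast k.succ_ne_zero
  rw [← integral_gaussianReal_zero_one]
  refine Filter.tendsto_of_subseq_tendsto fun N hN => ?_
  obtain ⟨φ, κ, a, s, -, hκ, hs, hlim⟩ := hW.exists_subseq_tendsto
    (f := fun y n => orbitSum G n y) (fun y => orbitSum_zero y) hrec hx hN
  exact ⟨φ, tendsto_expVal_of_tendsto_orbitSum hx (N := fun k => N (φ k)) hκ hs hlim hfc hB⟩
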